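/- Let 𝒜 ⊂ ℕ be finite with at least two elements and let μ be a Gibbs measure for the Gauss map restricted to the set B(𝒜) of 𝒜-badly approximable numbers, with Hausdorff dimension dim μ = h_μ/λ_μ > 1/2. Then there exists η > 0 such that |μ̂(ξ)| = O(|ξ|^{−η}) as |ξ| → ∞. -/

import Mathlib

open MeasureTheory Filter Set Topology
open scoped ENNReal NNReal Classical Real

noncomputable section

/-- The Gauss map `T(x) = 1/x mod 1`. -/
def gaussMap (x : ℝ) : ℝ := Int.fract x⁻¹

/-- The space `X = [0,1] ∖ ℚ` of irrational numbers in the unit interval. -/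
def gaussSet : Set ℝ := {x | x ∈ Set.Icc (0:ℝ) 1 ∧ Irrational x}

/-- The first continued fraction digit `a₁(x) = ⌊1/x⌋`. -/
def cfDigit1 (x : ℝ) : ℕ := ⌊x⁻¹⌋₊

/-- The `(i+1)`-th continued fraction digit `a_{i+1}(x) = a₁(Tⁱ x)`. -/
def cfDigit (i : ℕ) (x : ℝ) : ℕ := cfDigit1 (gaussMap^[i] x)

/-- The inverse branch `T_a(x) = 1/(x+a)` of the Gauss map. -/
def invBranch1 (a : ℕ) (x : ℝ) : ℝ := (x + (a : ℝ))⁻¹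

/-- The composed inverse branch `T_𝐚 = T_{a₁} ∘ ⋯ ∘ T_{aₙ}` for `𝐚 = [a₁,…,aₙ]`. -/
def invBranch (l : List ℕ) (x : ℝ) : ℝ := l.foldr invBranch1 x

/-- The cylinder set `I_𝐚` of points of `X` whose first digits are given by `𝐚`. -/
def cylinder (l : List ℕ) : Set ℝ :=
  {x | x ∈ gaussSet ∧ ∀ i : Fin l.length, cfDigit i.1 x = l.get i}

/-- The Birkhoff sum `S_n φ = ∑_{k<n} φ ∘ T^k`. -/
def birkhoff (φ : ℝ → ℝ) (n : ℕ) (x : ℝ) : ℝ :=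
  ∑ k ∈ Finset.range n, φ (gaussMap^[k] x)

/-- The pair `(pₙ(𝐚), qₙ(𝐚))` of numerator and denominator (continuant) of the
finite continued fraction `[a₁,…,aₙ] = pₙ/qₙ`. -/
def contPQ : List ℕ → ℕ × ℕ
  | [] => (0, 1)
  | a :: l => ((contPQ l).2, a * (contPQ l).2 + (contPQ l).1)

/-- The continuant `qₙ(𝐚)`, the denominator of `[a₁,…,aₙ]` in lowest terms. -/
def contQ (l : List ℕ) : ℕ := (contPQ l).2

/-- Words of length `n` with digits in `ℕ = {1,2,…}`. -/
def Word (n : ℕ) : Type := {l : List ℕ // l.length = n ∧ ∀ a ∈ l, 0 < a}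

/-- The periodic point `𝐚^∞` with periodic continued fraction expansion repeating `𝐚`. -/
def periodicPoint (l : List ℕ) : ℝ :=
  limUnder atTop fun k : ℕ => invBranch (List.flatten (List.replicate k l)) (1/2 : ℝ)

/-- The `n`-th partition sum `∑_{𝐚 ∈ ℕⁿ} exp(S_nφ(𝐚^∞))` appearing in the pressure. -/
def partSum (φ : ℝ → ℝ) (n : ℕ) : ℝ≥0∞ :=
  ∑' l : Word n, ENNReal.ofReal (Real.exp (birkhoff φ n (periodicPoint l.1)))

/-- `φ` has (finite) pressure `P(φ) = p`, i.e. `(1/n) log ∑_{𝐚∈ℕⁿ} exp(S_nφ(𝐚^∞)) → p`. -/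
def HasPressure (φ : ℝ → ℝ) (p : ℝ) : Prop :=
  (∀ n : ℕ, 0 < n → partSum φ n ≠ ⊤) ∧
    Tendsto (fun n : ℕ => Real.log (partSum φ n).toReal / (n : ℝ)) atTop (𝓝 p)

/-- The pressure of `φ` is finite: `P(φ) < ∞`. -/
def PressureFinite (φ : ℝ → ℝ) : Prop := ∃ p : ℝ, HasPressure φ p

/-- `φ` is locally Hölder: oscillation on `n`-cylinders decays geometrically. -/
def LocHolder (φ : ℝ → ℝ) : Prop :=
  ∃ C > (0:ℝ), ∃ θ ∈ Set.Ioo (0:ℝ) 1, ∀ l : List ℕ, l ≠ [] → (∀ a ∈ l, 0 < a) →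
    ∀ x ∈ cylinder l, ∀ y ∈ cylinder l, |φ x - φ y| ≤ C * θ ^ l.length

/-- The normalization `𝓛_φ 1 = 1` of the Ruelle transfer operator of `φ`. -/
def TransferNormalized (φ : ℝ → ℝ) : Prop :=
  ∀ x ∈ gaussSet, ∑' a : ℕ+, Real.exp (φ (invBranch1 (a : ℕ) x)) = 1

/-- `μ` is invariant under the Gauss map. -/
def GaussInvariant (μ : Measure ℝ) : Prop :=
  ∀ s : Set ℝ, MeasurableSet s → μ (gaussMap ⁻¹' s) = μ s

/-- The Gibbs property for the potential `φ` (with `P(φ) = 0`):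
`C⁻¹ e^{S_nφ(T_𝐚 x)} ≤ μ(I_𝐚) ≤ C e^{S_nφ(T_𝐚 x)}`. -/
def IsGibbs (φ : ℝ → ℝ) (μ : Measure ℝ) : Prop :=
  ∃ C : ℝ, 1 ≤ C ∧ ∀ l : List ℕ, l ≠ [] → (∀ a ∈ l, 0 < a) → ∀ x ∈ gaussSet,
    C⁻¹ * Real.exp (birkhoff φ l.length (invBranch l x)) ≤ (μ (cylinder l)).toReal ∧
      (μ (cylinder l)).toReal ≤ C * Real.exp (birkhoff φ l.length (invBranch l x))

/-- The Kolmogorov–Sinai entropy of `μ`: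
`h = lim (1/n) ∑_{𝐚∈ℕⁿ} -μ(I_𝐚) log μ(I_𝐚)`. -/
def HasEntropy (μ : Measure ℝ) (h : ℝ) : Prop :=
  Tendsto (fun n : ℕ => (∑' l : Word n, Real.negMulLog (μ (cylinder l.1)).toReal) / (n : ℝ))
    atTop (𝓝 h)

/-- `log |T'| (x) = log (1/x²)` for the Gauss map. -/
def logAbsDerivGauss (x : ℝ) : ℝ := Real.log (1 / x ^ 2)

/-- The observable `ψ = -log |T'|`. -/
def gaussPsi (x : ℝ) : ℝ := -Real.log (1 / x ^ 2)

/-- The Lyapunov exponent `λ_μ = ∫ log|T'| dμ`. -/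
def lyapunov (μ : Measure ℝ) : ℝ := ∫ x, logAbsDerivGauss x ∂μ

/-- The polynomial tail condition `μ({x : a₁(x) ≥ n}) = O(n^{-δ})`. -/
def PolyTail (μ : Measure ℝ) : Prop :=
  ∃ δ > (0:ℝ), ∃ K : ℝ, ∀ n : ℕ, 0 < n →
    (μ {x | x ∈ gaussSet ∧ n ≤ cfDigit1 x}).toReal ≤ K * (n : ℝ) ^ (-δ)

/-- The Fourier transform `μ̂(ξ) = ∫ e^{-2πiξx} dμ(x)`. -/
def muFourier (μ : Measure ℝ) (ξ : ℝ) : ℂ :=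
  ∫ x, Complex.exp (-(2 * Real.pi * ξ * x : ℝ) * Complex.I) ∂μ

/-- A sequence `u` equidistributes modulo 1. -/
def EquidistributedMod1 (u : ℕ → ℝ) : Prop :=
  ∀ a b : ℝ, 0 ≤ a → a ≤ b → b ≤ 1 →
    Tendsto (fun N : ℕ =>
        (((Finset.range N).filter fun k => Int.fract (u k) ∈ Set.Ico a b).card : ℝ) / (N : ℝ))
      atTop (𝓝 (b - a))

/-- The set `B(𝒜)` of `𝒜`-badly approximable numbers: all digits lie in `𝒜`. -/
def badSet (A : Finset ℕ) : Set ℝ := {x | x ∈ gaussSet ∧ ∀ i : ℕ, cfDigit i x ∈ A}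

/-- Locally Hölder on the subsystem `B(𝒜)`. -/
def LocHolderOn (A : Finset ℕ) (φ : ℝ → ℝ) : Prop :=
  ∃ C > (0:ℝ), ∃ θ ∈ Set.Ioo (0:ℝ) 1, ∀ l : List ℕ, l ≠ [] → (∀ a ∈ l, a ∈ A) →
    ∀ x ∈ cylinder l ∩ badSet A, ∀ y ∈ cylinder l ∩ badSet A,
      |φ x - φ y| ≤ C * θ ^ l.length

/-- The Gibbs property for the Gauss map restricted to `B(𝒜)`. -/
def IsGibbsOn (A : Finset ℕ) (φ : ℝ → ℝ) (μ : Measure ℝ) : Prop :=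
  ∃ C : ℝ, 1 ≤ C ∧ ∀ l : List ℕ, l ≠ [] → (∀ a ∈ l, a ∈ A) → ∀ x ∈ badSet A,
    C⁻¹ * Real.exp (birkhoff φ l.length (invBranch l x)) ≤ (μ (cylinder l)).toReal ∧
      (μ (cylinder l)).toReal ≤ C * Real.exp (birkhoff φ l.length (invBranch l x))

/-- The `n`-regular set `A_n(ε)` of the large deviation decomposition. -/
def regSet (φ : ℝ → ℝ) (lam s ε : ℝ) (n : ℕ) : Set ℝ :=
  {x | |birkhoff gaussPsi n x / (n : ℝ) + lam| < ε ∧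
       |birkhoff φ n x / birkhoff gaussPsi n x - s| < ε}

/-- The collection `𝓡ₙ` of `n`-regular words. -/
def regWords (φ : ℝ → ℝ) (lam s ε : ℝ) (n : ℕ) : Set (List ℕ) :=
  {l | l.length = n ∧ (∀ a ∈ l, 0 < a) ∧
       ∀ k : ℕ, n / 2 ≤ k → k ≤ n → cylinder (l.take k) ⊆ regSet φ lam s ε k}

/-- The union `Rₙ` of the `n`-regular cylinders. -/
def regUnion (φ : ℝ → ℝ) (lam s ε : ℝ) (n : ℕ) : Set ℝ :=
  ⋃ l ∈ regWords φ lam s ε n, cylinder l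

end

namespace GaussGibbs

/-! ### Symbolic dynamics on the one-sided full shift -/

section Symbolic

variable {ι : Type*}

/-- Prepend a letter to an infinite sequence. -/
def scons (a : ι) (y : ℕ → ι) : ℕ → ι
  | 0 => a
  | n + 1 => y n

/-- The left shift. -/
def shift (y : ℕ → ι) : ℕ → ι := fun n => y (n + 1)

/-- Prepend a finite word to an infinite sequence. -/
def app (l : List ι) (y : ℕ → ι) : ℕ → ι := l.foldr scons y

/-- The first `n` letters of a sequence. -/
def pre : ℕ → (ℕ → ι) → List ι
  | 0, _ => []
  | n + 1, y => y 0 :: pre n (shift y)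

/-- The cylinder of sequences that begin with a given word. -/
def cyl : List ι → Set (ℕ → ι)
  | [] => Set.univ
  | a :: l => {y | y 0 = a ∧ shift y ∈ cyl l}

/-- The Birkhoff sum of `f` along the letters of `l`, at the point `app l y`. -/
def bs (f : (ℕ → ι) → ℝ) : List ι → (ℕ → ι) → ℝ
  | [], _ => 0
  | a :: l, y => f (app (a :: l) y) + bs f l y

/-- Sequences that agree in the first `n` letters have `f`-values within `C θ ^ n`. -/
def Hol (C θ : ℝ) (f : (ℕ → ι) → ℝ) : Prop :=
  ∀ (n : ℕ) (x y : ℕ → ι), (∀ i < n, x i = y i) → |f x - f y| ≤ C * θ ^ n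

@[simp] lemma scons_zero (a : ι) (y : ℕ → ι) : scons a y 0 = a := rfl
@[simp] lemma scons_succ (a : ι) (y : ℕ → ι) (n : ℕ) : scons a y (n + 1) = y n := rfl
@[simp] lemma shift_scons (a : ι) (y : ℕ → ι) : shift (scons a y) = y := rfl
@[simp] lemma scons_shift (y : ℕ → ι) : scons (y 0) (shift y) = y := by
  funext n; cases n <;> rfl
@[simp] lemma app_nil (y : ℕ → ι) : app [] y = y := rfl
@[simp] lemma app_cons (a : ι) (l : List ι) (y : ℕ → ι) :
    app (a :: l) y = scons a (app l y) := rfl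
lemma app_append (u v : List ι) (y : ℕ → ι) : app (u ++ v) y = app u (app v y) := by
  simp [app]
@[simp] lemma bs_nil (f : (ℕ → ι) → ℝ) (y : ℕ → ι) : bs f [] y = 0 := rfl
@[simp] lemma bs_cons (f : (ℕ → ι) → ℝ) (a : ι) (l : List ι) (y : ℕ → ι) :
    bs f (a :: l) y = f (scons a (app l y)) + bs f l y := rfl
@[simp] lemma cyl_nil : cyl ([] : List ι) = Set.univ := rfl
lemma mem_cyl_cons {a : ι} {l : List ι} {y : ℕ → ι} :
    y ∈ cyl (a :: l) ↔ y 0 = a ∧ shift y ∈ cyl l := Iff.rfl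

lemma bs_append (f : (ℕ → ι) → ℝ) (u v : List ι) (y : ℕ → ι) :
    bs f (u ++ v) y = bs f u (app v y) + bs f v y := by
  induction u with
  | nil => simp
  | cons a u ih => simp [ih, app_append, add_assoc]

@[simp] lemma pre_length (n : ℕ) (y : ℕ → ι) : (pre n y).length = n := by
  induction n generalizing y with
  | zero => rfl
  | succ n ih => simp [pre, ih]

lemma shift_iterate (n : ℕ) (y : ℕ → ι) (i : ℕ) : shift^[n] y i = y (i + n) := by
  induction n generalizing y with
  | zero => rfl
  | succ n ih => rw [Function.iterate_succ_apply, ih]; simp [shift]; ring_nf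

lemma app_pre (n : ℕ) (y : ℕ → ι) : app (pre n y) (shift^[n] y) = y := by
  induction n generalizing y with
  | zero => rfl
  | succ n ih => rw [Function.iterate_succ_apply]; simp [pre, ih]

lemma pre_app (l : List ι) (y : ℕ → ι) : pre l.length (app l y) = l := by
  induction l with
  | nil => rfl
  | cons a l ih => simp [pre, ih]

lemma shift_iterate_app (l : List ι) (y : ℕ → ι) : shift^[l.length] (app l y) = y := by
  induction l with
  | nil => rfl
  | cons a l ih => simp [ih]

lemma mem_cyl_iff {l : List ι} {y : ℕ → ι} : y ∈ cyl l ↔ pre l.length y = l := by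
  induction l generalizing y with
  | nil => simp [pre]
  | cons a l ih => simp [mem_cyl_cons, pre, ih]

lemma mem_cyl_pre (n : ℕ) (y : ℕ → ι) : y ∈ cyl (pre n y) := by
  simp [mem_cyl_iff]

lemma app_mem_cyl (l : List ι) (y : ℕ → ι) : app l y ∈ cyl l := by
  simp [mem_cyl_iff, pre_app]

lemma mem_cyl_append {u v : List ι} {y : ℕ → ι} :
    y ∈ cyl (u ++ v) ↔ y ∈ cyl u ∧ shift^[u.length] y ∈ cyl v := by
  induction u generalizing y with
  | nil => simp
  | cons a u ih => simp [mem_cyl_cons, ih, and_assoc]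

lemma app_mem_cyl_append {l u v : List ι} (h : l.length = u.length) {y : ℕ → ι} :
    app l y ∈ cyl (u ++ v) ↔ l = u ∧ y ∈ cyl v := by
  rw [mem_cyl_append, mem_cyl_iff, ← h, pre_app, shift_iterate_app]

lemma app_mem_cyl_iff {l u : List ι} (h : l.length = u.length) {y : ℕ → ι} :
    app l y ∈ cyl u ↔ l = u := by
  simpa using app_mem_cyl_append (v := []) h (y := y)

lemma eq_of_mem_cyl {l : List ι} {x y : ℕ → ι} (hx : x ∈ cyl l) (hy : y ∈ cyl l) :
    ∀ i < l.length, x i = y i := by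
  induction l generalizing x y with
  | nil => simp
  | cons a l ih =>
    intro i hi
    cases i with
    | zero => rw [hx.1, hy.1]
    | succ i => exact ih hx.2 hy.2 i (by simpa using hi)

lemma mem_cyl_of_agree {l : List ι} {x y : ℕ → ι} (hx : x ∈ cyl l)
    (h : ∀ i < l.length, y i = x i) : y ∈ cyl l := by
  induction l generalizing x y with
  | nil => simp
  | cons a l ih =>
    refine ⟨by rw [h 0 (by simp), hx.1], ih hx.2 ?_⟩
    intro i hi
    exact h (i + 1) (by simpa using hi)

lemma app_agree {l : List ι} {x y : ℕ → ι} {k : ℕ} (h : ∀ i < k, x i = y i) :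
    ∀ i < l.length + k, app l x i = app l y i := by
  induction l with
  | nil => simpa using h
  | cons a l ih =>
    intro i hi
    cases i with
    | zero => rfl
    | succ i => exact ih i (by simp at hi; omega)

lemma bs_eq_birkhoffSum (f : (ℕ → ι) → ℝ) (l : List ι) (y : ℕ → ι) :
    bs f l y = birkhoffSum shift f l.length (app l y) := by
  induction l with
  | nil => simp
  | cons a l ih => simp [birkhoffSum_succ', ih]

lemma birkhoffSum_eq_bs (f : (ℕ → ι) → ℝ) (n : ℕ) (y : ℕ → ι) :
    birkhoffSum shift f n y = bs f (pre n y) (shift^[n] y) := by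
  rw [bs_eq_birkhoffSum, app_pre, pre_length]

lemma Hol.bs_le {C θ : ℝ} {f : (ℕ → ι) → ℝ} (hf : Hol C θ f) (hC : 0 ≤ C) (h0 : 0 < θ)
    (h1 : θ < 1) (l : List ι) {k : ℕ} {x y : ℕ → ι} (h : ∀ i < k, x i = y i) :
    |bs f l x - bs f l y| ≤ C / (1 - θ) * θ ^ k := by
  have key : |bs f l x - bs f l y| ≤ C / (1 - θ) * θ ^ k * (1 - θ ^ l.length) := by
    induction l with
    | nil => simp
    | cons a l ih =>
      have h2 : |f (scons a (app l x)) - f (scons a (app l y))| ≤ C * θ ^ (l.length + 1 + k) :=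
        hf _ _ _ (app_agree (l := a :: l) h)
      have h3 : C / (1 - θ) * θ ^ k * (1 - θ ^ (l.length + 1)) =
          C / (1 - θ) * θ ^ k * (1 - θ ^ l.length) + C * θ ^ (l.length + k) := by
        have : 1 - θ ≠ 0 := by linarith
        field_simp
        ring
      have h4 : C * θ ^ (l.length + 1 + k) ≤ C * θ ^ (l.length + k) := by
        apply mul_le_mul_of_nonneg_left _ hC
        exact pow_le_pow_of_le_one h0.le h1.le (by omega)
      simp only [bs_cons, List.length_cons]
      rw [h3]
      have : f (scons a (app l x)) + bs f l x - (f (scons a (app l y)) + bs f l y)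
        = (bs f l x - bs f l y) + (f (scons a (app l x)) - f (scons a (app l y))) := by ring
      rw [this]
      exact (abs_add_le _ _).trans (add_le_add ih (h2.trans h4))
  refine key.trans ?_
  have : 0 ≤ C / (1 - θ) * θ ^ k := by
    have : 0 < 1 - θ := by linarith
    positivity
  nlinarith [pow_pos h0 l.length]

lemma Hol.add {C₁ C₂ θ : ℝ} {f g : (ℕ → ι) → ℝ} (hf : Hol C₁ θ f) (hg : Hol C₂ θ g) :
    Hol (C₁ + C₂) θ (fun y => f y + g y) := by
  intro n x y h
  have := hf n x y h
  have := hg n x y h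
  calc |f x + g x - (f y + g y)| = |(f x - f y) + (g x - g y)| := by ring_nf
    _ ≤ |f x - f y| + |g x - g y| := abs_add_le _ _
    _ ≤ _ := by linarith

lemma Hol.const_mul {C θ : ℝ} {f : (ℕ → ι) → ℝ} (hf : Hol C θ f) (c : ℝ) :
    Hol (|c| * C) θ (fun y => c * f y) := by
  intro n x y h
  rw [← mul_sub, abs_mul, mul_assoc]
  exact mul_le_mul_of_nonneg_left (hf n x y h) (abs_nonneg c)

lemma Hol.add_const {C θ : ℝ} {f : (ℕ → ι) → ℝ} (hf : Hol C θ f) (c : ℝ) :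
    Hol C θ (fun y => f y + c) := by
  intro n x y h
  simpa using hf n x y h

lemma Hol.mono_exp {C θ θ' : ℝ} {f : (ℕ → ι) → ℝ} (hf : Hol C θ f) (hC : 0 ≤ C)
    (h0 : 0 ≤ θ) (h : θ ≤ θ') : Hol C θ' f := by
  intro n x y hxy
  exact (hf n x y hxy).trans (mul_le_mul_of_nonneg_left (pow_le_pow_left₀ h0 h n) hC)

lemma Hol.continuous [TopologicalSpace ι] [DiscreteTopology ι] {C θ : ℝ}
    {f : (ℕ → ι) → ℝ} (hf : Hol C θ f) (h0 : 0 ≤ θ) (h1 : θ < 1) : Continuous f := by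
  rw [continuous_iff_continuousAt]
  intro x
  rw [Metric.continuousAt_iff']
  intro ε hε
  have ht : Tendsto (fun n : ℕ => C * θ ^ n) atTop (𝓝 (C * 0)) :=
    (tendsto_pow_atTop_nhds_zero_of_lt_one h0 h1).const_mul C
  rw [mul_zero] at ht
  obtain ⟨n, hn⟩ := ((tendsto_order.1 ht).2 ε hε).exists
  have : ∀ᶠ y in 𝓝 x, ∀ i < n, y i = x i := by
    have : ∀ i ∈ Finset.range n, ∀ᶠ y in 𝓝 x, y i = x i := by
      intro i _
      have ho : IsOpen ((fun y : ℕ → ι => y i) ⁻¹' {x i}) :=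
        (isOpen_discrete {x i}).preimage (continuous_apply i)
      exact ho.mem_nhds rfl
    filter_upwards [(Filter.eventually_all_finset (Finset.range n)).2 this] with y hy i hi
    exact hy i (Finset.mem_range.2 hi)
  filter_upwards [this] with y hy
  rw [Real.dist_eq]
  exact (hf n y x hy).trans_lt hn

lemma continuous_scons [TopologicalSpace ι] (a : ι) : Continuous (scons a) := by
  refine continuous_pi fun n => ?_
  cases n with
  | zero => exact continuous_const
  | succ n => exact continuous_apply n

lemma continuous_app [TopologicalSpace ι] (l : List ι) :
    Continuous (app l : (ℕ → ι) → (ℕ → ι)) := by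
  induction l with
  | nil => exact continuous_id
  | cons a l ih => exact (continuous_scons a).comp ih

lemma continuous_shift [TopologicalSpace ι] : Continuous (shift : (ℕ → ι) → (ℕ → ι)) :=
  continuous_pi fun n => continuous_apply (n + 1)

lemma continuous_bs [TopologicalSpace ι] {f : (ℕ → ι) → ℝ} (hf : Continuous f) (l : List ι) :
    Continuous (bs f l) := by
  induction l with
  | nil => exact continuous_const
  | cons a l ih => exact (hf.comp (continuous_app (a :: l))).add ih

lemma isClopen_cyl [TopologicalSpace ι] [DiscreteTopology ι] (l : List ι) :
    IsClopen (cyl l) := by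
  induction l with
  | nil => exact isClopen_univ
  | cons a l ih =>
    exact ((isClopen_discrete {a}).preimage (continuous_apply 0)).inter
      (ih.preimage continuous_shift)

variable [Fintype ι]

/-- The finite set of words of length `n`. -/
noncomputable def words (ι : Type*) [Fintype ι] (n : ℕ) : Finset (List ι) :=
  (Finset.univ : Finset (Fin n → ι)).map ⟨List.ofFn, List.ofFn_injective⟩

lemma mem_words {n : ℕ} {l : List ι} : l ∈ words ι n ↔ l.length = n := by
  simp only [words, Finset.mem_map, Finset.mem_univ, true_and, Function.Embedding.coeFn_mk]
  constructor
  · rintro ⟨v, rfl⟩; simp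
  · rintro rfl; exact ⟨l.get, by simp⟩

lemma pre_mem_words (n : ℕ) (y : ℕ → ι) : pre n y ∈ words ι n := by simp [mem_words]

@[simp] lemma sum_words_zero {M : Type*} [AddCommMonoid M] (F : List ι → M) :
    ∑ l ∈ words ι 0, F l = F [] := by
  simp [words]

lemma sum_words_succ {M : Type*} [AddCommMonoid M] (n : ℕ) (F : List ι → M) :
    ∑ l ∈ words ι (n + 1), F l = ∑ a : ι, ∑ l ∈ words ι n, F (a :: l) := by
  simp only [words, Finset.sum_map, Function.Embedding.coeFn_mk]
  rw [← (Fin.consEquiv fun _ => ι).sum_comp, Fintype.sum_prod_type]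
  simp [Fin.consEquiv, List.ofFn_succ]

lemma sum_words_add {M : Type*} [AddCommMonoid M] (n k : ℕ) (F : List ι → M) :
    ∑ l ∈ words ι (n + k), F l = ∑ u ∈ words ι n, ∑ v ∈ words ι k, F (u ++ v) := by
  induction n generalizing F with
  | zero => simp
  | succ n ih =>
    rw [Nat.add_right_comm, sum_words_succ, sum_words_succ]
    simp [ih]

lemma card_words (n : ℕ) : (words ι n).card = Fintype.card ι ^ n := by
  simp [words]

lemma sum_words_indicator {M : Type*} [AddCommMonoid M] (n : ℕ) (y : ℕ → ι) (F : List ι → M) :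
    ∑ l ∈ words ι n, (cyl l).indicator (fun _ => F l) y = F (pre n y) := by
  rw [Finset.sum_eq_single (pre n y)]
  · simp [mem_cyl_pre]
  · intro l hl hne
    rw [mem_words] at hl
    rw [Set.indicator_of_notMem]
    rw [mem_cyl_iff, hl]
    exact fun h => hne h.symm
  · exact fun h => absurd (pre_mem_words n y) h

lemma Hol.of_succ {C θ : ℝ} {f : (ℕ → ι) → ℝ} (hθ : 0 ≤ θ)
    (h : ∀ (n : ℕ) (x y : ℕ → ι), 0 < n → (∀ i < n, x i = y i) → |f x - f y| ≤ C * θ ^ n) :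
    ∃ C' ≥ C, Hol C' θ f := by
  by_cases hι : Nonempty ι
  · obtain ⟨a⟩ := hι
    let o : ℕ → ι := fun _ => a
    let S : ℝ := ∑ b : ι, |f (scons b o)|
    have hS : ∀ x, |f x| ≤ S + |C * θ| := by
      intro x
      have h1 := h 1 x (scons (x 0) o) one_pos (by intro i hi; interval_cases i; rfl)
      have h2 : |f (scons (x 0) o)| ≤ S :=
        Finset.single_le_sum (f := fun b => |f (scons b o)|) (fun _ _ => abs_nonneg _)
          (Finset.mem_univ (x 0))
      have h3 := le_abs_self (C * θ)
      have h4 := abs_sub_abs_le_abs_sub (f x) (f (scons (x 0) o))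
      rw [pow_one] at h1
      linarith
    have hS0 : 0 ≤ S + |C * θ| := by
      have : 0 ≤ S := Finset.sum_nonneg fun _ _ => abs_nonneg _
      positivity
    refine ⟨max C (2 * (S + |C * θ|)), le_max_left _ _, ?_⟩
    intro n x y hxy
    rcases Nat.eq_zero_or_pos n with rfl | hn
    · rw [pow_zero, mul_one]
      refine le_trans ?_ (le_max_right _ _)
      have := abs_sub (f x) (f y)
      have := hS x
      have := hS y
      linarith
    · have h1 := h n x y hn hxy
      exact h1.trans (mul_le_mul_of_nonneg_right (le_max_left _ _) (pow_nonneg hθ n))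
  · exact ⟨C, le_rfl, fun n x => (hι ⟨x 0⟩).elim⟩

end Symbolic

/-! ### Normalization of the potential -/

section Normalization

variable {ι : Type*} [Fintype ι] [TopologicalSpace ι] [DiscreteTopology ι]
  [MeasurableSpace ι] [BorelSpace ι]

/-- The Gibbs inequalities on the full shift, with constant `C`. -/
def GibbsW (C : ℝ) (f : (ℕ → ι) → ℝ) (m : Measure (ℕ → ι)) : Prop :=
  ∀ (l : List ι) (y : ℕ → ι), C⁻¹ * Real.exp (bs f l y) ≤ m.real (cyl l) ∧
    m.real (cyl l) ≤ C * Real.exp (bs f l y)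

/-- The transfer operator of `f` fixes the constant function `1`. -/
def Normalized (f : (ℕ → ι) → ℝ) : Prop := ∀ y, ∑ a : ι, Real.exp (f (scons a y)) = 1

lemma measurableSet_cyl (l : List ι) : MeasurableSet (cyl l) := (isClopen_cyl l).isOpen.measurableSet

lemma sum_real_cyl_inter (m : Measure (ℕ → ι)) [IsFiniteMeasure m] (n : ℕ)
    {E : Set (ℕ → ι)} (hE : MeasurableSet E) :
    ∑ l ∈ words ι n, m.real (cyl l ∩ E) = m.real E := by
  have h : E = ⋃ l ∈ words ι n, cyl l ∩ E := by
    ext y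
    simp only [mem_iUnion, mem_inter_iff, exists_prop]
    exact ⟨fun h => ⟨pre n y, pre_mem_words n y, mem_cyl_pre n y, h⟩, fun ⟨_, _, _, h⟩ => h⟩
  conv_rhs => rw [h]
  rw [measureReal_biUnion_finset]
  · intro l hl l' hl' hne
    rw [Function.onFun, Set.disjoint_left]
    intro y hy hy'
    simp only [Finset.mem_coe, mem_words] at hl hl'
    have h1 := mem_cyl_iff.1 hy.1
    have h2 := mem_cyl_iff.1 hy'.1
    exact hne (by rw [← h1, ← h2, hl, hl'])
  · exact fun l _ => (measurableSet_cyl l).inter hE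

lemma sum_real_cyl (m : Measure (ℕ → ι)) [IsProbabilityMeasure m] (n : ℕ) :
    ∑ l ∈ words ι n, m.real (cyl l) = 1 := by
  simpa using sum_real_cyl_inter m n MeasurableSet.univ

lemma Normalized.sum_words {f : (ℕ → ι) → ℝ} (hf : Normalized f) (n : ℕ) (y : ℕ → ι) :
    ∑ l ∈ words ι n, Real.exp (bs f l y) = 1 := by
  induction n with
  | zero => simp
  | succ n ih =>
    rw [sum_words_succ, Finset.sum_comm, ← ih]
    refine Finset.sum_congr rfl fun l _ => ?_
    simp only [bs_cons, Real.exp_add]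
    rw [← Finset.sum_mul, hf, one_mul]

/-- A Gibbs potential is cohomologous to a normalized one. -/
lemma exists_normalized {C C₀ θ : ℝ} {f : (ℕ → ι) → ℝ} {m : Measure (ℕ → ι)}
    [IsProbabilityMeasure m] (hC : 1 ≤ C) (hG : GibbsW C f m) (hC₀ : 0 ≤ C₀) (h0 : 0 < θ)
    (h1 : θ < 1) (hf : Hol C₀ θ f) :
    ∃ g : (ℕ → ι) → ℝ, ∃ C' ≥ (1 : ℝ), ∃ C₁ ≥ (0 : ℝ), Normalized g ∧ Hol C₁ θ g ∧
      GibbsW C' g m := by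
  have hCpos : 0 < C := by linarith
  let s : ℕ → (ℕ → ι) → ℝ := fun n y => ∑ l ∈ words ι n, Real.exp (bs f l y)
  have hs1 : ∀ n y, s n y ∈ Icc C⁻¹ C := by
    intro n y
    have e := sum_real_cyl m n
    constructor
    · have : ∑ l ∈ words ι n, m.real (cyl l) ≤ ∑ l ∈ words ι n, C * Real.exp (bs f l y) :=
        Finset.sum_le_sum fun l _ => (hG l y).2
      rw [e, ← Finset.mul_sum] at this
      rw [inv_le_iff_one_le_mul₀ hCpos, mul_comm]
      exact this
    · have : ∑ l ∈ words ι n, C⁻¹ * Real.exp (bs f l y) ≤ ∑ l ∈ words ι n, m.real (cyl l) :=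
        Finset.sum_le_sum fun l _ => (hG l y).1
      rw [e, ← Finset.mul_sum, inv_mul_le_iff₀ hCpos, mul_one] at this
      exact this
  have hs2 : ∀ n y, ∑ a : ι, Real.exp (f (scons a y)) * s n (scons a y) = s (n + 1) y := by
    intro n y
    simp only [s, sum_words_add n 1, sum_words_succ 0, sum_words_zero, Finset.mul_sum]
    rw [Finset.sum_comm]
    refine Finset.sum_congr rfl fun l _ => Finset.sum_congr rfl fun a _ => ?_
    rw [bs_append, ← Real.exp_add, add_comm]
    simp
  set K : ℝ := C₀ / (1 - θ) with hK
  have hK0 : 0 ≤ K := div_nonneg hC₀ (by linarith)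
  have hs3 : ∀ n (k : ℕ) x y, (∀ i < k, x i = y i) → s n x ≤ Real.exp (K * θ ^ k) * s n y := by
    intro n k x y hxy
    simp only [s, Finset.mul_sum]
    refine Finset.sum_le_sum fun l _ => ?_
    rw [← Real.exp_add, Real.exp_le_exp]
    have := abs_le.1 (hf.bs_le hC₀ h0 h1 l hxy)
    linarith [this.2]
  let H : ℕ → (ℕ → ι) → ℝ := fun N y => (∑ n ∈ Finset.range (N + 1), s n y) / (N + 1)
  have hH1 : ∀ N y, H N y ∈ Icc C⁻¹ C := by
    intro N y
    have hN : (0 : ℝ) < N + 1 := by positivity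
    constructor
    · rw [le_div_iff₀ hN]
      have := Finset.card_nsmul_le_sum (Finset.range (N + 1)) (fun n => s n y) C⁻¹
        (fun n _ => (hs1 n y).1)
      simpa [mul_comm] using this
    · rw [div_le_iff₀ hN]
      have := Finset.sum_le_card_nsmul (Finset.range (N + 1)) (fun n => s n y) C
        (fun n _ => (hs1 n y).2)
      simpa [mul_comm] using this
  have hH2 : ∀ N y, ∑ a : ι, Real.exp (f (scons a y)) * H N (scons a y)
      = H N y + (s (N + 1) y - s 0 y) / (N + 1) := by
    intro N y
    simp only [H, mul_div_assoc', Finset.mul_sum]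
    rw [← Finset.sum_div, Finset.sum_comm, ← add_div]
    congr 1
    simp only [hs2]
    rw [Finset.sum_range_succ' (fun n => s n y), Finset.sum_range_succ (fun n => s (n + 1) y)]
    ring
  have hH3 : ∀ N (k : ℕ) x y, (∀ i < k, x i = y i) →
      H N x ≤ Real.exp (K * θ ^ k) * H N y := by
    intro N k x y hxy
    simp only [H, mul_div_assoc', Finset.mul_sum]
    exact div_le_div_of_nonneg_right (Finset.sum_le_sum fun n _ => hs3 n k x y hxy)
      (by positivity)
  have hlim : ∀ y, ∃ c ∈ Icc C⁻¹ C, Tendsto (fun N => H N y) (hyperfilter ℕ : Filter ℕ) (𝓝 c) := by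
    intro y
    have := (isCompact_Icc (a := C⁻¹) (b := C)).ultrafilter_le_nhds
      ((hyperfilter ℕ).map (fun N => H N y))
      (by
        rw [Ultrafilter.coe_map, le_principal_iff, Filter.mem_map]
        exact Filter.Eventually.of_forall fun N => hH1 N y)
    exact this
  choose h hh1 hh2 using hlim
  have hhpos : ∀ y, 0 < h y := fun y => lt_of_lt_of_le (inv_pos.2 hCpos) (hh1 y).1
  have hle : (hyperfilter ℕ : Filter ℕ) ≤ atTop := by
    rw [← Nat.cofinite_eq_atTop]; exact hyperfilter_le_cofinite
  have hh3 : ∀ y, ∑ a : ι, Real.exp (f (scons a y)) * h (scons a y) = h y := by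
    intro y
    have t1 : Tendsto (fun N => ∑ a : ι, Real.exp (f (scons a y)) * H N (scons a y))
        (hyperfilter ℕ : Filter ℕ) (𝓝 (∑ a : ι, Real.exp (f (scons a y)) * h (scons a y))) :=
      tendsto_finsetSum _ fun a _ => (hh2 _).const_mul _
    have t2 : Tendsto (fun N : ℕ => (s (N + 1) y - s 0 y) / ((N : ℝ) + 1)) atTop (𝓝 0) := by
      have t3 : Tendsto (fun N : ℕ => (2 * C) / ((N : ℝ) + 1)) atTop (𝓝 0) := by
        have := tendsto_one_div_add_atTop_nhds_zero_nat (𝕜 := ℝ) |>.const_mul (2 * C)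
        simpa [div_eq_mul_inv] using this
      refine squeeze_zero_norm (fun N => ?_) t3
      rw [norm_div, Real.norm_eq_abs, Real.norm_eq_abs, abs_of_pos (by positivity : (0:ℝ) < N + 1)]
      gcongr
      have a1 := hs1 (N + 1) y
      have a2 := hs1 0 y
      have : 0 < C⁻¹ := inv_pos.2 hCpos
      rw [abs_le]
      constructor <;> linarith [a1.1, a1.2, a2.1, a2.2]
    have t4 := (hh2 y).add (t2.mono_left hle)
    rw [add_zero] at t4
    refine tendsto_nhds_unique t1 (t4.congr fun N => (hH2 N y).symm)
  have hh4 : ∀ (k : ℕ) x y, (∀ i < k, x i = y i) → h x ≤ Real.exp (K * θ ^ k) * h y := by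
    intro k x y hxy
    exact le_of_tendsto_of_tendsto' (hh2 x) ((hh2 y).const_mul _) fun N => hH3 N k x y hxy
  have hlog : Hol K θ (fun y => Real.log (h y)) := by
    intro n x y hxy
    have key : ∀ x y, (∀ i < n, x i = y i) → Real.log (h x) - Real.log (h y) ≤ K * θ ^ n := by
      intro x y hxy
      have := Real.log_le_log (hhpos x) (hh4 n x y hxy)
      rw [Real.log_mul (Real.exp_pos _).ne' (hhpos y).ne', Real.log_exp] at this
      linarith
    rw [abs_le]
    have a := key x y hxy
    have b := key y x (fun i hi => (hxy i hi).symm)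
    constructor <;> linarith
  have hlogshift : Hol (K / θ) θ (fun y => Real.log (h (shift y))) := by
    intro n x y hxy
    have := hlog (n - 1) (shift x) (shift y) (fun i hi => hxy (i + 1) (by omega))
    refine this.trans ?_
    cases n with
    | zero =>
      simp only [zero_tsub, pow_zero, mul_one]
      rw [le_div_iff₀ h0]
      nlinarith
    | succ n =>
      simp only [Nat.add_sub_cancel, pow_succ]
      have : K / θ * (θ ^ n * θ) = K * θ ^ n := by field_simp
      exact this.ge
  let g : (ℕ → ι) → ℝ := fun y => (f y + Real.log (h y)) + (-1) * Real.log (h (shift y))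
  have hgbs : ∀ l y, bs g l y = bs f l y + Real.log (h (app l y)) - Real.log (h y) := by
    intro l y
    induction l with
    | nil => simp
    | cons a l ih => simp only [bs_cons, ih, app_cons, g, shift_scons]; ring
  refine ⟨g, C ^ 3, one_le_pow₀ hC, _, ?_, ?_, (hf.add hlog).add (hlogshift.const_mul (-1)), ?_⟩
  · have : 0 ≤ K / θ := by positivity
    positivity
  · intro y
    have : ∀ a, Real.exp (g (scons a y)) = Real.exp (f (scons a y)) * h (scons a y) / h y := by
      intro a
      simp only [g, shift_scons]
      rw [neg_one_mul, ← sub_eq_add_neg, Real.exp_sub, Real.exp_add, Real.exp_log (hhpos _),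
        Real.exp_log (hhpos _)]
    simp only [this]
    rw [← Finset.sum_div, hh3, div_self (hhpos y).ne']
  · intro l y
    have e : Real.exp (bs g l y) = Real.exp (bs f l y) * (h (app l y) / h y) := by
      rw [hgbs, Real.exp_sub, Real.exp_add, Real.exp_log (hhpos _), Real.exp_log (hhpos _)]
      ring
    have r1 : h (app l y) / h y ≤ C ^ 2 := by
      rw [div_le_iff₀ (hhpos y)]
      have a := (hh1 (app l y)).2
      have b := (hh1 y).1
      calc h (app l y) ≤ C := a
        _ = C ^ 2 * C⁻¹ := by field_simp
        _ ≤ _ := by gcongr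
    have r2 : (C ^ 2)⁻¹ ≤ h (app l y) / h y := by
      rw [le_div_iff₀ (hhpos y)]
      have a := (hh1 (app l y)).1
      have b := (hh1 y).2
      calc (C ^ 2)⁻¹ * h y ≤ (C ^ 2)⁻¹ * C := by gcongr
        _ = C⁻¹ := by field_simp
        _ ≤ _ := a
    have e1 := hG l y
    have ep := Real.exp_pos (bs f l y)
    rw [e]
    constructor
    · refine le_trans ?_ e1.1
      calc (C ^ 3)⁻¹ * (Real.exp (bs f l y) * (h (app l y) / h y))
          ≤ (C ^ 3)⁻¹ * (Real.exp (bs f l y) * C ^ 2) := by gcongr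
        _ = C⁻¹ * Real.exp (bs f l y) := by field_simp
    · refine e1.2.trans ?_
      calc C * Real.exp (bs f l y) = C ^ 3 * (Real.exp (bs f l y) * (C ^ 2)⁻¹) := by field_simp
        _ ≤ _ := by gcongr

end Normalization

/-! ### Gibbs measures of normalized potentials are conformal -/

section Conformal

variable {ι : Type*} [Fintype ι] [TopologicalSpace ι] [DiscreteTopology ι]
  [MeasurableSpace ι] [BorelSpace ι]

lemma le_of_cyl (ν₁ ν₂ : Measure (ℕ → ι)) [IsFiniteMeasure ν₂] (n₀ : ℕ)
    (h : ∀ l : List ι, n₀ ≤ l.length → ν₁ (cyl l) ≤ ν₂ (cyl l)) : ν₁ ≤ ν₂ := by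
  have hopen : ∀ U : Set (ℕ → ι), IsOpen U → ν₁ U ≤ ν₂ U := by
    intro U hU
    let W : ℕ → Finset (List ι) := fun k => (words ι k).filter fun l => cyl l ⊆ U
    let V : ℕ → Set (ℕ → ι) := fun k => ⋃ l ∈ W k, cyl l
    have hV : ∀ k y, y ∈ V k ↔ cyl (pre k y) ⊆ U := by
      intro k y
      simp only [V, W, mem_iUnion, Finset.mem_filter, exists_prop]
      constructor
      · rintro ⟨l, ⟨hl, hlU⟩, hy⟩
        rw [mem_words] at hl
        rw [mem_cyl_iff, hl] at hy
        rwa [hy]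
      · intro hs
        exact ⟨pre k y, ⟨pre_mem_words k y, hs⟩, mem_cyl_pre k y⟩
    have hmono : Monotone V := by
      intro j k hjk y hy
      rw [hV] at hy ⊢
      refine Subset.trans (fun z hz => ?_) hy
      refine mem_cyl_of_agree (mem_cyl_pre j y) fun i hi => ?_
      rw [pre_length] at hi
      exact eq_of_mem_cyl hz (mem_cyl_pre k y) i (by rw [pre_length]; omega)
    have hUV : U = ⋃ k, V k := by
      ext y
      rw [mem_iUnion]
      constructor
      · intro hy
        have := hU.mem_nhds hy
        rw [nhds_pi, Filter.mem_pi] at this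
        obtain ⟨I, hI, t, ht, hsub⟩ := this
        obtain ⟨k, hk⟩ := hI.bddAbove
        refine ⟨k + 1, (hV _ _).2 fun z hz => hsub fun i hi => ?_⟩
        have : z i = y i := eq_of_mem_cyl hz (mem_cyl_pre (k + 1) y) i (by
          rw [pre_length]; exact Nat.lt_succ_of_le (hk hi))
        rw [this]
        exact mem_of_mem_nhds (ht i)
      · rintro ⟨k, hk⟩
        exact (hV k y).1 hk (mem_cyl_pre k y)
    have hVm : ∀ k, n₀ ≤ k → ν₁ (V k) ≤ ν₂ (V k) := by
      intro k hk
      have hd : (W k : Set (List ι)).PairwiseDisjoint cyl := by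
        intro l hl l' hl' hne
        rw [Function.onFun, Set.disjoint_left]
        intro y hy hy'
        simp only [W, Finset.mem_coe, Finset.mem_filter, mem_words] at hl hl'
        have h1 := mem_cyl_iff.1 hy
        have h2 := mem_cyl_iff.1 hy'
        exact hne (by rw [← h1, ← h2, hl.1, hl'.1])
      simp only [V]
      rw [measure_biUnion_finset hd fun l _ => measurableSet_cyl l,
        measure_biUnion_finset hd fun l _ => measurableSet_cyl l]
      refine Finset.sum_le_sum fun l hl => h l ?_
      simp only [W, Finset.mem_filter, mem_words] at hl
      omega
    rw [hUV]
    refine le_of_tendsto_of_tendsto (tendsto_measure_iUnion_atTop hmono)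
      (tendsto_measure_iUnion_atTop hmono) ?_
    filter_upwards [eventually_ge_atTop n₀] with k hk using hVm k hk
  refine Measure.le_iff.2 fun s _ => ?_
  rw [Set.measure_eq_iInf_isOpen s ν₂]
  exact le_iInf₂ fun U hU => le_iInf fun ho => (measure_mono hU).trans (hopen U ho)

lemma measurable_scons (a : ι) : Measurable (scons a) := (continuous_scons a).measurable

lemma measurable_shift : Measurable (shift : (ℕ → ι) → (ℕ → ι)) := continuous_shift.measurable

/-- The dual of the transfer operator of `f`. -/
noncomputable def dualOp (f : (ℕ → ι) → ℝ) (ν : Measure (ℕ → ι)) : Measure (ℕ → ι) :=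
  ∑ a : ι, (ν.withDensity fun y => ENNReal.ofReal (Real.exp (f (scons a y)))).map (scons a)

lemma lintegral_dualOp {f : (ℕ → ι) → ℝ} (hf : Continuous f) (ν : Measure (ℕ → ι))
    {F : (ℕ → ι) → ℝ≥0∞} (hF : Measurable F) :
    ∫⁻ y, F y ∂(dualOp f ν) =
      ∫⁻ y, ∑ a : ι, ENNReal.ofReal (Real.exp (f (scons a y))) * F (scons a y) ∂ν := by
  have hm : ∀ a : ι, Measurable fun y => ENNReal.ofReal (Real.exp (f (scons a y))) := fun a =>
    (Real.continuous_exp.comp (hf.comp (continuous_scons a))).measurable.ennreal_ofReal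
  rw [dualOp, lintegral_finsetSum_measure, lintegral_finsetSum]
  · refine Finset.sum_congr rfl fun a _ => ?_
    rw [lintegral_map hF (measurable_scons a),
      lintegral_withDensity_eq_lintegral_mul _ (hm a)
        (show Measurable fun y => F (scons a y) from hF.comp (measurable_scons a))]
    rfl
  · exact fun a _ => (hm a).mul (hF.comp (measurable_scons a))

lemma lintegral_dualOp_iterate {f : (ℕ → ι) → ℝ} (hf : Continuous f) (ν : Measure (ℕ → ι))
    (n : ℕ) {F : (ℕ → ι) → ℝ≥0∞} (hF : Measurable F) :
    ∫⁻ y, F y ∂((dualOp f)^[n] ν) =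
      ∫⁻ y, ∑ l ∈ words ι n, ENNReal.ofReal (Real.exp (bs f l y)) * F (app l y) ∂ν := by
  induction n generalizing F with
  | zero => simp
  | succ n ih =>
    have hm : ∀ a : ι, Measurable fun y => ENNReal.ofReal (Real.exp (f (scons a y))) := fun a =>
      (Real.continuous_exp.comp (hf.comp (continuous_scons a))).measurable.ennreal_ofReal
    rw [Function.iterate_succ_apply', lintegral_dualOp hf _ hF, ih]
    · refine lintegral_congr fun y => ?_
      rw [sum_words_succ, Finset.sum_comm]
      refine Finset.sum_congr rfl fun l _ => ?_
      rw [Finset.mul_sum]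
      refine Finset.sum_congr rfl fun a _ => ?_
      rw [bs_cons, Real.exp_add, ENNReal.ofReal_mul (Real.exp_pos _).le, app_cons]
      ring
    · exact Finset.measurable_sum _ fun a _ => (hm a).mul (hF.comp (measurable_scons a))

lemma dualOp_withDensity {f : (ℕ → ι) → ℝ} (hf : Continuous f) (ν : Measure (ℕ → ι))
    {ρ : (ℕ → ι) → ℝ≥0∞} (hρ : Measurable ρ) :
    dualOp f (ν.withDensity ρ) = (dualOp f ν).withDensity (fun y => ρ (shift y)) := by
  have hρs : Measurable fun y : ℕ → ι => ρ (shift y) := hρ.comp measurable_shift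
  have hm : ∀ a : ι, Measurable fun y => ENNReal.ofReal (Real.exp (f (scons a y))) := fun a =>
      (Real.continuous_exp.comp (hf.comp (continuous_scons a))).measurable.ennreal_ofReal
  refine Measure.ext_of_lintegral _ fun F hF => ?_
  rw [lintegral_dualOp hf _ hF, lintegral_withDensity_eq_lintegral_mul _ hρs hF,
    lintegral_dualOp hf _ (hρs.mul hF), lintegral_withDensity_eq_lintegral_mul _ hρ
      (show Measurable fun y => ∑ a : ι, ENNReal.ofReal (Real.exp (f (scons a y))) * F (scons a y)
        from Finset.measurable_sum _ fun a _ => (hm a).mul (hF.comp (measurable_scons a)))]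
  refine lintegral_congr fun y => ?_
  simp only [Pi.mul_apply, shift_scons, Finset.mul_sum]
  exact Finset.sum_congr rfl fun a _ => by ring

lemma GibbsW.exp_bs_mul_le {C : ℝ} {f : (ℕ → ι) → ℝ} {m : Measure (ℕ → ι)} (hC : 1 ≤ C)
    (hG : GibbsW C f m) (u v : List ι) {y : ℕ → ι} (hy : y ∈ cyl v) :
    Real.exp (bs f u y) * m.real (cyl v) ≤ C ^ 2 * m.real (cyl (u ++ v)) ∧
      (C ^ 2)⁻¹ * m.real (cyl (u ++ v)) ≤ Real.exp (bs f u y) * m.real (cyl v) := by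
  have hCpos : 0 < C := by linarith
  set z := shift^[v.length] y
  have hz : app v z = y := by
    have := app_pre v.length y
    rwa [mem_cyl_iff.1 hy] at this
  have e : Real.exp (bs f (u ++ v) z) = Real.exp (bs f u y) * Real.exp (bs f v z) := by
    rw [bs_append, hz, Real.exp_add]
  have h1 := hG (u ++ v) z
  have h2 := hG v z
  rw [e] at h1
  have p1 := Real.exp_pos (bs f u y)
  constructor
  · calc Real.exp (bs f u y) * m.real (cyl v)
        ≤ Real.exp (bs f u y) * (C * Real.exp (bs f v z)) := by gcongr; exact h2.2
      _ = C ^ 2 * (C⁻¹ * (Real.exp (bs f u y) * Real.exp (bs f v z))) := by field_simp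
      _ ≤ _ := by gcongr; exact h1.1
  · calc (C ^ 2)⁻¹ * m.real (cyl (u ++ v))
        ≤ (C ^ 2)⁻¹ * (C * (Real.exp (bs f u y) * Real.exp (bs f v z))) := by
          gcongr; exact h1.2
      _ = Real.exp (bs f u y) * (C⁻¹ * Real.exp (bs f v z)) := by field_simp
      _ ≤ _ := by gcongr; exact h2.1

lemma dualOp_iterate_cyl {f : (ℕ → ι) → ℝ} (hf : Continuous f) (ν : Measure (ℕ → ι))
    (u v : List ι) :
    (dualOp f)^[u.length] ν (cyl (u ++ v)) =
      ∫⁻ y in cyl v, ENNReal.ofReal (Real.exp (bs f u y)) ∂ν := by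
  rw [← lintegral_indicator_one (measurableSet_cyl _), lintegral_dualOp_iterate hf ν _
    (measurable_one.indicator (measurableSet_cyl _)), ← lintegral_indicator (measurableSet_cyl _)]
  refine lintegral_congr fun y => ?_
  rw [Finset.sum_eq_single u]
  · by_cases hy : y ∈ cyl v
    · rw [Set.indicator_of_mem ((app_mem_cyl_append rfl).2 ⟨rfl, hy⟩), Set.indicator_of_mem hy]
      simp
    · rw [Set.indicator_of_notMem (fun h => hy ((app_mem_cyl_append rfl).1 h).2),
        Set.indicator_of_notMem hy]
      simp
  · intro l hl hne
    rw [Set.indicator_of_notMem (fun h => hne ((app_mem_cyl_append (mem_words.1 hl)).1 h).1)]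
    simp
  · exact fun h => absurd (mem_words.2 rfl) h

lemma GibbsW.dualOp_iterate_le {C : ℝ} {f : (ℕ → ι) → ℝ} {m : Measure (ℕ → ι)}
    [IsProbabilityMeasure m] (hC : 1 ≤ C) (hf : Continuous f) (hG : GibbsW C f m) (n : ℕ) :
    (dualOp f)^[n] m ≤ ENNReal.ofReal (C ^ 2) • m ∧
      ENNReal.ofReal ((C ^ 2)⁻¹) • m ≤ (dualOp f)^[n] m := by
  have hcyl : ∀ l : List ι, n ≤ l.length →
      (dualOp f)^[n] m (cyl l) ≤ ENNReal.ofReal (C ^ 2 * m.real (cyl l)) ∧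
      ENNReal.ofReal ((C ^ 2)⁻¹ * m.real (cyl l)) ≤ (dualOp f)^[n] m (cyl l) := by
    intro l hl
    obtain ⟨u, v, rfl, hu⟩ : ∃ u v, l = u ++ v ∧ u.length = n :=
      ⟨l.take n, l.drop n, (List.take_append_drop n l).symm, by simp [hl]⟩
    subst hu
    rw [dualOp_iterate_cyl hf]
    rcases (measureReal_nonneg (μ := m) (s := cyl v)).eq_or_lt with h0 | h0
    · have hn : (cyl v).Nonempty := by
        by_contra hne
        rw [Set.not_nonempty_iff_eq_empty] at hne
        have : IsEmpty (ℕ → ι) := ⟨fun y => by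
          have := app_mem_cyl v y
          rw [hne] at this
          exact this⟩
        have h1 : m univ = 1 := measure_univ
        rw [Set.eq_empty_of_isEmpty univ] at h1
        simp at h1
      obtain ⟨y, -⟩ := hn
      have := (hG v y).1
      rw [← h0] at this
      have : 0 < C⁻¹ * Real.exp (bs f v y) := by
        have : 0 < C := by linarith
        positivity
      linarith
    · have key : ∀ c : ℝ, ENNReal.ofReal c =
          ∫⁻ y in cyl v, ENNReal.ofReal (c / m.real (cyl v)) ∂m := by
        intro c
        rw [setLIntegral_const, ← ofReal_measureReal, ← ENNReal.ofReal_mul' measureReal_nonneg,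
          div_mul_cancel₀ _ h0.ne']
      constructor
      · rw [key]
        refine setLIntegral_mono' (measurableSet_cyl v) fun y hy => ?_
        refine ENNReal.ofReal_le_ofReal ?_
        rw [le_div_iff₀ h0]
        exact (hG.exp_bs_mul_le hC u v hy).1
      · rw [key]
        refine setLIntegral_mono' (measurableSet_cyl v) fun y hy => ?_
        refine ENNReal.ofReal_le_ofReal ?_
        rw [div_le_iff₀ h0]
        exact (hG.exp_bs_mul_le hC u v hy).2
  have e : ∀ c : ℝ, 0 ≤ c → ∀ l : List ι,
      ENNReal.ofReal (c * m.real (cyl l)) = (ENNReal.ofReal c • m) (cyl l) := by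
    intro c hc l
    rw [ENNReal.ofReal_mul hc, ofReal_measureReal]
    rfl
  have hup : (dualOp f)^[n] m ≤ ENNReal.ofReal (C ^ 2) • m := by
    have : IsFiniteMeasure (ENNReal.ofReal (C ^ 2) • m) := Measure.smul_finite _ ENNReal.ofReal_ne_top
    refine le_of_cyl _ _ n fun l hl => ?_
    rw [← e _ (by positivity)]
    exact (hcyl l hl).1
  refine ⟨hup, ?_⟩
  have : IsFiniteMeasure (ENNReal.ofReal (C ^ 2) • m) := Measure.smul_finite _ ENNReal.ofReal_ne_top
  have : IsFiniteMeasure ((dualOp f)^[n] m) := isFiniteMeasure_of_le _ hup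
  refine le_of_cyl _ _ n fun l hl => ?_
  rw [← e _ (by positivity)]
  exact (hcyl l hl).2

/-- A shift-invariant Gibbs measure of a normalized potential is fixed by the dual operator. -/
lemma dualOp_eq_self {C : ℝ} {f : (ℕ → ι) → ℝ} {m : Measure (ℕ → ι)}
    [IsProbabilityMeasure m] (hC : 1 ≤ C) (hf : Continuous f) (hG : GibbsW C f m)
    (hN : Normalized f) (hinv : MeasurePreserving shift m m) : dualOp f m = m := by
  have hCpos : 0 < C := by linarith
  have hb := hG.dualOp_iterate_le hC hf
  have hfin : ∀ n, IsFiniteMeasure ((dualOp f)^[n] m) := fun n =>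
    have : IsFiniteMeasure (ENNReal.ofReal (C ^ 2) • m) :=
      Measure.smul_finite _ ENNReal.ofReal_ne_top
    isFiniteMeasure_of_le _ (hb n).1
  have hfin1 : IsFiniteMeasure (dualOp f m) := hfin 1
  have hσ : (dualOp f m).HaveLebesgueDecomposition m :=
    Measure.haveLebesgueDecomposition_of_sigmaFinite _ _
  have hac : dualOp f m ≪ m :=
    Measure.absolutelyContinuous_of_le_smul (hb 1).1
  set r : (ℕ → ι) → ℝ≥0∞ := (dualOp f m).rnDeriv m with hr
  have hrm : Measurable r := Measure.measurable_rnDeriv _ _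
  have hrd : m.withDensity r = dualOp f m := Measure.withDensity_rnDeriv_eq _ _ hac
  let ρ : ℕ → (ℕ → ι) → ℝ≥0∞ := fun n y => ∏ k ∈ Finset.range n, r (shift^[k] y)
  have hρm : ∀ n, Measurable (ρ n) := fun n =>
    Finset.measurable_prod _ fun k _ => hrm.comp (measurable_shift.iterate k)
  have hρ : ∀ n, (dualOp f)^[n] m = m.withDensity (ρ n) := by
    intro n
    induction n with
    | zero => simp [ρ]
    | succ n ih =>
      rw [Function.iterate_succ_apply', ih, dualOp_withDensity hf _ (hρm n), ← hrd,
        ← withDensity_mul _ hrm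
          (show Measurable fun y => ρ n (shift y) from (hρm n).comp measurable_shift)]
      congr 1
      funext y
      simp only [ρ, Pi.mul_apply, Finset.prod_range_succ', Function.iterate_succ_apply,
        Function.iterate_zero, id]
      rw [mul_comm]
  have hρle : ∀ n, ∀ᵐ y ∂m, ρ n y ≤ ENNReal.ofReal (C ^ 2) := by
    intro n
    refine ae_le_of_forall_setLIntegral_le_of_sigmaFinite (hρm n) fun s hs _ => ?_
    rw [← withDensity_apply _ hs, ← hρ, setLIntegral_const]
    exact (hb n).1 s
  have hρge : ∀ n, ∀ᵐ y ∂m, ENNReal.ofReal ((C ^ 2)⁻¹) ≤ ρ n y := by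
    intro n
    refine ae_le_of_forall_setLIntegral_le_of_sigmaFinite measurable_const fun s hs _ => ?_
    rw [← withDensity_apply (ρ n) hs, ← hρ, setLIntegral_const]
    exact (hb n).2 s
  let R : (ℕ → ι) → ℝ := fun y => (r y).toReal
  have hRm : Measurable R := hrm.ennreal_toReal
  have hRn : ∀ n, ∀ᵐ y ∂m, ∏ k ∈ Finset.range n, R (shift^[k] y) ∈ Icc (C ^ 2)⁻¹ (C ^ 2) := by
    intro n
    filter_upwards [hρle n, hρge n] with y h1 h2
    have e : ∏ k ∈ Finset.range n, R (shift^[k] y) = (ρ n y).toReal := by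
      simp only [ρ, ENNReal.toReal_prod, R]
    rw [e]
    have hne : ρ n y ≠ ⊤ := (h1.trans_lt ENNReal.ofReal_lt_top).ne
    constructor
    · exact (ENNReal.ofReal_le_iff_le_toReal hne).1 h2
    · exact ENNReal.toReal_le_of_le_ofReal (by positivity) h1
  have hR1 : ∀ᵐ y ∂m, R y ∈ Icc (C ^ 2)⁻¹ (C ^ 2) := by
    filter_upwards [hRn 1] with y h
    simpa using h
  have hD : (0 : ℝ) < (C ^ 2)⁻¹ := by positivity
  have hlogb : ∀ x ∈ Icc (C ^ 2)⁻¹ (C ^ 2), |Real.log x| ≤ Real.log (C ^ 2) := by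
    intro x hx
    have hx0 : 0 < x := hD.trans_le hx.1
    rw [abs_le, ← Real.log_inv]
    exact ⟨Real.log_le_log hD hx.1, Real.log_le_log hx0 hx.2⟩
  have hlogi : Integrable (fun y => Real.log (R y)) m := by
    refine Integrable.of_bound (Real.measurable_log.comp hRm).aestronglyMeasurable
      (Real.log (C ^ 2)) ?_
    filter_upwards [hR1] with y hy using hlogb _ hy
  have hlogn : ∀ n : ℕ, (n : ℝ) * ∫ y, Real.log (R y) ∂m =
      ∫ y, Real.log (∏ k ∈ Finset.range n, R (shift^[k] y)) ∂m := by
    intro n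
    have h1 : ∀ᵐ y ∂m, ∀ k : ℕ, R (shift^[k] y) ∈ Icc (C ^ 2)⁻¹ (C ^ 2) := by
      rw [ae_all_iff]
      intro k
      exact (hinv.iterate k).quasiMeasurePreserving.ae hR1
    have h2 : ∫ y, Real.log (∏ k ∈ Finset.range n, R (shift^[k] y)) ∂m =
        ∫ y, ∑ k ∈ Finset.range n, Real.log (R (shift^[k] y)) ∂m := by
      refine integral_congr_ae ?_
      filter_upwards [h1] with y hy
      exact Real.log_prod fun k _ => (hD.trans_le (hy k).1).ne'
    have h3 : ∀ k, Integrable (fun y => Real.log (R (shift^[k] y))) m := fun k =>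
      (hinv.iterate k).integrable_comp_of_integrable hlogi
    have h4 : ∀ k, ∫ y, Real.log (R (shift^[k] y)) ∂m = ∫ y, Real.log (R y) ∂m := by
      intro k
      have := integral_map (μ := m) (hinv.iterate k).measurable.aemeasurable
        (f := fun y => Real.log (R y)) (Real.measurable_log.comp hRm).aestronglyMeasurable
      rw [(hinv.iterate k).map_eq] at this
      exact this.symm
    rw [h2, integral_finsetSum _ fun k _ => h3 k]
    simp [h4]
  have hlog0 : ∫ y, Real.log (R y) ∂m = 0 := by
    by_contra hne
    have hb : ∀ n : ℕ, (n : ℝ) * |∫ y, Real.log (R y) ∂m| ≤ Real.log (C ^ 2) := by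
      intro n
      have h5 := norm_integral_le_of_norm_le_const (μ := m)
        (f := fun y => Real.log (∏ k ∈ Finset.range n, R (shift^[k] y))) (C := Real.log (C ^ 2))
        (by filter_upwards [hRn n] with y hy using hlogb _ hy)
      rw [← hlogn, norm_mul] at h5
      simpa using h5
    obtain ⟨n, hn⟩ := exists_nat_gt (Real.log (C ^ 2) / |∫ y, Real.log (R y) ∂m|)
    rw [div_lt_iff₀ (abs_pos.2 hne)] at hn
    exact absurd (hb n) (not_le.2 hn)
  have hRi : Integrable R m := by
    refine Integrable.of_bound hRm.aestronglyMeasurable (C ^ 2) ?_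
    filter_upwards [hR1] with y hy
    rw [Real.norm_eq_abs, abs_of_pos (hD.trans_le hy.1)]
    exact hy.2
  have hRint : ∫ y, R y ∂m = 1 := by
    rw [integral_toReal hrm.aemeasurable (by
      filter_upwards [hρle 1] with y hy
      simpa [ρ] using hy.trans_lt ENNReal.ofReal_lt_top), ← setLIntegral_univ,
      ← withDensity_apply _ MeasurableSet.univ, hrd, ← lintegral_one,
      lintegral_dualOp hf m (F := fun _ => 1) measurable_const]
    have : ∀ y, ∑ a : ι, ENNReal.ofReal (Real.exp (f (scons a y))) * 1 = 1 := by
      intro y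
      simp only [mul_one]
      rw [← ENNReal.ofReal_sum_of_nonneg fun a _ => (Real.exp_pos _).le, hN y, ENNReal.ofReal_one]
    simp only [this]
    simp
  have hz : ∫ y, (R y - 1 - Real.log (R y)) ∂m = 0 := by
    have e1 : ∫ y, (R y - 1 - Real.log (R y)) ∂m = ∫ y, (R y - 1) ∂m - ∫ y, Real.log (R y) ∂m :=
      integral_sub (hRi.sub (integrable_const 1)) hlogi
    rw [e1, integral_sub hRi (integrable_const 1), hRint, hlog0]
    simp
  have hnn : 0 ≤ᵐ[m] fun y => R y - 1 - Real.log (R y) := by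
    filter_upwards [hR1] with y hy
    have := Real.log_le_sub_one_of_pos (hD.trans_le hy.1)
    simp only [Pi.zero_apply]
    linarith
  rw [integral_eq_zero_iff_of_nonneg_ae hnn ((hRi.sub (integrable_const 1)).sub hlogi)] at hz
  have hr1 : r =ᵐ[m] 1 := by
    filter_upwards [hz, hR1] with y h1 h2
    simp only [Pi.zero_apply] at h1
    have h3 : R y = 1 := by
      by_contra hne
      have := Real.log_lt_sub_one_of_pos (hD.trans_le h2.1) hne
      linarith
    simp only [Pi.one_apply]
    have : (r y).toReal = (1 : ℝ≥0∞).toReal := by simpa using h3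
    rcases ENNReal.toReal_eq_toReal_iff _ _ |>.1 this with h | h | h
    · exact h
    · simp at h
    · simp at h
  rw [← hrd, withDensity_congr_ae hr1, withDensity_one]

lemma lintegral_eq_sum_words {f : (ℕ → ι) → ℝ} {m : Measure (ℕ → ι)} (hf : Continuous f)
    (hd : dualOp f m = m) (n : ℕ) {F : (ℕ → ι) → ℝ≥0∞} (hF : Measurable F) :
    ∫⁻ y, F y ∂m =
      ∫⁻ y, ∑ l ∈ words ι n, ENNReal.ofReal (Real.exp (bs f l y)) * F (app l y) ∂m := by
  rw [← lintegral_dualOp_iterate hf m n hF, Function.iterate_fixed hd]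

lemma integral_eq_sum_words {E : Type*} [NormedAddCommGroup E] [NormedSpace ℝ E]
    {f : (ℕ → ι) → ℝ} {m : Measure (ℕ → ι)} [IsFiniteMeasure m] (hf : Continuous f)
    (hd : dualOp f m = m) (n : ℕ) {F : (ℕ → ι) → E} (hF : Continuous F) :
    ∫ y, F y ∂m = ∫ y, ∑ l ∈ words ι n, Real.exp (bs f l y) • F (app l y) ∂m := by
  have hI : ∀ (F : (ℕ → ι) → E) (_ : Continuous F) (ν : Measure (ℕ → ι)) [IsFiniteMeasure ν],
      Integrable F ν := fun F hF ν _ => hF.integrable_of_hasCompactSupport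
        (HasCompactSupport.of_compactSpace F)
  have hce : ∀ a : ι, Continuous fun y => Real.exp (f (scons a y)) := fun a =>
    Real.continuous_exp.comp (hf.comp (continuous_scons a))
  have step : ∀ F : (ℕ → ι) → E, Continuous F →
      ∫ y, F y ∂m = ∫ y, ∑ a : ι, Real.exp (f (scons a y)) • F (scons a y) ∂m := by
    intro F hF
    have hb : ∀ a : ι, IsFiniteMeasure
        (m.withDensity fun y => ENNReal.ofReal (Real.exp (f (scons a y)))) := fun a =>
      isFiniteMeasure_withDensity_ofReal
        ((hce a).integrable_of_hasCompactSupport (HasCompactSupport.of_compactSpace _)).2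
    conv_lhs => rw [← hd]
    rw [dualOp, integral_finsetSum_measure fun a _ => hI _ hF _, integral_finsetSum]
    · refine Finset.sum_congr rfl fun a _ => ?_
      rw [integral_map (measurable_scons a).aemeasurable hF.aestronglyMeasurable,
        integral_withDensity_eq_integral_toReal_smul (hce a).measurable.ennreal_ofReal
          (Eventually.of_forall fun _ => ENNReal.ofReal_lt_top)]
      refine integral_congr_ae (Eventually.of_forall fun y => ?_)
      simp only [ENNReal.toReal_ofReal (Real.exp_pos _).le]
    · exact fun a _ => hI _ ((hce a).smul (hF.comp (continuous_scons a))) m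
  induction n with
  | zero => simp
  | succ n ih =>
    have hc : Continuous fun y => ∑ l ∈ words ι n, Real.exp (bs f l y) • F (app l y) :=
      continuous_finsetSum _ fun l _ =>
        (Real.continuous_exp.comp (continuous_bs hf l)).smul (hF.comp (continuous_app l))
    rw [ih, step _ hc]
    refine integral_congr_ae (Eventually.of_forall fun y => ?_)
    simp only [sum_words_add n 1, sum_words_succ 0, sum_words_zero, Finset.smul_sum]
    rw [Finset.sum_comm]
    refine Finset.sum_congr rfl fun l _ => Finset.sum_congr rfl fun a _ => ?_
    rw [bs_append, app_append, Real.exp_add, smul_smul, mul_comm]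
    simp

end Conformal

/-! ### Ergodicity and large deviations -/

section LargeDeviations

variable {ι : Type*} [Fintype ι] [TopologicalSpace ι] [DiscreteTopology ι]
  [MeasurableSpace ι] [BorelSpace ι]

lemma ergodic_shift {C : ℝ} {φ : (ℕ → ι) → ℝ} {m : Measure (ℕ → ι)}
    [IsProbabilityMeasure m] (hC : 1 ≤ C) (hφ : Continuous φ) (hG : GibbsW C φ m)
    (hd : dualOp φ m = m) (hinv : MeasurePreserving shift m m) : Ergodic shift m := by
  refine ⟨hinv, ⟨fun E hE hEinv => ?_⟩⟩
  have hCpos : 0 < C := by linarith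
  have hmem : ∀ (l : List ι) y, app l y ∈ E ↔ y ∈ E := by
    intro l y
    have h1 : ∀ z, shift z ∈ E ↔ z ∈ E := fun z => by
      conv_rhs => rw [← hEinv]
      rfl
    induction l with
    | nil => rfl
    | cons a l ih => exact (h1 (app (a :: l) y)).symm.trans ih
  have key : (ENNReal.ofReal C⁻¹ * m E) • m ≤ m.restrict E := by
    refine le_of_cyl _ _ 0 fun l _ => ?_
    rw [Measure.restrict_apply (measurableSet_cyl l),
      ← lintegral_indicator_one ((measurableSet_cyl l).inter hE),
      lintegral_eq_sum_words hφ hd l.length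
        (measurable_one.indicator ((measurableSet_cyl l).inter hE))]
    have e : ∀ y, ∑ l' ∈ words ι l.length, ENNReal.ofReal (Real.exp (bs φ l' y)) *
        (cyl l ∩ E).indicator 1 (app l' y) =
        E.indicator (fun y => ENNReal.ofReal (Real.exp (bs φ l y))) y := by
      intro y
      rw [Finset.sum_eq_single l]
      · by_cases hy : y ∈ E
        · rw [Set.indicator_of_mem (show app l y ∈ cyl l ∩ E from
            ⟨app_mem_cyl l y, (hmem l y).2 hy⟩), Set.indicator_of_mem hy]
          simp
        · rw [Set.indicator_of_notMem (fun h => hy ((hmem l y).1 h.2)),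
            Set.indicator_of_notMem hy]
          simp
      · intro l' hl' hne
        rw [Set.indicator_of_notMem (fun h => hne ((app_mem_cyl_iff (mem_words.1 hl')).1 h.1))]
        simp
      · exact fun h => absurd (mem_words.2 rfl) h
    simp only [e]
    rw [lintegral_indicator hE]
    have h2 : ∀ y, ENNReal.ofReal (C⁻¹ * m.real (cyl l)) ≤
        ENNReal.ofReal (Real.exp (bs φ l y)) := by
      intro y
      refine ENNReal.ofReal_le_ofReal ?_
      rw [inv_mul_le_iff₀ hCpos]
      exact (hG l y).2
    calc ((ENNReal.ofReal C⁻¹ * m E) • m) (cyl l)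
        = ∫⁻ _ in E, ENNReal.ofReal (C⁻¹ * m.real (cyl l)) ∂m := by
          rw [setLIntegral_const, ENNReal.ofReal_mul (inv_nonneg.2 hCpos.le), ofReal_measureReal,
            Measure.smul_apply, smul_eq_mul]
          ring
      _ ≤ _ := lintegral_mono h2
  have h0 := Measure.le_iff'.1 key Eᶜ
  rw [Measure.restrict_apply hE.compl, Set.compl_inter_self, measure_empty, Measure.smul_apply,
    smul_eq_mul, nonpos_iff_eq_zero, mul_eq_zero, mul_eq_zero] at h0
  rw [eventuallyConst_set]
  rcases h0 with (h0 | h0) | h0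
  · exact absurd (ENNReal.ofReal_eq_zero.1 h0) (not_le.2 (inv_pos.2 hCpos))
  · right
    exact measure_eq_zero_iff_ae_notMem.1 h0
  · left
    rw [measure_eq_zero_iff_ae_notMem] at h0
    filter_upwards [h0] with y hy
    simpa using hy

/-- The weak law of large numbers for an ergodic shift-invariant measure. -/
lemma tendsto_measure_birkhoffSum {m : Measure (ℕ → ι)} [IsProbabilityMeasure m]
    (he : Ergodic shift m) {g : (ℕ → ι) → ℝ} (hg : Continuous g) {η : ℝ} (hη : 0 < η) :
    Tendsto (fun N : ℕ => m.real {y | (∫ z, g z ∂m + η) * N ≤ birkhoffSum shift g N y})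
      atTop (𝓝 0) := by
  have hmp := he.toMeasurePreserving
  have hI : ∀ F : (ℕ → ι) → ℝ, Continuous F → MemLp F 2 m := fun F hF =>
    hF.memLp_of_hasCompactSupport (HasCompactSupport.of_compactSpace F)
  have hck : ∀ k, Continuous fun y => g (shift^[k] y) := fun k =>
    hg.comp (continuous_shift.iterate k)
  let A : ℕ → (ℕ → ι) → ℝ := fun N y => (N : ℝ)⁻¹ * birkhoffSum shift g N y
  have hA : ∀ N, Continuous (A N) := fun N =>
    continuous_const.mul (continuous_finsetSum _ fun k _ => hck k)
  let U : Lp ℝ 2 m →L[ℝ] Lp ℝ 2 m :=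
    (Lp.compMeasurePreservingₗᵢ ℝ (p := 2) (E := ℝ) shift hmp).toContinuousLinearMap
  have hU1 : ‖U‖ ≤ 1 := LinearIsometry.norm_toContinuousLinearMap_le _
  set x : Lp ℝ 2 m := (hI g hg).toLp g with hx
  have hUk : ∀ k, (U^[k] x : Lp ℝ 2 m) = (hI _ (hck k)).toLp (fun y => g (shift^[k] y)) := by
    intro k
    induction k with
    | zero => rfl
    | succ k ih =>
      rw [Function.iterate_succ_apply', ih]
      rfl
  have hAN : ∀ N, birkhoffAverage ℝ U _root_.id N x = (hI _ (hA N)).toLp (A N) := by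
    intro N
    have : ∀ N, birkhoffSum U _root_.id N x = (hI (fun y => birkhoffSum shift g N y)
        (continuous_finsetSum _ fun k _ => hck k)).toLp _ := by
      intro N
      induction N with
      | zero => rfl
      | succ N ih =>
        rw [birkhoffSum_succ, ih, id, hUk, ← MemLp.toLp_add]
        refine MemLp.toLp_congr _ _ (Eventually.of_forall fun y => ?_)
        simp [birkhoffSum_succ]
    rw [birkhoffAverage, this, ← MemLp.toLp_const_smul]
    rfl
  have hlim := U.tendsto_birkhoffAverage_orthogonalProjection hU1 x
  set p : Lp ℝ 2 m := ((U.eqLocus (1 : Lp ℝ 2 m →L[ℝ] Lp ℝ 2 m)).orthogonalProjectionOnto x :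
    Lp ℝ 2 m) with hp
  have hpU : U p = p := ((U.eqLocus (1 : Lp ℝ 2 m →L[ℝ] Lp ℝ 2 m)).orthogonalProjectionOnto x).2
  obtain ⟨c, hc⟩ := he.eq_const_of_compMeasurePreserving_eq (g := (p : (ℕ → ι) →ₘ[m] ℝ))
    (congrArg Subtype.val hpU)
  have hpc : p = (hI (fun _ => c) continuous_const).toLp _ := Subtype.ext hc
  have hn : Tendsto (fun N => eLpNorm (A N - fun _ => c) 2 m) atTop (𝓝 0) := by
    rw [← Lp.tendsto_Lp_iff_tendsto_eLpNorm'' A (fun N => hI _ (hA N)) (fun _ => c)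
      (hI _ continuous_const), ← hpc]
    exact hlim.congr hAN
  have hconst : ∫ z, g z ∂m = c := by
    have h1 : Tendsto (fun N => eLpNorm (A N - fun _ => c) 1 m) atTop (𝓝 0) := by
      refine tendsto_of_tendsto_of_tendsto_of_le_of_le tendsto_const_nhds hn (fun _ => zero_le)
        fun N => eLpNorm_le_eLpNorm_of_exponent_le (by norm_num)
          ((hA N).sub continuous_const).aestronglyMeasurable
    have h2 := tendsto_integral_of_L1' (μ := m) (fun _ => c) aestronglyMeasurable_const
      (Eventually.of_forall fun N => (hI _ (hA N)).integrable (by norm_num)) h1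
    have h3 : ∀ N : ℕ, 0 < N → ∫ y, A N y ∂m = ∫ z, g z ∂m := by
      intro N hN
      have h4 : ∀ k, ∫ y, g (shift^[k] y) ∂m = ∫ y, g y ∂m := by
        intro k
        have := integral_map (μ := m) (hmp.iterate k).measurable.aemeasurable
          (f := g) hg.aestronglyMeasurable
        rw [(hmp.iterate k).map_eq] at this
        exact this.symm
      simp only [A, birkhoffSum]
      rw [integral_const_mul, integral_finsetSum _ fun k _ => (hI _ (hck k)).integrable (by norm_num)]
      simp only [h4, Finset.sum_const, Finset.card_range, nsmul_eq_mul]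
      field_simp
    have h5 : Tendsto (fun N : ℕ => ∫ y, A N y ∂m) atTop (𝓝 (∫ z, g z ∂m)) :=
      tendsto_const_nhds.congr' (by
        filter_upwards [eventually_gt_atTop 0] with N hN using (h3 N hN).symm)
    have := tendsto_nhds_unique h2 h5
    simpa using this.symm
  have hM := tendstoInMeasure_of_tendsto_eLpNorm (by norm_num)
    (fun N => (hA N).aestronglyMeasurable) aestronglyMeasurable_const hn
  rw [tendstoInMeasure_iff_norm] at hM
  have hM' := (ENNReal.tendsto_toReal ENNReal.zero_ne_top).comp (hM η hη)
  rw [ENNReal.toReal_zero] at hM'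
  refine tendsto_of_tendsto_of_tendsto_of_le_of_le' tendsto_const_nhds hM'
    (Eventually.of_forall fun _ => measureReal_nonneg) ?_
  filter_upwards [eventually_gt_atTop 0] with N hN
  refine measureReal_mono (fun y hy => ?_)
  simp only [Set.mem_ofPred_eq, hconst] at hy ⊢
  have hN' : (0 : ℝ) < N := by exact_mod_cast hN
  have : c + η ≤ A N y := by
    simp only [A]
    rw [inv_mul_eq_div, le_div_iff₀ hN']
    exact hy
  exact le_trans (by linarith) (le_abs_self _)

/-- Exponential large deviations for Hölder observables with negative mean. -/
lemma exists_large_deviation {C Cφ Cf θ : ℝ} {φ f : (ℕ → ι) → ℝ} {m : Measure (ℕ → ι)}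
    [IsProbabilityMeasure m] (hC : 1 ≤ C) (h0 : 0 < θ) (h1 : θ < 1) (hCφ : 0 ≤ Cφ)
    (hφ : Hol Cφ θ φ) (hN : Normalized φ) (hG : GibbsW C φ m)
    (hinv : MeasurePreserving shift m m) (hCf : 0 ≤ Cf) (hf : Hol Cf θ f)
    (hneg : ∫ y, f y ∂m < 0) :
    ∃ K ≥ (0 : ℝ), ∃ δ > (0 : ℝ), ∀ n : ℕ,
      m.real {y | 0 ≤ birkhoffSum shift f n y} ≤ K * Real.exp (-δ * n) := by
  have hφc := hφ.continuous h0.le h1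
  have hfc := hf.continuous h0.le h1
  have hd := dualOp_eq_self hC hφc hG hN hinv
  have he := ergodic_shift hC hφc hG hd hinv
  have hI : ∀ F : (ℕ → ι) → ℝ, Continuous F → Integrable F m := fun F hF =>
    hF.integrable_of_hasCompactSupport (HasCompactSupport.of_compactSpace F)
  have hSc : ∀ n, Continuous fun y => birkhoffSum shift f n y := fun n =>
    continuous_finsetSum _ fun k _ => hfc.comp (continuous_shift.iterate k)
  obtain ⟨M, hM0, hM⟩ : ∃ M : ℝ, 0 ≤ M ∧ ∀ y, f y ≤ M := by
    obtain ⟨M, hM⟩ := (isCompact_range hfc).bddAbove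
    exact ⟨max M 0, le_max_right _ _, fun y => (hM ⟨y, rfl⟩).trans (le_max_left _ _)⟩
  have hSM : ∀ n y, birkhoffSum shift f n y ≤ M * n := by
    intro n y
    have := Finset.sum_le_card_nsmul (Finset.range n) (fun k => f (shift^[k] y)) M
      (fun k _ => hM _)
    simpa [birkhoffSum, mul_comm] using this
  let u : ℝ → ℕ → (ℕ → ι) → ℝ := fun t n y =>
    ∑ l ∈ words ι n, Real.exp (bs φ l y + t * bs f l y)
  have hu : ∀ t n, ∫ y, Real.exp (t * birkhoffSum shift f n y) ∂m = ∫ y, u t n y ∂m := by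
    intro t n
    rw [integral_eq_sum_words hφc hd n (F := fun y => Real.exp (t * birkhoffSum shift f n y))
      (Real.continuous_exp.comp ((hSc n).const_mul t))]
    refine integral_congr_ae (Eventually.of_forall fun y => ?_)
    refine Finset.sum_congr rfl fun l hl => ?_
    rw [mem_words] at hl
    subst hl
    rw [smul_eq_mul, ← Real.exp_add, bs_eq_birkhoffSum f]
  have huc : ∀ t n, Continuous (u t n) := fun t n => continuous_finsetSum _ fun l _ =>
    Real.continuous_exp.comp ((continuous_bs hφc l).add ((continuous_bs hfc l).const_mul t))
  have hupos : ∀ t n y, 0 ≤ u t n y := fun t n y =>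
    Finset.sum_nonneg fun l _ => (Real.exp_pos _).le
  have huadd : ∀ t n k B, (∀ y, u t n y ≤ B) → ∀ y, u t (n + k) y ≤ B * u t k y := by
    intro t n k B hB y
    simp only [u, sum_words_add]
    rw [Finset.sum_comm, Finset.mul_sum]
    refine Finset.sum_le_sum fun v _ => ?_
    calc ∑ w ∈ words ι n, Real.exp (bs φ (w ++ v) y + t * bs f (w ++ v) y)
        = u t n (app v y) * Real.exp (bs φ v y + t * bs f v y) := by
          simp only [u, Finset.sum_mul]
          refine Finset.sum_congr rfl fun w _ => ?_
          rw [bs_append, bs_append, ← Real.exp_add]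
          ring_nf
      _ ≤ _ := by gcongr; exact hB _
  set D : ℝ := Real.exp (Cφ / (1 - θ) + Cf / (1 - θ)) with hD
  have hDpos : 0 < D := Real.exp_pos _
  have hdist : ∀ t ∈ Icc (0 : ℝ) 1, ∀ n y y', u t n y ≤ D * u t n y' := by
    intro t ht n y y'
    simp only [u, Finset.mul_sum]
    refine Finset.sum_le_sum fun l _ => ?_
    rw [hD, ← Real.exp_add, Real.exp_le_exp]
    have a1 := (abs_le.1 (hφ.bs_le hCφ h0 h1 l (k := 0) (x := y) (y := y') (by simp))).2
    have a2 := (abs_le.1 (hf.bs_le hCf h0 h1 l (k := 0) (x := y) (y := y') (by simp))).2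
    have a3 : 0 ≤ Cf / (1 - θ) := div_nonneg hCf (by linarith)
    rw [pow_zero, mul_one] at a1 a2
    nlinarith [ht.1, ht.2]
  have hsup : ∀ t ∈ Icc (0 : ℝ) 1, ∀ n y,
      u t n y ≤ D * ∫ y, Real.exp (t * birkhoffSum shift f n y) ∂m := by
    intro t ht n y
    rw [hu, ← integral_const_mul]
    have := integral_mono (integrable_const (u t n y)) ((hI _ (huc t n)).const_mul D)
      (fun y' => hdist t ht n y y')
    simpa using this
  set η : ℝ := -(∫ y, f y ∂m) / 2 with hη
  have hη0 : 0 < η := by rw [hη]; linarith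
  have hlln := tendsto_measure_birkhoffSum he hfc hη0
  have hfη : ∫ z, f z ∂m + η = -η := by rw [hη]; ring
  rw [hfη] at hlln
  set p : ℕ → ℝ := fun N => m.real {y | -η * N ≤ birkhoffSum shift f N y} with hp
  have hintg : ∀ T ≥ (0 : ℝ), ∀ N : ℕ, 0 < N →
      ∫ y, Real.exp (T / N * birkhoffSum shift f N y) ∂m ≤
        Real.exp (T * M) * p N + Real.exp (-(T * η)) := by
    intro T hT N hN0
    have hN' : (0 : ℝ) < N := by exact_mod_cast hN0
    set S : Set (ℕ → ι) := {y | -η * N ≤ birkhoffSum shift f N y}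
    have hS : MeasurableSet S := measurableSet_le measurable_const (hSc N).measurable
    have hTN : 0 ≤ T / N := by positivity
    have hle : ∀ y, Real.exp (T / N * birkhoffSum shift f N y) ≤
        S.indicator (fun _ => Real.exp (T * M)) y + Real.exp (-(T * η)) := by
      intro y
      by_cases hy : y ∈ S
      · rw [Set.indicator_of_mem hy]
        have : Real.exp (T / N * birkhoffSum shift f N y) ≤ Real.exp (T * M) := by
          rw [Real.exp_le_exp]
          calc T / N * birkhoffSum shift f N y ≤ T / N * (M * N) := by gcongr; exact hSM N y
            _ = T * M := by field_simp
        linarith [Real.exp_pos (-(T * η))]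
      · rw [Set.indicator_of_notMem hy, zero_add, Real.exp_le_exp]
        have hy' : birkhoffSum shift f N y ≤ -η * N := le_of_lt (not_le.1 hy)
        calc T / N * birkhoffSum shift f N y ≤ T / N * (-η * N) := by gcongr
          _ = -(T * η) := by field_simp
    have hii : Integrable (S.indicator fun _ => Real.exp (T * M)) m :=
      (integrable_const _).indicator hS
    have := integral_mono (hI _ (Real.continuous_exp.comp ((hSc N).const_mul (T / N))))
      (hii.add (integrable_const (Real.exp (-(T * η))))) hle
    refine this.trans (le_of_eq ?_)
    simp only [Pi.add_apply]
    rw [integral_add hii (integrable_const _), integral_indicator_const _ hS]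
    simp [p, S, mul_comm]
  obtain ⟨T, hT0, hT⟩ : ∃ T ≥ (0 : ℝ), D * Real.exp (-(T * η)) ≤ 1 / 4 := by
    refine ⟨max 0 (Real.log (4 * D) / η), le_max_left _ _, ?_⟩
    have : Real.log (4 * D) ≤ max 0 (Real.log (4 * D) / η) * η := by
      rw [← div_le_iff₀ hη0]; exact le_max_right _ _
    calc D * Real.exp (-(max 0 (Real.log (4 * D) / η) * η))
        ≤ D * Real.exp (-Real.log (4 * D)) := by gcongr
      _ = 1 / 4 := by
        rw [Real.exp_neg, Real.exp_log (by positivity)]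
        field_simp
  obtain ⟨N, hN0, hNT, hNp⟩ : ∃ N : ℕ, 0 < N ∧ T ≤ N ∧ D * (Real.exp (T * M) * p N) ≤ 1 / 4 := by
    have h2 : Tendsto (fun N => D * (Real.exp (T * M) * p N)) atTop (𝓝 0) := by
      simpa using (hlln.const_mul (Real.exp (T * M))).const_mul D
    have h3 := (tendsto_order.1 h2).2 (1 / 4) (by norm_num)
    obtain ⟨N, h4, h5, h6⟩ := (h3.and ((eventually_gt_atTop 0).and
      (tendsto_natCast_atTop_atTop.eventually_ge_atTop T))).exists
    exact ⟨N, h5, h6, h4.le⟩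
  have hN' : (0 : ℝ) < N := by exact_mod_cast hN0
  set t : ℝ := T / N with ht
  have ht01 : t ∈ Icc (0 : ℝ) 1 := ⟨by positivity, by rw [ht, div_le_one hN']; exact hNT⟩
  have hhalf : ∀ y, u t N y ≤ 1 / 2 := by
    intro y
    calc u t N y ≤ D * ∫ y, Real.exp (t * birkhoffSum shift f N y) ∂m := hsup t ht01 N y
      _ ≤ D * (Real.exp (T * M) * p N + Real.exp (-(T * η))) := by
        gcongr; exact hintg T hT0 N hN0
      _ ≤ 1 / 2 := by rw [mul_add]; linarith
  have hpow : ∀ k r y, u t (N * k + r) y ≤ (1 / 2) ^ k * u t r y := by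
    intro k r
    induction k with
    | zero => intro y; simp
    | succ k ih =>
      intro y
      have e : N * (k + 1) + r = N + (N * k + r) := by ring
      rw [e]
      refine (huadd t N (N * k + r) _ hhalf y).trans ?_
      rw [pow_succ]
      nlinarith [ih y]
  have hr : ∀ r ≤ N, ∀ y, u t r y ≤ Real.exp (M * N) := by
    intro r hr y
    have h2 : u t r y ≤ ∑ l ∈ words ι r, Real.exp (bs φ l y) * Real.exp (M * N) := by
      refine Finset.sum_le_sum fun l hl => ?_
      rw [← Real.exp_add, Real.exp_le_exp]
      rw [mem_words] at hl
      have h3 : bs f l y ≤ M * N := by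
        rw [bs_eq_birkhoffSum, hl]
        refine (hSM _ _).trans ?_
        gcongr
      have h4 : 0 ≤ M * N := by positivity
      nlinarith [ht01.1, ht01.2]
    rw [← Finset.sum_mul, hN.sum_words, one_mul] at h2
    exact h2
  refine ⟨2 * Real.exp (M * N), by positivity, Real.log 2 / N,
    div_pos (Real.log_pos (by norm_num)) hN', fun n => ?_⟩
  have hfin : ∀ y, u t n y ≤ (1 / 2) ^ (n / N) * Real.exp (M * N) := by
    intro y
    have := hpow (n / N) (n % N) y
    rw [Nat.div_add_mod] at this
    refine this.trans ?_
    gcongr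
    exact hr _ (Nat.mod_lt _ hN0).le y
  have hS : MeasurableSet {y | 0 ≤ birkhoffSum shift f n y} :=
    measurableSet_le measurable_const (hSc n).measurable
  calc m.real {y | 0 ≤ birkhoffSum shift f n y}
      = ∫ y, ({y | 0 ≤ birkhoffSum shift f n y} : Set (ℕ → ι)).indicator (fun _ => (1 : ℝ)) y ∂m := by
        rw [integral_indicator_const _ hS]; simp
    _ ≤ ∫ y, Real.exp (t * birkhoffSum shift f n y) ∂m := by
        refine integral_mono ((integrable_const _).indicator hS)
          (hI _ (Real.continuous_exp.comp ((hSc n).const_mul t))) fun y => ?_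
        by_cases hy : 0 ≤ birkhoffSum shift f n y
        · rw [Set.indicator_of_mem (by exact hy)]
          exact Real.one_le_exp (mul_nonneg ht01.1 hy)
        · rw [Set.indicator_of_notMem (by exact hy)]
          exact (Real.exp_pos _).le
    _ = ∫ y, u t n y ∂m := hu t n
    _ ≤ ∫ _, (1 / 2) ^ (n / N) * Real.exp (M * N) ∂m :=
        integral_mono (hI _ (huc t n)) (integrable_const _) hfin
    _ = (1 / 2) ^ (n / N) * Real.exp (M * N) := by simp
    _ ≤ 2 * Real.exp (M * N) * Real.exp (-(Real.log 2 / N) * n) := by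
        have h2 : ((1 : ℝ) / 2) ^ (n / N) = Real.exp (-(Real.log 2) * (n / N : ℕ)) := by
          rw [mul_comm, Real.exp_nat_mul, Real.exp_neg, Real.exp_log (by norm_num), one_div]
        have h3 : (n : ℝ) / N ≤ (n / N : ℕ) + 1 := by
          rw [div_le_iff₀ hN']
          have := Nat.div_add_mod n N
          have h4 := (Nat.mod_lt n hN0).le
          have h5 : (n : ℝ) = N * (n / N : ℕ) + (n % N : ℕ) := by exact_mod_cast this.symm
          have h6 : ((n % N : ℕ) : ℝ) ≤ N := by exact_mod_cast h4
          linarith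
        have h4 : Real.exp (-(Real.log 2) * (n / N : ℕ)) ≤
            2 * Real.exp (-(Real.log 2 / N) * n) := by
          have : (2 : ℝ) = Real.exp (Real.log 2) := (Real.exp_log (by norm_num)).symm
          conv_rhs => rw [this]
          rw [Real.log_exp, ← Real.exp_add, Real.exp_le_exp]
          have h5 : Real.log 2 / N * n = Real.log 2 * (n / N) := by ring
          have h6 : 0 < Real.log 2 := Real.log_pos (by norm_num)
          nlinarith
        rw [h2]
        nlinarith [Real.exp_pos (M * N)]

end LargeDeviations

/-! ### Continuants and inverse branches -/

section Continuants

variable {ι : Type*} (dg : ι → ℕ)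

/-- The action on row vectors `(numerator, denominator)` of the inverse branch of a word. -/
def mob : List ι → ℝ × ℝ → ℝ × ℝ
  | [], z => z
  | a :: w, z => ((mob w z).2, dg a * (mob w z).2 + (mob w z).1)

/-- The entries of the matrix of the inverse branch `x ↦ (S x + P) / (R x + Q)`. -/
def cP (w : List ι) : ℝ := (mob dg w (0, 1)).1
/-- The continuant of a word. -/
def cQ (w : List ι) : ℝ := (mob dg w (0, 1)).2
/-- The leading coefficient of the numerator. -/
def cS (w : List ι) : ℝ := (mob dg w (1, 0)).1
/-- The leading coefficient of the denominator. -/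
def cR (w : List ι) : ℝ := (mob dg w (1, 0)).2

/-- The inverse branch of the Gauss map along a word. -/
noncomputable def br (w : List ι) (x : ℝ) : ℝ := (cS dg w * x + cP dg w) / (cR dg w * x + cQ dg w)

@[simp] lemma cP_nil : cP dg [] = 0 := rfl
@[simp] lemma cQ_nil : cQ dg [] = 1 := rfl
@[simp] lemma cS_nil : cS dg [] = 1 := rfl
@[simp] lemma cR_nil : cR dg [] = 0 := rfl
lemma cP_cons (a : ι) (w : List ι) : cP dg (a :: w) = cQ dg w := rfl
lemma cQ_cons (a : ι) (w : List ι) : cQ dg (a :: w) = dg a * cQ dg w + cP dg w := rfl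
lemma cS_cons (a : ι) (w : List ι) : cS dg (a :: w) = cR dg w := rfl
lemma cR_cons (a : ι) (w : List ι) : cR dg (a :: w) = dg a * cR dg w + cS dg w := rfl
@[simp] lemma br_nil (x : ℝ) : br dg [] x = x := by simp [br]

lemma mat_append (u v : List ι) :
    cP dg (u ++ v) = cS dg u * cP dg v + cP dg u * cQ dg v ∧
    cQ dg (u ++ v) = cR dg u * cP dg v + cQ dg u * cQ dg v ∧
    cS dg (u ++ v) = cS dg u * cS dg v + cP dg u * cR dg v ∧
    cR dg (u ++ v) = cR dg u * cS dg v + cQ dg u * cR dg v := by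
  induction u with
  | nil => simp
  | cons a u ih =>
    obtain ⟨h1, h2, h3, h4⟩ := ih
    simp only [List.cons_append, cP_cons, cQ_cons, cS_cons, cR_cons, h1, h2, h3, h4]
    refine ⟨trivial, ?_, trivial, ?_⟩ <;> ring

lemma cQ_append (u v : List ι) :
    cQ dg (u ++ v) = cR dg u * cP dg v + cQ dg u * cQ dg v := (mat_append dg u v).2.1

lemma cR_append (u v : List ι) :
    cR dg (u ++ v) = cR dg u * cS dg v + cQ dg u * cR dg v := (mat_append dg u v).2.2.2

lemma cQ_concat (u : List ι) (a : ι) :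
    cQ dg (u ++ [a]) = cR dg u + dg a * cQ dg u := by
  rw [cQ_append]; simp [cP_cons, cQ_cons, mul_comm]

lemma cR_concat (u : List ι) (a : ι) : cR dg (u ++ [a]) = cQ dg u := by
  rw [cR_append]; simp [cS_cons, cR_cons]

lemma mat_det (w : List ι) :
    cS dg w * cQ dg w - cP dg w * cR dg w = (-1) ^ w.length := by
  induction w with
  | nil => simp
  | cons a w ih =>
    simp only [cP_cons, cQ_cons, cS_cons, cR_cons, List.length_cons, pow_succ, ← ih]; ring

variable {dg} (hd : ∀ a, 1 ≤ dg a)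
include hd

lemma one_le_dg (a : ι) : (1 : ℝ) ≤ dg a := by exact_mod_cast hd a

lemma cPQ_bounds (w : List ι) : 0 ≤ cP dg w ∧ cP dg w ≤ cQ dg w ∧ 1 ≤ cQ dg w := by
  induction w with
  | nil => simp
  | cons a w ih =>
    obtain ⟨h1, h2, h3⟩ := ih
    rw [cP_cons, cQ_cons]
    have := one_le_dg hd a
    refine ⟨by linarith, by nlinarith, by nlinarith⟩

lemma cP_nonneg (w : List ι) : 0 ≤ cP dg w := (cPQ_bounds hd w).1
lemma cP_le (w : List ι) : cP dg w ≤ cQ dg w := (cPQ_bounds hd w).2.1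
lemma one_le_cQ (w : List ι) : 1 ≤ cQ dg w := (cPQ_bounds hd w).2.2
lemma cQ_pos (w : List ι) : 0 < cQ dg w := by linarith [one_le_cQ hd w]

lemma cR_bounds (w : List ι) : 0 ≤ cR dg w ∧ cR dg w ≤ cQ dg w := by
  induction w using List.reverseRecOn with
  | nil => simp
  | append_singleton u a ih =>
    rw [cR_concat, cQ_concat]
    have := one_le_dg hd a
    have := cQ_pos hd u
    refine ⟨by linarith, by nlinarith⟩

lemma cR_nonneg (w : List ι) : 0 ≤ cR dg w := (cR_bounds hd w).1
lemma cR_le (w : List ι) : cR dg w ≤ cQ dg w := (cR_bounds hd w).2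

lemma cS_bounds (w : List ι) : 0 ≤ cS dg w ∧ cS dg w ≤ cQ dg w := by
  cases w with
  | nil => simp
  | cons a w =>
    rw [cS_cons, cQ_cons]
    have := one_le_dg hd a
    have := cR_bounds hd w
    have := cP_nonneg hd w
    have := cQ_pos hd w
    refine ⟨by linarith, by nlinarith⟩

lemma cQ_append_le (u v : List ι) : cQ dg (u ++ v) ≤ 2 * (cQ dg u * cQ dg v) := by
  rw [cQ_append]
  have := mul_le_mul (cR_le hd u) (cP_le hd v) (cP_nonneg hd v) (cQ_pos hd u).le
  linarith

lemma den_pos (w : List ι) {x : ℝ} (hx : 0 ≤ x) : 0 < cR dg w * x + cQ dg w := by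
  have := mul_nonneg (cR_nonneg hd w) hx
  linarith [cQ_pos hd w]

lemma num_nonneg (w : List ι) {x : ℝ} (hx : 0 ≤ x) : 0 ≤ cS dg w * x + cP dg w := by
  have := mul_nonneg (cS_bounds hd w).1 hx
  linarith [cP_nonneg hd w]

lemma br_cons (a : ι) (w : List ι) {x : ℝ} (hx : 0 ≤ x) :
    br dg (a :: w) x = (dg a + br dg w x)⁻¹ := by
  have h := den_pos hd w hx
  have h2 := num_nonneg hd w hx
  have := one_le_dg hd a
  have h3 : 0 < (dg a * cR dg w + cS dg w) * x + (dg a * cQ dg w + cP dg w) := by nlinarith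
  rw [br, br, cS_cons, cP_cons, cR_cons, cQ_cons]
  rw [← one_div, div_eq_div_iff h3.ne' (by positivity)]
  field_simp
  ring

lemma br_nonneg (w : List ι) {x : ℝ} (hx : 0 ≤ x) : 0 ≤ br dg w x :=
  div_nonneg (num_nonneg hd w hx) (den_pos hd w hx).le

lemma br_append (u v : List ι) {x : ℝ} (hx : 0 ≤ x) :
    br dg (u ++ v) x = br dg u (br dg v x) := by
  induction u with
  | nil => simp
  | cons a u ih => rw [List.cons_append, br_cons hd _ _ hx, ih, br_cons hd _ _ (br_nonneg hd v hx)]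

lemma br_sub (w : List ι) {x y : ℝ} (hx : 0 ≤ x) (hy : 0 ≤ y) :
    br dg w x - br dg w y =
      (-1) ^ w.length * (x - y) / ((cR dg w * x + cQ dg w) * (cR dg w * y + cQ dg w)) := by
  have h := den_pos hd w hx
  have h2 := den_pos hd w hy
  rw [br, br, div_sub_div _ _ h.ne' h2.ne', ← mat_det dg w]
  congr 1
  ring

lemma hasDerivAt_br (w : List ι) {x : ℝ} (hx : 0 ≤ x) :
    HasDerivAt (br dg w) ((-1) ^ w.length / (cR dg w * x + cQ dg w) ^ 2) x := by
  have h := den_pos hd w hx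
  have h1 : HasDerivAt (fun x => cS dg w * x + cP dg w) (cS dg w) x := by
    simpa using ((hasDerivAt_id x).const_mul (cS dg w)).add_const (cP dg w)
  have h2 : HasDerivAt (fun x => cR dg w * x + cQ dg w) (cR dg w) x := by
    simpa using ((hasDerivAt_id x).const_mul (cR dg w)).add_const (cQ dg w)
  have := h1.div h2 h.ne'
  refine this.congr_deriv ?_
  rw [← mat_det dg w]
  congr 1
  ring

lemma abs_br_sub (w : List ι) {x y : ℝ} (hx : 0 ≤ x) (hy : 0 ≤ y) :
    |br dg w x - br dg w y| =
      |x - y| / ((cR dg w * x + cQ dg w) * (cR dg w * y + cQ dg w)) := by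
  rw [br_sub hd w hx hy, abs_div, abs_mul, abs_pow]
  simp [abs_of_pos (den_pos hd w hx), abs_of_pos (den_pos hd w hy)]

lemma abs_br_sub_le (w : List ι) {x y : ℝ} (hx : 0 ≤ x) (hy : 0 ≤ y) :
    |br dg w x - br dg w y| ≤ |x - y| / cQ dg w ^ 2 := by
  rw [abs_br_sub hd w hx hy, sq]
  have h := cQ_pos hd w
  have h1 := mul_nonneg (cR_nonneg hd w) hx
  have h2 := mul_nonneg (cR_nonneg hd w) hy
  gcongr <;> linarith

variable {K : ℕ} (hK : ∀ a, dg a ≤ K)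
include hK

omit hd in
lemma dg_le (a : ι) : (dg a : ℝ) ≤ K := by exact_mod_cast hK a

lemma cQ_le_pow (w : List ι) : cQ dg w ≤ (K + 1) ^ w.length := by
  induction w with
  | nil => simp
  | cons a w ih =>
    rw [cQ_cons, List.length_cons, pow_succ]
    have := cP_le hd w
    have := dg_le hK a
    have := cQ_pos hd w
    nlinarith

lemma cQ_le_cR (w : List ι) (hw : w ≠ []) : cQ dg w ≤ (K + 1) * cR dg w := by
  obtain ⟨u, a, rfl⟩ : ∃ u a, w = u ++ [a] :=
    ⟨w.dropLast, w.getLast hw, (List.dropLast_append_getLast hw).symm⟩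
  rw [cR_concat, cQ_concat]
  have := cR_le hd u
  have := dg_le hK a
  have := cQ_pos hd u
  nlinarith

/-- Denominators of two words of equal length are separated in terms of their common suffix. -/
lemma separation {e e' c : List ι} {x x' : ι} (hlen : e.length = e'.length)
    (hx : dg x ≠ dg x') :
    cQ dg (e ++ x :: c) / (8 * (K + 1) ^ 3 * cQ dg c ^ 2) ≤
      |cQ dg (e ++ x :: c) - cQ dg (e' ++ x' :: c)| +
        |cR dg (e ++ x :: c) - cR dg (e' ++ x' :: c)| := by
  have key : ∀ (e e' : List ι) (x x' : ι), e.length = e'.length → dg x < dg x' →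
      cQ dg e * cQ dg e' ≤ (K + 1) * (cQ dg (e' ++ [x']) * cQ dg e - cQ dg (e ++ [x]) * cQ dg e') := by
    intro e e' x x' hl h
    rw [cQ_concat, cQ_concat]
    have h1 : (dg x : ℝ) + 1 ≤ dg x' := by exact_mod_cast h
    have hq := cQ_pos hd e
    have hq' := cQ_pos hd e'
    have hr := cR_le hd e
    have hr' := cR_nonneg hd e'
    have hKn : (0 : ℝ) ≤ K := by positivity
    by_cases hn : e' = []
    · subst hn
      have : e = [] := by simpa using hl
      subst this
      simp
      nlinarith
    · have h3 := cQ_le_cR hd hK e' hn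
      have h4 : 0 ≤ (cQ dg e - cR dg e) * cQ dg e' := mul_nonneg (by linarith) hq'.le
      have h5 : 0 ≤ ((dg x' : ℝ) - dg x - 1) * (cQ dg e * cQ dg e') :=
        mul_nonneg (by linarith) (by positivity)
      have h6 : cQ dg e * cQ dg e' ≤ (K + 1) * (cR dg e' * cQ dg e) := by nlinarith
      have h7 : 0 ≤ ((K : ℝ) + 1) * ((cQ dg e - cR dg e) * cQ dg e' +
        ((dg x' : ℝ) - dg x - 1) * (cQ dg e * cQ dg e')) := by positivity
      nlinarith
  have key2 : cQ dg e * cQ dg e' ≤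
      (K + 1) * |cQ dg (e ++ [x]) * cQ dg e' - cQ dg (e' ++ [x']) * cQ dg e| := by
    rcases lt_or_gt_of_ne hx with h | h
    · refine (key e e' x x' hlen h).trans ?_
      gcongr
      rw [abs_sub_comm]
      exact le_abs_self _
    · rw [mul_comm]
      refine (key e' e x' x hlen.symm h).trans ?_
      gcongr
      exact le_abs_self _
  set q := cQ dg (e ++ [x]) with hq
  set q' := cQ dg (e' ++ [x']) with hq'
  set r := cQ dg e with hr
  set r' := cQ dg e' with hr'
  have hrp : 0 < r := cQ_pos hd _
  have hrp' : 0 < r' := cQ_pos hd _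
  have hqr : q ≤ (K + 1) * r := by
    have := cQ_le_cR hd hK (e ++ [x]) (by simp)
    rwa [cR_concat] at this
  have hqp : 0 < q := cQ_pos hd _
  -- gap of the first rows
  set D := |q - q'| + |r - r'| with hD
  have h1 : r * r' ≤ (K + 1) * (q * D) := by
    refine key2.trans ?_
    gcongr
    have e1 : q * r' - q' * r = r * (q - q') - q * (r - r') := by ring
    rw [e1]
    have h2 : r ≤ q := by
      have := cR_le hd (e ++ [x]); rwa [cR_concat] at this
    calc |r * (q - q') - q * (r - r')| ≤ |r * (q - q')| + |q * (r - r')| := abs_sub _ _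
      _ = r * |q - q'| + q * |r - r'| := by
          rw [abs_mul, abs_mul, abs_of_pos hrp, abs_of_pos hqp]
      _ ≤ q * |q - q'| + q * |r - r'| := by gcongr
      _ = q * D := by rw [hD]; ring
  have hKn : (0 : ℝ) ≤ K := by positivity
  have h2 : r' ≤ (K + 1) ^ 2 * D := by
    have : r * r' ≤ r * ((K + 1) ^ 2 * D) := by
      refine h1.trans ?_
      calc (K + 1) * (q * D) ≤ (K + 1) * (((K + 1) * r) * D) := by gcongr
        _ = _ := by ring
    exact le_of_mul_le_mul_left this hrp
  have h3 : q ≤ 2 * (K + 1) ^ 3 * D := by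
    have : r ≤ r' + D := by
      have := le_abs_self (r - r')
      have := abs_nonneg (q - q')
      linarith
    have hD0 : 0 ≤ D := by positivity
    have h4 : D ≤ (K + 1) ^ 2 * D := by
      have : (1 : ℝ) ≤ (K + 1) ^ 2 := one_le_pow₀ (by linarith)
      nlinarith
    calc q ≤ (K + 1) * r := hqr
      _ ≤ (K + 1) * ((K + 1) ^ 2 * D + (K + 1) ^ 2 * D) := by gcongr; linarith
      _ = _ := by ring
  have eQ : ∀ (e : List ι) (x : ι), cQ dg (e ++ x :: c) =
      cQ dg e * cP dg c + cQ dg (e ++ [x]) * cQ dg c := by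
    intro e x
    rw [List.append_cons, cQ_append, cR_concat]
  have eR : ∀ (e : List ι) (x : ι), cR dg (e ++ x :: c) =
      cQ dg e * cS dg c + cQ dg (e ++ [x]) * cR dg c := by
    intro e x
    rw [List.append_cons, cR_append, cR_concat]
  set δ := |cQ dg (e ++ x :: c) - cQ dg (e' ++ x' :: c)| +
        |cR dg (e ++ x :: c) - cR dg (e' ++ x' :: c)| with hδ
  have hc := cQ_pos hd c
  have hdet : |cS dg c * cQ dg c - cP dg c * cR dg c| = 1 := by rw [mat_det]; simp
  have e1 : |q - q'| ≤ cS dg c * |cQ dg (e ++ x :: c) - cQ dg (e' ++ x' :: c)| +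
      cP dg c * |cR dg (e ++ x :: c) - cR dg (e' ++ x' :: c)| := by
    rw [← abs_of_nonneg (cS_bounds hd c).1, ← abs_of_nonneg (cP_nonneg hd c), ← abs_mul, ← abs_mul]
    refine le_trans (le_of_eq ?_) (abs_sub _ _)
    rw [← mul_one |q - q'|, ← hdet, ← abs_mul, eQ, eQ, eR, eR]
    congr 1
    ring
  have e2 : |r - r'| ≤ cQ dg c * |cR dg (e ++ x :: c) - cR dg (e' ++ x' :: c)| +
      cR dg c * |cQ dg (e ++ x :: c) - cQ dg (e' ++ x' :: c)| := by
    rw [← abs_of_nonneg (cR_nonneg hd c), ← abs_of_pos hc, ← abs_mul, ← abs_mul]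
    refine le_trans (le_of_eq ?_) (abs_sub _ _)
    rw [← mul_one |r - r'|, ← hdet, ← abs_mul, eQ, eQ, eR, eR]
    congr 1
    ring
  have h5 : D ≤ 2 * cQ dg c * δ := by
    have n1 := abs_nonneg (cQ dg (e ++ x :: c) - cQ dg (e' ++ x' :: c))
    have n2 := abs_nonneg (cR dg (e ++ x :: c) - cR dg (e' ++ x' :: c))
    have m1 := mul_le_mul_of_nonneg_right (cS_bounds hd c).2 n1
    have m2 := mul_le_mul_of_nonneg_right (cP_le hd c) n2
    have m3 := mul_le_mul_of_nonneg_right (cR_le hd c) n1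
    have : 2 * cQ dg c * δ = 2 * (cQ dg c * |cQ dg (e ++ x :: c) - cQ dg (e' ++ x' :: c)|) +
      2 * (cQ dg c * |cR dg (e ++ x :: c) - cR dg (e' ++ x' :: c)|) := by rw [hδ]; ring
    linarith
  have h6 : cQ dg (e ++ x :: c) ≤ 2 * (q * cQ dg c) := by
    have := cQ_append_le hd (e ++ [x]) c
    rwa [← List.append_cons] at this
  rw [div_le_iff₀ (by positivity)]
  calc cQ dg (e ++ x :: c) ≤ 2 * (q * cQ dg c) := h6
    _ ≤ 2 * ((2 * (K + 1) ^ 3 * (2 * cQ dg c * δ)) * cQ dg c) := by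
        gcongr
        exact h3.trans (by gcongr)
    _ = _ := by ring

end Continuants

/-! ### The coding map -/

section Coding

variable {ι : Type*} (dg : ι → ℕ)

/-- The real number with the continued fraction digits of a sequence. -/
noncomputable def code (y : ℕ → ι) : ℝ := limUnder atTop fun n => br dg (pre n y) 1

variable {dg} (hd : ∀ a, 1 ≤ dg a) {K : ℕ} (hK : ∀ a, dg a ≤ K)

/-- The contraction ratio of the inverse branches. -/
noncomputable def ratio (K : ℕ) : ℝ := ((1 + ((K : ℝ) + 1)⁻¹) ^ 2)⁻¹

lemma ratio_pos (K : ℕ) : 0 < ratio K := by unfold ratio; positivity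

lemma ratio_lt_one (K : ℕ) : ratio K < 1 := by
  unfold ratio
  apply inv_lt_one_of_one_lt₀
  have : (0 : ℝ) < ((K : ℝ) + 1)⁻¹ := by positivity
  nlinarith

include hd hK

lemma br_mem_Icc (w : List ι) {x : ℝ} (hx : x ∈ Icc ((K : ℝ) + 1)⁻¹ 1) :
    br dg w x ∈ Icc ((K : ℝ) + 1)⁻¹ 1 := by
  have hx0 : 0 ≤ x := le_trans (by positivity) hx.1
  induction w with
  | nil => simpa using hx
  | cons a w ih =>
    rw [br_cons hd _ _ hx0]
    have h1 := one_le_dg hd a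
    have h2 := dg_le hK a
    have h3 : (0 : ℝ) ≤ ((K : ℝ) + 1)⁻¹ := by positivity
    constructor
    · exact inv_anti₀ (by linarith [ih.1]) (by linarith [ih.2])
    · exact inv_le_one_of_one_le₀ (by linarith [ih.1])

lemma abs_br_sub_le_ratio (w : List ι) {x y : ℝ} (hx : x ∈ Icc ((K : ℝ) + 1)⁻¹ 1)
    (hy : y ∈ Icc ((K : ℝ) + 1)⁻¹ 1) :
    |br dg w x - br dg w y| ≤ ratio K ^ w.length * |x - y| := by
  have hx0 : 0 ≤ x := le_trans (by positivity) hx.1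
  have hy0 : 0 ≤ y := le_trans (by positivity) hy.1
  induction w with
  | nil => simp
  | cons a w ih =>
    have h1 := one_le_dg hd a
    have h3 : (0 : ℝ) ≤ ((K : ℝ) + 1)⁻¹ := by positivity
    have bx := (br_mem_Icc hd hK w hx).1
    have b_y := (br_mem_Icc hd hK w hy).1
    rw [br_cons hd _ _ hx0, br_cons hd _ _ hy0, inv_sub_inv (by linarith) (by linarith), abs_div,
      add_sub_add_left_eq_sub, abs_sub_comm, abs_of_pos (a := _ * _) (by
        apply mul_pos <;> linarith), List.length_cons, pow_succ', mul_assoc]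
    rw [div_eq_mul_inv, mul_comm]
    refine mul_le_mul ?_ ih (abs_nonneg _) (ratio_pos K).le
    unfold ratio
    rw [sq]
    gcongr
    linarith

lemma cauchySeq_br (y : ℕ → ι) : CauchySeq fun n => br dg (pre n y) 1 := by
  refine cauchySeq_of_le_geometric (ratio K) 1 (ratio_lt_one K) fun n => ?_
  have h1 : (1 : ℝ) ∈ Icc ((K : ℝ) + 1)⁻¹ 1 :=
    ⟨inv_le_one_of_one_le₀ (by linarith [(Nat.cast_nonneg K : (0 : ℝ) ≤ K)]), le_rfl⟩
  have hsucc : ∀ (n : ℕ) (y : ℕ → ι), pre (n + 1) y = pre n y ++ [y n] := by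
    intro n
    induction n with
    | zero => intro y; rfl
    | succ n ih => intro y; rw [pre, ih (shift y)]; rfl
  rw [Real.dist_eq, hsucc, br_append hd _ _ zero_le_one, one_mul]
  refine (abs_br_sub_le_ratio hd hK _ h1 (br_mem_Icc hd hK _ h1)).trans ?_
  rw [pre_length]
  have h2 := br_mem_Icc hd hK [y n] h1
  have h3 : (0 : ℝ) ≤ ((K : ℝ) + 1)⁻¹ := by positivity
  refine mul_le_of_le_one_right (pow_nonneg (ratio_pos K).le _) ?_
  rw [abs_le]; constructor <;> linarith [h2.1, h2.2]

lemma tendsto_code (y : ℕ → ι) : Tendsto (fun n => br dg (pre n y) 1) atTop (𝓝 (code dg y)) :=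
  (cauchySeq_br hd hK y).tendsto_limUnder

lemma code_mem_Icc (y : ℕ → ι) : code dg y ∈ Icc ((K : ℝ) + 1)⁻¹ 1 := by
  refine isClosed_Icc.mem_of_tendsto (tendsto_code hd hK y) (Eventually.of_forall fun n => ?_)
  refine br_mem_Icc hd hK _ ⟨inv_le_one_of_one_le₀ ?_, le_rfl⟩
  linarith [(Nat.cast_nonneg K : (0 : ℝ) ≤ K)]

lemma code_pos (y : ℕ → ι) : 0 < code dg y :=
  lt_of_lt_of_le (by positivity) (code_mem_Icc hd hK y).1

lemma code_scons (a : ι) (y : ℕ → ι) : code dg (scons a y) = (dg a + code dg y)⁻¹ := by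
  have h1 := (tendsto_code hd hK (scons a y)).comp (tendsto_add_atTop_nat 1)
  have h2 : Tendsto (fun n => (dg a + br dg (pre n y) 1)⁻¹) atTop (𝓝 (dg a + code dg y)⁻¹) := by
    refine ((tendsto_code hd hK y).const_add _).inv₀ ?_
    linarith [code_pos hd hK y, one_le_dg hd a]
  refine tendsto_nhds_unique h1 (h2.congr fun n => ?_)
  simp [pre, br_cons hd _ _ zero_le_one]

lemma code_app (w : List ι) (y : ℕ → ι) : code dg (app w y) = br dg w (code dg y) := by
  induction w with
  | nil => simp
  | cons a w ih => rw [app_cons, code_scons hd hK, ih, br_cons hd _ _ (code_pos hd hK y).le]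

lemma hol_code : Hol 1 (ratio K) (code dg) := by
  intro n x y h
  have hp : pre n x = pre n y := by
    induction n generalizing x y with
    | zero => rfl
    | succ n ih =>
      rw [pre, pre, h 0 (by omega), ih (shift x) (shift y) fun i hi => h (i + 1) (by omega)]
  rw [← app_pre n x, ← app_pre n y, code_app hd hK, code_app hd hK, hp]
  refine (abs_br_sub_le_ratio hd hK _ (code_mem_Icc hd hK _) (code_mem_Icc hd hK _)).trans ?_
  rw [pre_length, one_mul]
  refine mul_le_of_le_one_right (pow_nonneg (ratio_pos K).le _) ?_
  have h2 := code_mem_Icc hd hK (shift^[n] x)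
  have h4 := code_mem_Icc hd hK (shift^[n] y)
  have h3 : (0 : ℝ) ≤ ((K : ℝ) + 1)⁻¹ := by positivity
  rw [abs_le]; constructor <;> linarith [h2.1, h2.2, h4.1, h4.2]

lemma code_lt_one (y : ℕ → ι) : code dg y < 1 := by
  rw [← scons_shift y, code_scons hd hK]
  exact inv_lt_one_of_one_lt₀ (by linarith [code_pos hd hK (shift y), one_le_dg hd (y 0)])

lemma irrational_code (y : ℕ → ι) : Irrational (code dg y) := by
  have key : ∀ N : ℕ, ∀ (y : ℕ → ι) (p q : ℕ), q ≤ N → 0 < q → code dg y * q ≠ p := by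
    intro N
    induction N with
    | zero => intro y p q h1 h2; omega
    | succ N ih =>
      intro y p q hq hq0 h
      have c0 := code_pos hd hK y
      have c1 := code_lt_one hd hK y
      have hq0' : (0 : ℝ) < q := by exact_mod_cast hq0
      have hp0 : (0 : ℝ) < p := by rw [← h]; positivity
      have hpq : (p : ℝ) < q := by rw [← h]; nlinarith
      have hpq' : p < q := by exact_mod_cast hpq
      have t0 := code_pos hd hK (shift y)
      have e := code_scons hd hK (y 0) (shift y)
      rw [scons_shift] at e
      have d1 := one_le_dg hd (y 0)
      have e2 : code dg (shift y) * p = q - dg (y 0) * p := by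
        rw [e, inv_mul_eq_div, div_eq_iff (by positivity)] at h
        linarith
      have hle : dg (y 0) * p ≤ q := by
        have : (dg (y 0) * p : ℝ) ≤ q := by
          have := mul_pos t0 hp0
          linarith
        exact_mod_cast this
      refine ih (shift y) (q - dg (y 0) * p) p (by omega) (by exact_mod_cast hp0) ?_
      rw [e2, Nat.cast_sub hle]; push_cast; ring
  rintro ⟨r, hr⟩
  have c0 := code_pos hd hK y
  have hr0 : 0 ≤ r := by
    have : (0 : ℝ) ≤ (r : ℝ) := by rw [hr]; exact c0.le
    exact_mod_cast this
  refine key r.den y r.num.toNat r.den le_rfl r.den_pos ?_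
  rw [← hr]
  have h1 : ((r.num.toNat : ℤ) : ℝ) = (r.num : ℝ) := by
    rw [Int.toNat_of_nonneg (Rat.num_nonneg.mpr hr0)]
  have h2 : (r * r.den : ℚ) = r.num := Rat.mul_den_eq_num r
  have h3 : ((r * r.den : ℚ) : ℝ) = ((r.num : ℚ) : ℝ) := by rw [h2]
  push_cast at h1 h3
  rw [h3]; exact_mod_cast h1.symm

/-- The Birkhoff sum of `-2 log` is the logarithm of the squared denominator. -/
lemma bs_log_code (w : List ι) (y : ℕ → ι) :
    bs (fun y => -2 * Real.log (code dg y)) w y =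
      2 * Real.log (cR dg w * code dg y + cQ dg w) := by
  have c0 := code_pos hd hK y
  induction w with
  | nil => simp
  | cons a w ih =>
    have h1 := den_pos hd w c0.le
    have h2 := num_nonneg hd w c0.le
    have d1 := one_le_dg hd a
    have h3 : 0 < dg a + br dg w (code dg y) := by linarith [br_nonneg hd w c0.le]
    rw [bs_cons, ih, code_scons hd hK, code_app hd hK, Real.log_inv]
    have e : cR dg (a :: w) * code dg y + cQ dg (a :: w) =
        (dg a + br dg w (code dg y)) * (cR dg w * code dg y + cQ dg w) := by
      rw [br, cR_cons, cQ_cons, add_mul (dg a : ℝ), div_mul_cancel₀ _ h1.ne']; ring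
    rw [e, Real.log_mul h3.ne' h1.ne']
    ring

lemma bs_log_code_bounds (w : List ι) (y : ℕ → ι) :
    2 * Real.log (cQ dg w) ≤ bs (fun y => -2 * Real.log (code dg y)) w y ∧
    bs (fun y => -2 * Real.log (code dg y)) w y ≤ 2 * Real.log (2 * cQ dg w) := by
  have c0 := code_pos hd hK y
  have c1 := code_lt_one hd hK y
  have hq := cQ_pos hd w
  have hr := cR_nonneg hd w
  have hr' := cR_le hd w
  have h1 := mul_nonneg hr c0.le
  have h2 : cR dg w * code dg y ≤ cQ dg w := by nlinarith
  rw [bs_log_code hd hK]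
  constructor
  · have := Real.log_le_log hq (by linarith : cQ dg w ≤ cR dg w * code dg y + cQ dg w)
    linarith
  · have := Real.log_le_log (by linarith) (by linarith : cR dg w * code dg y + cQ dg w ≤ 2 * cQ dg w)
    linarith

lemma hol_log_code : Hol (2 * (K + 1)) (ratio K) (fun y => -2 * Real.log (code dg y)) := by
  have key : ∀ s t : ℝ, ((K : ℝ) + 1)⁻¹ ≤ s → 0 < s → 0 < t →
      Real.log t - Real.log s ≤ (K + 1) * |t - s| := by
    intro s t h1 hs ht
    rw [← Real.log_div ht.ne' hs.ne']
    refine (Real.log_le_sub_one_of_pos (by positivity)).trans ?_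
    rw [div_sub_one hs.ne', div_eq_inv_mul]
    have : s⁻¹ ≤ K + 1 := by
      rw [← inv_inv ((K : ℝ) + 1)]; exact inv_anti₀ (by positivity) h1
    calc s⁻¹ * (t - s) ≤ s⁻¹ * |t - s| := by gcongr; exact le_abs_self _
      _ ≤ _ := by gcongr
  intro n x y h
  have h0 := hol_code hd hK n x y h
  rw [one_mul] at h0
  have a1 := key _ _ (code_mem_Icc hd hK x).1 (code_pos hd hK x) (code_pos hd hK y)
  have a2 := key _ _ (code_mem_Icc hd hK y).1 (code_pos hd hK y) (code_pos hd hK x)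
  rw [abs_sub_comm] at a1
  have a3 : ((K : ℝ) + 1) * |code dg x - code dg y| ≤ (K + 1) * ratio K ^ n := by gcongr
  rw [abs_le]
  constructor <;> linarith

end Coding

/-! ### Oscillatory integrals -/

section Oscillatory

/-- Integration by parts against an explicit primitive bound for the derivative of `1 / deriv f`. -/
lemma norm_integral_exp_le {c d Ξ : ℝ} (hcd : c ≤ d) (hΞ : 0 < Ξ) {f f' v v' B B' : ℝ → ℝ}
    (hfm : Measurable f)
    (hf : ∀ x ∈ Icc c d, HasDerivAt f (f' x) x) (hv : ∀ x ∈ Icc c d, HasDerivAt v (v' x) x)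
    (hB : ∀ x ∈ Icc c d, HasDerivAt B (B' x) x) (hvf : ∀ x ∈ Icc c d, v x * f' x = 1)
    (hvB : ∀ x ∈ Icc c d, |v' x| ≤ B' x) :
    ‖∫ x in c..d, Complex.exp ((Ξ * f x : ℝ) * Complex.I)‖ ≤
      (|v c| + |v d| + (B d - B c)) / Ξ := by
  set e : ℝ → ℂ := fun x => Complex.exp ((Ξ * f x : ℝ) * Complex.I) with he
  have hen : ∀ x, ‖e x‖ = 1 := fun x => Complex.norm_exp_ofReal_mul_I _
  have hem : Measurable e := by
    have : Measurable fun x => ((Ξ * f x : ℝ) : ℂ) :=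
      Complex.measurable_ofReal.comp (hfm.const_mul Ξ)
    exact (this.mul_const _).cexp
  have hi : ∀ a b : ℝ, IntervalIntegrable e volume a b := by
    intro a b
    refine (intervalIntegrable_const (c := (1 : ℝ))).mono_fun hem.aestronglyMeasurable ?_
    exact Eventually.of_forall fun x => by simp [hen]
  have hed : ∀ x ∈ Icc c d, HasDerivAt e (e x * ((Ξ * f' x : ℝ) * Complex.I)) x := by
    intro x hx
    have h1 : HasDerivAt (fun x => ((Ξ * f x : ℝ) : ℂ)) ((Ξ * f' x : ℝ) : ℂ) x :=
      ((hf x hx).const_mul Ξ).ofReal_comp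
    exact (h1.mul_const Complex.I).cexp
  set F : ℝ → ℂ := fun x => (∫ t in c..x, e t) * (Ξ * Complex.I) - ((v x : ℂ) * e x - v c * e c)
    with hF
  have hFd : ∀ x ∈ Icc c d, HasDerivAt F (-((v' x : ℂ) * e x)) x := by
    intro x hx
    have h1 : HasDerivAt (fun x => ∫ t in c..x, e t) (e x) x :=
      intervalIntegral.integral_hasDerivAt_right (hi _ _)
        hem.stronglyMeasurable.stronglyMeasurableAtFilter (hed x hx).continuousAt
    have h2 : HasDerivAt (fun x => ((v x : ℝ) : ℂ)) (v' x : ℂ) x := (hv x hx).ofReal_comp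
    have h3 := (h1.mul_const (Ξ * Complex.I)).sub ((h2.mul (hed x hx)).sub_const (v c * e c))
    refine h3.congr_deriv ?_
    have h4 : ((v x : ℂ)) * (f' x : ℂ) = 1 := by exact_mod_cast hvf x hx
    push_cast
    linear_combination (-(e x * Ξ * Complex.I)) * h4
  have hbound : ‖F d‖ ≤ B d - B c := by
    refine image_norm_le_of_norm_deriv_right_le_deriv_boundary' (f := F)
      (f' := fun x => -((v' x : ℂ) * e x)) (B := fun x => B x - B c) (B' := B') (a := c) (b := d)
      (fun x hx => (hFd x hx).continuousAt.continuousWithinAt)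
      (fun x hx => (hFd x (Ico_subset_Icc_self hx)).hasDerivWithinAt) (by simp [hF])
      (fun x hx => ((hB x hx).sub_const _).continuousAt.continuousWithinAt)
      (fun x hx => ((hB x (Ico_subset_Icc_self hx)).sub_const _).hasDerivWithinAt)
      (fun x hx => ?_) (right_mem_Icc.2 hcd)
    rw [norm_neg, norm_mul, hen, mul_one, Complex.norm_real]
    exact hvB x (Ico_subset_Icc_self hx)
  rw [le_div_iff₀ hΞ]
  have h1 : ‖∫ x in c..d, e x‖ * Ξ = ‖(∫ x in c..d, e x) * (Ξ * Complex.I)‖ := by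
    simp [abs_of_pos hΞ]
  rw [h1]
  have h2 : (∫ x in c..d, e x) * (Ξ * Complex.I) = F d + ((v d : ℂ) * e d - v c * e c) := by
    rw [hF]; ring
  rw [h2]
  calc ‖F d + ((v d : ℂ) * e d - v c * e c)‖ ≤ ‖F d‖ + (‖(v d : ℂ) * e d‖ + ‖v c * e c‖) :=
        (norm_add_le _ _).trans (by gcongr; exact norm_sub_le _ _)
    _ ≤ (B d - B c) + (|v d| + |v c|) := by
        rw [norm_mul, norm_mul, hen, hen, mul_one, mul_one, Complex.norm_real, Complex.norm_real]
        gcongr <;> simp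
    _ = _ := by ring

/-- The oscillatory integral of a difference of two inverse branches, away from the stationary
point. -/
lemma norm_integral_exp_le_of_gap {c d Ξ r q r' q' W ρ σ : ℝ} (hcd : c ≤ d) (hc0 : 0 ≤ c)
    (hΞ : 0 < Ξ) (hr : 0 ≤ r) (hq : 0 < q) (hr' : 0 ≤ r') (hq' : 0 < q') (hρ : 0 < ρ)
    (hσ : |σ| = 1) {f : ℝ → ℝ} (hfm : Measurable f)
    (hf : ∀ x ∈ Icc c d, HasDerivAt f (σ / (r * x + q) ^ 2 - σ / (r' * x + q') ^ 2) x)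
    (hW : ∀ x ∈ Icc c d,
      ((r * x + q) * (r' * x + q')) ^ 2 / ((r * x + q) + (r' * x + q')) ≤ W)
    (hgap : ∀ x ∈ Icc c d, ρ ≤ |(r' * x + q') - (r * x + q)|) :
    ‖∫ x in c..d, Complex.exp ((Ξ * f x : ℝ) * Complex.I)‖ ≤ 5 * W / (ρ * Ξ) := by
  set u : ℝ → ℝ := fun x => r * x + q with hu
  set u' : ℝ → ℝ := fun x => r' * x + q' with hu'
  set l : ℝ → ℝ := fun x => u' x - u x with hl
  set w : ℝ → ℝ := fun x => (u x * u' x) ^ 2 / (u x + u' x) with hw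
  set wd : ℝ → ℝ := fun x => (2 * (u x * u' x) * (r * u' x + u x * r') * (u x + u' x) -
    (u x * u' x) ^ 2 * (r + r')) / (u x + u' x) ^ 2 with hwd
  have up : ∀ x ∈ Icc c d, 0 < u x := fun x hx => by
    have := mul_nonneg hr (hc0.trans hx.1); simp only [hu]; linarith
  have up' : ∀ x ∈ Icc c d, 0 < u' x := fun x hx => by
    have := mul_nonneg hr' (hc0.trans hx.1); simp only [hu']; linarith
  have ud : ∀ x, HasDerivAt u r x := fun x => by
    exact (((hasDerivAt_id x).const_mul r).add_const q).congr_deriv (mul_one r)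
  have ud' : ∀ x, HasDerivAt u' r' x := fun x => by
    exact (((hasDerivAt_id x).const_mul r').add_const q').congr_deriv (mul_one r')
  have ld : ∀ x, HasDerivAt l (r' - r) x := fun x => (ud' x).sub (ud x)
  have wdv : ∀ x ∈ Icc c d, HasDerivAt w (wd x) x := fun x hx => by
    have h1 := (((ud x).mul (ud' x)).pow 2).div ((ud x).add (ud' x))
      (by have := up x hx; have := up' x hx; simp only [Pi.add_apply]; positivity)
    refine h1.congr_deriv ?_
    simp [hwd]
  have wdn : ∀ x ∈ Icc c d, 0 ≤ wd x := fun x hx => by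
    have h1 := up x hx
    have h2 := up' x hx
    simp only [hwd]
    apply div_nonneg _ (by positivity)
    have : 2 * (u x * u' x) * (r * u' x + u x * r') * (u x + u' x) -
      (u x * u' x) ^ 2 * (r + r') = (u x * u' x) * (2 * (r * u' x ^ 2 + r' * u x ^ 2) +
        (u x * u' x) * (r + r')) := by ring
    rw [this]; positivity
  have wn : ∀ x ∈ Icc c d, 0 ≤ w x := fun x hx => by
    have h1 := up x hx
    have h2 := up' x hx
    simp only [hw]; positivity
  have ln : ∀ x ∈ Icc c d, l x ≠ 0 := fun x hx h => by
    have := hgap x hx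
    change ρ ≤ |l x| at this
    rw [h, abs_zero] at this; linarith
  have linv : ∀ x ∈ Icc c d, |(l x)⁻¹| ≤ ρ⁻¹ := fun x hx => by
    rw [abs_inv]; exact inv_anti₀ hρ (hgap x hx)
  have hs2 : σ * σ = 1 := by rw [← abs_mul_abs_self, hσ]; norm_num
  obtain ⟨s, hs, hsβ⟩ : ∃ s : ℝ, |s| ≤ 1 ∧ s * (r' - r) = |r' - r| := by
    rcases le_total 0 (r' - r) with h | h
    · exact ⟨1, by simp, by rw [abs_of_nonneg h, one_mul]⟩
    · exact ⟨-1, by simp, by rw [abs_of_nonpos h]; ring⟩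
  have hcm : c ∈ Icc c d := left_mem_Icc.2 hcd
  have hdm : d ∈ Icc c d := right_mem_Icc.2 hcd
  have hW0 : 0 ≤ W := (wn c hcm).trans (hW c hcm)
  have hlinvd : ∀ x ∈ Icc c d, HasDerivAt (fun x => (l x)⁻¹) (-(r' - r) / l x ^ 2) x :=
    fun x hx => (ld x).inv (ln x hx)
  have main := norm_integral_exp_le hcd hΞ hfm hf
    (v := fun x => σ * (w x * (l x)⁻¹))
    (v' := fun x => σ * (wd x * (l x)⁻¹ + w x * (-(r' - r) / l x ^ 2)))
    (B := fun x => w x * ρ⁻¹ + W * (-s * (l x)⁻¹))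
    (B' := fun x => wd x * ρ⁻¹ + W * (-s * (-(r' - r) / l x ^ 2)))
    (fun x hx => ((wdv x hx).mul (hlinvd x hx)).const_mul σ)
    (fun x hx => ((wdv x hx).mul_const _).add (((hlinvd x hx).const_mul _).const_mul _))
    (fun x hx => by
      have h1 := (up x hx).ne'
      have h2 := (up' x hx).ne'
      have h3 := ln x hx
      have h4 : u x + u' x ≠ 0 := (add_pos (up x hx) (up' x hx)).ne'
      change σ * ((u x * u' x) ^ 2 / (u x + u' x) * (l x)⁻¹) * (σ / u x ^ 2 - σ / u' x ^ 2) = 1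
      have h5 : σ / u x ^ 2 - σ / u' x ^ 2 =
          σ * (l x * (u x + u' x)) / (u x * u' x) ^ 2 := by
        simp only [hl]; field_simp; ring
      rw [h5]
      field_simp
      linarith [hs2])
    (fun x hx => by
      rw [abs_mul, hσ, one_mul]
      refine (abs_add_le _ _).trans ?_
      rw [abs_mul, abs_mul, abs_of_nonneg (wdn x hx), abs_of_nonneg (wn x hx)]
      have e1 : -s * (-(r' - r) / l x ^ 2) = |-(r' - r) / l x ^ 2| := by
        rw [abs_div, abs_neg, abs_of_nonneg (sq_nonneg (l x)), ← hsβ]; ring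
      rw [e1]
      gcongr
      · exact wdn x hx
      · exact linv x hx
      · exact hW x hx)
  refine main.trans ?_
  have hv : ∀ x ∈ Icc c d, |σ * (w x * (l x)⁻¹)| ≤ W * ρ⁻¹ := fun x hx => by
    rw [abs_mul, hσ, one_mul, abs_mul, abs_of_nonneg (wn x hx)]
    exact mul_le_mul (hW x hx) (linv x hx) (abs_nonneg _) hW0
  have hsl : ∀ x ∈ Icc c d, |s * (l x)⁻¹| ≤ ρ⁻¹ := fun x hx => by
    rw [abs_mul]
    calc |s| * |(l x)⁻¹| ≤ 1 * ρ⁻¹ := mul_le_mul hs (linv x hx) (abs_nonneg _) zero_le_one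
      _ = _ := one_mul _
  have h1 := hv c hcm
  have h2 := hv d hdm
  have h3 := hsl c hcm
  have h4 := hsl d hdm
  have h5 : w d * ρ⁻¹ ≤ W * ρ⁻¹ := mul_le_mul_of_nonneg_right (hW d hdm) (by positivity)
  have h6 : 0 ≤ w c * ρ⁻¹ := mul_nonneg (wn c hcm) (by positivity)
  have h7 : W * (s * (l c)⁻¹) ≤ W * ρ⁻¹ := mul_le_mul_of_nonneg_left (le_of_abs_le h3) hW0
  have h8 : W * (-(s * (l d)⁻¹)) ≤ W * ρ⁻¹ := 
    mul_le_mul_of_nonneg_left ((neg_le_abs _).trans h4) hW0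
  rw [show 5 * W / (ρ * Ξ) = (5 * (W * ρ⁻¹)) / Ξ by field_simp]
  gcongr
  linarith

/-- Van der Corput type bound for the difference of two inverse branches. -/
lemma norm_integral_exp_sub_le {Ξ r q r' q' Qm Qp σ : ℝ}
    (hΞ : 0 < Ξ) (hr : 0 ≤ r) (hrq : r ≤ q) (hr' : 0 ≤ r') (hrq' : r' ≤ q') (hQm : 0 < Qm)
    (hq : Qm ≤ q) (hq2 : q ≤ Qp) (hq' : Qm ≤ q') (hq2' : q' ≤ Qp)
    (hσ : |σ| = 1) {f : ℝ → ℝ} (hfm : Measurable f)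
    (hf : ∀ x ∈ Icc (0 : ℝ) 1, HasDerivAt f (σ / (r * x + q) ^ 2 - σ / (r' * x + q') ^ 2) x)
    {δ : ℝ} (hδ : 0 < δ) (hδ' : δ ≤ |q - q'| + |r - r'|) :
    ‖∫ x in (0 : ℝ)..1, Complex.exp ((Ξ * f x : ℝ) * Complex.I)‖ ≤
      32 * √((8 * Qp ^ 4 / Qm) / (δ * Ξ)) := by
  set W := 8 * Qp ^ 4 / Qm with hWdef
  have hQp : 0 < Qp := by linarith
  have hWp : 0 < W := by positivity
  set t := √(W / (δ * Ξ)) with ht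
  have htp : 0 < t := Real.sqrt_pos.2 (by positivity)
  have ht2 : t ^ 2 = W / (δ * Ξ) := Real.sq_sqrt (by positivity)
  have hW : ∀ x ∈ Icc (0 : ℝ) 1,
      ((r * x + q) * (r' * x + q')) ^ 2 / ((r * x + q) + (r' * x + q')) ≤ W := by
    intro x hx
    have a1 := mul_nonneg hr hx.1
    have a2 := mul_nonneg hr' hx.1
    have a3 : r * x ≤ r := mul_le_of_le_one_right hr hx.2
    have a4 : r' * x ≤ r' := mul_le_of_le_one_right hr' hx.2
    have a5 : 0 ≤ (r * x + q) * (r' * x + q') := mul_nonneg (by linarith) (by linarith)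
    calc ((r * x + q) * (r' * x + q')) ^ 2 / ((r * x + q) + (r' * x + q'))
        ≤ ((2 * Qp) * (2 * Qp)) ^ 2 / (Qm + Qm) := by
          gcongr <;> linarith
      _ = W := by rw [hWdef]; field_simp; ring
  set e : ℝ → ℂ := fun x => Complex.exp ((Ξ * f x : ℝ) * Complex.I) with he
  have hen : ∀ x, ‖e x‖ = 1 := fun x => Complex.norm_exp_ofReal_mul_I _
  have hem : Measurable e := by
    have : Measurable fun x => ((Ξ * f x : ℝ) : ℂ) :=
      Complex.measurable_ofReal.comp (hfm.const_mul Ξ)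
    exact (this.mul_const _).cexp
  have hi : ∀ a b : ℝ, IntervalIntegrable e volume a b := by
    intro a b
    refine (intervalIntegrable_const (c := (1 : ℝ))).mono_fun hem.aestronglyMeasurable ?_
    exact Eventually.of_forall fun x => by simp [hen]
  have htriv : ∀ a b : ℝ, ‖∫ x in a..b, e x‖ ≤ |b - a| := by
    intro a b
    have := intervalIntegral.norm_integral_le_of_norm_le_const (a := a) (b := b) (f := e) (C := 1)
      (fun x _ => (hen x).le)
    simpa using this
  have gap : ∀ c d ρ : ℝ, 0 ≤ c → d ≤ 1 → c ≤ d → 0 < ρ → (c < d → ∀ x ∈ Icc c d,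
      ρ ≤ |(r' * x + q') - (r * x + q)|) → ‖∫ x in c..d, e x‖ ≤ 5 * W / (ρ * Ξ) := by
    intro c d ρ hc hd hcd hρ h
    rcases hcd.eq_or_lt with rfl | hlt
    · simp; positivity
    · have hsub : Icc c d ⊆ Icc (0 : ℝ) 1 := Icc_subset_Icc hc hd
      exact norm_integral_exp_le_of_gap hcd hc hΞ hr (by linarith) hr' (by linarith) hρ hσ hfm
        (fun x hx => hf x (hsub hx)) (fun x hx => hW x (hsub hx)) (h hlt)
  rcases le_or_gt 1 t with h1 | h1
  · have := htriv 0 1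
    simp at this
    linarith
  by_cases hβ : |r' - r| < δ / 3
  · have h := gap 0 1 (δ / 3) le_rfl le_rfl zero_le_one (by positivity) (fun _ x hx => by
      have a1 : |(r' - r) * x| ≤ |r' - r| := by
        rw [abs_mul, abs_of_nonneg hx.1]; exact mul_le_of_le_one_right (abs_nonneg _) hx.2
      have a2 : |q - q'| ≤ |(r' * x + q') - (r * x + q)| + |(r' - r) * x| := by
        rw [abs_sub_comm q q']
        have : q' - q = ((r' * x + q') - (r * x + q)) - (r' - r) * x := by ring
        rw [this]; exact abs_sub _ _
      rw [abs_sub_comm r r'] at hδ'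
      linarith)
    refine h.trans ?_
    have : 5 * W / (δ / 3 * Ξ) = 15 * t ^ 2 := by rw [ht2]; field_simp; norm_num
    rw [this]
    nlinarith
  · push Not at hβ
    have hβ0 : r' - r ≠ 0 := by
      intro h; rw [h, abs_zero] at hβ; linarith
    set x0 := -(q' - q) / (r' - r) with hx0
    have hlin : ∀ x, |(r' * x + q') - (r * x + q)| = |r' - r| * |x - x0| := by
      intro x
      rw [← abs_mul, hx0]
      congr 1
      field_simp
      ring
    have hgap : ∀ x, t ≤ |x - x0| → δ / 3 * t ≤ |(r' * x + q') - (r * x + q)| := by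
      intro x hx
      rw [hlin]; gcongr
    set c1 := max 0 (min 1 (x0 - t)) with hc1
    set c2 := max 0 (min 1 (x0 + t)) with hc2
    have b1 : 0 ≤ c1 := le_max_left _ _
    have b2 : c2 ≤ 1 := max_le zero_le_one (min_le_left _ _)
    have b3 : c1 ≤ c2 := by rw [hc1, hc2]; gcongr; linarith
    have b4 : c2 - c1 ≤ 2 * t := by
      rw [hc1, hc2]
      rcases max_cases 0 (min 1 (x0 - t)) with h | h <;>
      rcases max_cases 0 (min 1 (x0 + t)) with h' | h' <;>
      rcases min_cases 1 (x0 - t) with h'' | h'' <;>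
      rcases min_cases 1 (x0 + t) with h''' | h''' <;> linarith
    have i1 := gap 0 c1 (δ / 3 * t) le_rfl (b3.trans b2) b1 (by positivity) (fun hlt x hx => by
      apply hgap
      have : c1 ≤ x0 - t := by
        rcases max_cases 0 (min 1 (x0 - t)) with h | h
        · linarith
        · rw [hc1, h.1]; exact min_le_right _ _
      rw [abs_sub_comm]
      exact le_trans (by linarith [hx.2]) (le_abs_self _))
    have i3 := gap c2 1 (δ / 3 * t) (b1.trans b3) le_rfl b2 (by positivity) (fun hlt x hx => by
      apply hgap
      have : x0 + t ≤ c2 := by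
        rcases min_cases 1 (x0 + t) with h | h
        · have : c2 = 1 := by rw [hc2, h.1]; simp
          linarith
        · rw [hc2, h.1]; exact le_max_right _ _
      exact le_trans (by linarith [hx.1]) (le_abs_self _))
    have i2 := htriv c1 c2
    rw [abs_of_nonneg (by linarith)] at i2
    have e15 : 5 * W / (δ / 3 * t * Ξ) = 15 * t := by
      have : W = t ^ 2 * (δ * Ξ) := by rw [ht2]; field_simp
      rw [this]; field_simp; norm_num
    rw [e15] at i1 i3
    rw [← intervalIntegral.integral_add_adjacent_intervals (hi 0 c1) (hi c1 1),
      ← intervalIntegral.integral_add_adjacent_intervals (hi c1 c2) (hi c2 1)]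
    refine (norm_add_le _ _).trans ?_
    have := norm_add_le (∫ x in c1..c2, e x) (∫ x in c2..1, e x)
    linarith

end Oscillatory

/-! ### Mean square estimates for exponential sums over words -/

section MeanSquare

variable {ι : Type*} {dg : ι → ℕ}

lemma exists_common_suffix {a a' : List ι} (hl : a.length = a'.length) (hne : a ≠ a') :
    ∃ e x e' x' c, a = e ++ x :: c ∧ a' = e' ++ x' :: c ∧ x ≠ x' ∧ e.length = e'.length := by
  induction a generalizing a' with
  | nil => exact absurd (List.eq_nil_of_length_eq_zero hl.symm).symm hne
  | cons x a ih =>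
    cases a' with
    | nil => simp at hl
    | cons x' a' =>
      by_cases h : a = a'
      · subst h
        exact ⟨[], x, [], x', a, rfl, rfl, fun h => hne (by rw [h]), rfl⟩
      · obtain ⟨e, z, e', z', c, h1, h2, h3, h4⟩ := ih (by simpa using hl) h
        exact ⟨x :: e, z, x' :: e', z', c, by simp [h1], by simp [h2], h3, by simp [h4]⟩

lemma measurable_br (w : List ι) : Measurable (br dg w) := by
  unfold br; fun_prop

/-- The constant of the oscillatory estimate. -/
noncomputable def oscConst (K : ℕ) (Qm Qp Ξ : ℝ) : ℝ :=
  32 * √((8 * Qp ^ 4 / Qm) * (8 * (K + 1) ^ 3 / (Qm * Ξ)))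

lemma oscConst_nonneg (K : ℕ) (Qm Qp Ξ : ℝ) : 0 ≤ oscConst K Qm Qp Ξ := by
  unfold oscConst; positivity

variable (hd : ∀ a, 1 ≤ dg a) {K : ℕ} (hK : ∀ a, dg a ≤ K)
include hd hK

lemma norm_integral_pair_le {Ξ Qm Qp : ℝ} (hΞ : 0 < Ξ) (hQm : 0 < Qm) {e e' c : List ι} {x x' : ι}
    (hlen : e.length = e'.length) (hx : dg x ≠ dg x')
    (h1 : Qm ≤ cQ dg (e ++ x :: c)) (h2 : cQ dg (e ++ x :: c) ≤ Qp)
    (h1' : Qm ≤ cQ dg (e' ++ x' :: c)) (h2' : cQ dg (e' ++ x' :: c) ≤ Qp) :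
    ‖∫ t in (0 : ℝ)..1,
      Complex.exp ((Ξ * (br dg (e ++ x :: c) t - br dg (e' ++ x' :: c) t) : ℝ) * Complex.I)‖ ≤
      oscConst K Qm Qp Ξ * cQ dg c := by
  have hc := cQ_pos hd c
  have hQp : 0 < Qp := by linarith
  have hl : (e' ++ x' :: c).length = (e ++ x :: c).length := by simp [hlen]
  have hs := separation hd hK (c := c) hlen hx
  refine (norm_integral_exp_sub_le hΞ (cR_nonneg hd (e ++ x :: c)) (cR_le hd _)
    (cR_nonneg hd (e' ++ x' :: c)) (cR_le hd _) hQm h1 h2 h1' h2'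
    (σ := (-1) ^ (e ++ x :: c).length) (by simp)
    (f := fun t => br dg (e ++ x :: c) t - br dg (e' ++ x' :: c) t)
    ((measurable_br _).sub (measurable_br _)) (fun t ht => ?_)
    (δ := Qm / (8 * (K + 1) ^ 3 * cQ dg c ^ 2)) (by positivity) ?_).trans ?_
  · have := (hasDerivAt_br hd (e ++ x :: c) ht.1).sub (hasDerivAt_br hd (e' ++ x' :: c) ht.1)
    rw [hl] at this
    exact this
  · refine le_trans ?_ hs
    gcongr
  · have : 8 * Qp ^ 4 / Qm / (Qm / (8 * (K + 1) ^ 3 * cQ dg c ^ 2) * Ξ) =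
      ((8 * Qp ^ 4 / Qm) * (8 * (K + 1) ^ 3 / (Qm * Ξ))) * cQ dg c ^ 2 := by field_simp
    rw [this, Real.sqrt_mul (by positivity), Real.sqrt_sq hc.le, oscConst, mul_assoc]

end MeanSquare

section MeanSquareSum

variable {ι : Type*} [Fintype ι] {dg : ι → ℕ}

/-- An exponential sum over inverse branches. -/
noncomputable def expSum (dg : ι → ℕ) (Ξ : ℝ) (G : Finset (List ι)) (p : List ι → ℝ) (t : ℝ) : ℂ :=
  ∑ a ∈ G, (p a : ℂ) * Complex.exp ((Ξ * br dg a t : ℝ) * Complex.I)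

lemma measurable_cexp_mul_I {f : ℝ → ℝ} (hf : Measurable f) :
    Measurable fun t => Complex.exp ((f t : ℝ) * Complex.I) :=
  ((Complex.measurable_ofReal.comp hf).mul_const _).cexp

lemma measurable_expSum (Ξ : ℝ) (G : Finset (List ι)) (p : List ι → ℝ) :
    Measurable (expSum dg Ξ G p) := by
  unfold expSum
  exact Finset.measurable_fun_sum _ fun a _ =>
    (measurable_cexp_mul_I ((measurable_br a).const_mul Ξ)).const_mul _

lemma norm_expSum_le (Ξ : ℝ) (G : Finset (List ι)) (p : List ι → ℝ) (t : ℝ)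
    (hp : ∀ a ∈ G, 0 ≤ p a) : ‖expSum dg Ξ G p t‖ ≤ ∑ a ∈ G, p a := by
  refine (norm_sum_le _ _).trans (Finset.sum_le_sum fun a ha => ?_)
  rw [norm_mul, Complex.norm_exp_ofReal_mul_I, mul_one, Complex.norm_real, Real.norm_eq_abs,
    abs_of_nonneg (hp a ha)]

lemma sq_norm_expSum (Ξ : ℝ) (G : Finset (List ι)) (p : List ι → ℝ) (t : ℝ) :
    ((‖expSum dg Ξ G p t‖ ^ 2 : ℝ) : ℂ) = ∑ a ∈ G, ∑ a' ∈ G, ((p a * p a' : ℝ) : ℂ) *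
      Complex.exp ((Ξ * (br dg a t - br dg a' t) : ℝ) * Complex.I) := by
  rw [Complex.ofReal_pow, ← Complex.mul_conj', expSum, map_sum, Finset.sum_mul_sum]
  refine Finset.sum_congr rfl fun a _ => Finset.sum_congr rfl fun a' _ => ?_
  rw [map_mul, ← Complex.exp_conj, map_mul, Complex.conj_ofReal, Complex.conj_ofReal,
    Complex.conj_I, mul_mul_mul_comm, ← Complex.exp_add]
  push_cast
  congr 2
  ring

lemma integral_sq_norm_expSum_le (Ξ : ℝ) (G : Finset (List ι)) (p : List ι → ℝ)
    (hp : ∀ a, 0 ≤ p a) :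
    ∫ t in (0 : ℝ)..1, ‖expSum dg Ξ G p t‖ ^ 2 ≤ ∑ a ∈ G, ∑ a' ∈ G, p a * p a' *
      ‖∫ t in (0 : ℝ)..1, Complex.exp ((Ξ * (br dg a t - br dg a' t) : ℝ) * Complex.I)‖ := by
  have hi : ∀ a a' : List ι, IntervalIntegrable (fun t =>
      Complex.exp ((Ξ * (br dg a t - br dg a' t) : ℝ) * Complex.I)) volume 0 1 := by
    intro a a'
    refine (intervalIntegrable_const (c := (1 : ℝ))).mono_fun
      (measurable_cexp_mul_I
        (((measurable_br a).sub (measurable_br a')).const_mul Ξ)).aestronglyMeasurable ?_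
    exact Eventually.of_forall fun x => by
      simp only [Complex.norm_exp_ofReal_mul_I, norm_one, le_refl]
  have h0 : 0 ≤ ∫ t in (0 : ℝ)..1, ‖expSum dg Ξ G p t‖ ^ 2 :=
    intervalIntegral.integral_nonneg zero_le_one fun t _ => by positivity
  calc ∫ t in (0 : ℝ)..1, ‖expSum dg Ξ G p t‖ ^ 2
      = ‖((∫ t in (0 : ℝ)..1, ‖expSum dg Ξ G p t‖ ^ 2 : ℝ) : ℂ)‖ := by
        rw [Complex.norm_real, Real.norm_eq_abs, abs_of_nonneg h0]
    _ = ‖∑ a ∈ G, ∑ a' ∈ G, ((p a * p a' : ℝ) : ℂ) * ∫ t in (0 : ℝ)..1,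
          Complex.exp ((Ξ * (br dg a t - br dg a' t) : ℝ) * Complex.I)‖ := by
        rw [← intervalIntegral.integral_ofReal]
        simp_rw [sq_norm_expSum]
        rw [intervalIntegral.integral_finsetSum]
        · congr 1
          refine Finset.sum_congr rfl fun a _ => ?_
          rw [intervalIntegral.integral_finsetSum]
          · refine Finset.sum_congr rfl fun a' _ => ?_
            rw [intervalIntegral.integral_const_mul]
          · exact fun a' _ => (hi a a').const_mul _
        · intro a _
          have := IntervalIntegrable.sum G fun a' _ => (hi a a').const_mul ((p a * p a' : ℝ) : ℂ)
          rwa [Finset.sum_fn] at this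
    _ ≤ _ := by
        refine (norm_sum_le _ _).trans (Finset.sum_le_sum fun a _ => ?_)
        refine (norm_sum_le _ _).trans (Finset.sum_le_sum fun a' _ => ?_)
        rw [norm_mul, Complex.norm_real, Real.norm_eq_abs,
          abs_of_nonneg (mul_nonneg (hp a) (hp a'))]

variable [TopologicalSpace ι] [DiscreteTopology ι] [MeasurableSpace ι] [BorelSpace ι]

lemma sum_words_drop {φ : (ℕ → ι) → ℝ} (hN : Normalized φ) {n j : ℕ} (hj : j ≤ n) (y : ℕ → ι)
    {c : List ι} (hc : c.length = n - j) :
    ∑ a ∈ words ι n, (if a.drop j = c then Real.exp (bs φ a y) else 0) = Real.exp (bs φ c y) := by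
  obtain ⟨k, rfl⟩ := Nat.exists_eq_add_of_le hj
  have hc' : c.length = k := by omega
  rw [sum_words_add]
  calc ∑ u ∈ words ι j, ∑ v ∈ words ι k,
        (if (u ++ v).drop j = c then Real.exp (bs φ (u ++ v) y) else 0)
      = ∑ u ∈ words ι j, Real.exp (bs φ u (app c y)) * Real.exp (bs φ c y) := by
        refine Finset.sum_congr rfl fun u hu => ?_
        have hu' : u.length = j := mem_words.1 hu
        have : ∀ v, (u ++ v).drop j = v := fun v => by rw [← hu', List.drop_left]
        simp_rw [this]
        rw [Finset.sum_ite_eq' (words ι k) c, if_pos (mem_words.2 hc'), bs_append, Real.exp_add]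
    _ = Real.exp (bs φ c y) := by rw [← Finset.sum_mul, hN.sum_words, one_mul]

variable (hd : ∀ a, 1 ≤ dg a) {K : ℕ} (hK : ∀ a, dg a ≤ K)
include hd hK

/-- The mean square of the exponential sum of a normalized potential over `[0, 1]`. -/
lemma integral_sq_norm_expSum_words_le (hinj : Function.Injective dg) {φ : (ℕ → ι) → ℝ}
    (hN : Normalized φ) {Ξ Qm Qp M R : ℝ} (hΞ : 0 < Ξ) (hQm : 0 < Qm) {n : ℕ} (y : ℕ → ι)
    {G : Finset (List ι)} (hG : G ⊆ words ι n)
    (hQ1 : ∀ a ∈ G, Qm ≤ cQ dg a) (hQ2 : ∀ a ∈ G, cQ dg a ≤ Qp)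
    (hM : ∀ a ∈ G, Real.exp (bs φ a y) ≤ M)
    (hR : ∀ a ∈ G, ∀ j < n, Real.exp (bs φ (a.drop (j + 1)) y) * cQ dg (a.drop (j + 1)) ≤ R)
    (hM0 : 0 ≤ M) (hR0 : 0 ≤ R) :
    ∫ t in (0 : ℝ)..1, ‖expSum dg Ξ G (fun a => Real.exp (bs φ a y)) t‖ ^ 2 ≤
      M + n * R * oscConst K Qm Qp Ξ := by
  set D := oscConst K Qm Qp Ξ with hD
  have hD0 : 0 ≤ D := oscConst_nonneg _ _ _ _
  set p : List ι → ℝ := fun a => Real.exp (bs φ a y) with hp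
  have hp0 : ∀ a, 0 ≤ p a := fun a => (Real.exp_pos _).le
  set I : List ι → List ι → ℝ := fun a a' =>
    ‖∫ t in (0 : ℝ)..1, Complex.exp ((Ξ * (br dg a t - br dg a' t) : ℝ) * Complex.I)‖ with hI
  refine (integral_sq_norm_expSum_le Ξ G p hp0).trans ?_
  have hsum : ∑ a ∈ G, p a ≤ 1 := by
    rw [← hN.sum_words n y]
    exact Finset.sum_le_sum_of_subset_of_nonneg hG fun a _ _ => hp0 a
  have hrow : ∀ a ∈ G, ∑ a' ∈ G, p a * p a' * I a a' ≤ p a * (M + n * R * D) := by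
    intro a ha
    have hIle : ∀ a' ∈ G, p a' * I a a' ≤ (if a' = a then M else 0) +
        ∑ j ∈ Finset.range n, D * cQ dg (a.drop (j + 1)) *
          (if a'.drop (j + 1) = a.drop (j + 1) then p a' else 0) := by
      intro a' ha'
      have hnn : ∀ j ∈ Finset.range n, 0 ≤ D * cQ dg (a.drop (j + 1)) *
          (if a'.drop (j + 1) = a.drop (j + 1) then p a' else 0) := fun j _ => by
        have := cQ_pos hd (a.drop (j + 1))
        have := hp0 a'
        split_ifs <;> positivity
      by_cases h : a' = a
      · rw [if_pos h, h]
        have h1 : I a a ≤ 1 := by simp [hI]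
        have h2 : p a * I a a ≤ M := by
          have := hM a ha
          have := mul_le_of_le_one_right (hp0 a) h1
          linarith
        have := Finset.sum_nonneg hnn
        rw [h] at this
        linarith
      · rw [if_neg h, zero_add]
        have la := mem_words.1 (hG ha)
        have la' := mem_words.1 (hG ha')
        obtain ⟨e, x, e', x', c, e1, e2, hx, hl⟩ :=
          exists_common_suffix (la.trans la'.symm) (Ne.symm h)
        have hdrop : a.drop (e.length + 1) = c := by
          rw [e1, List.append_cons]
          exact List.drop_left' (by simp)
        have hdrop' : a'.drop (e.length + 1) = c := by
          rw [e2, List.append_cons, hl]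
          exact List.drop_left' (by simp)
        have hen : e.length < n := by rw [← la, e1]; simp
        refine le_trans ?_ (Finset.single_le_sum hnn (Finset.mem_range.2 hen))
        rw [hdrop, hdrop', if_pos rfl, mul_comm]
        refine mul_le_mul_of_nonneg_right ?_ (hp0 a')
        have a1 := hQ1 a ha
        have a2 := hQ2 a ha
        have a3 := hQ1 a' ha'
        have a4 := hQ2 a' ha'
        rw [e1] at a1 a2
        rw [e2] at a3 a4
        simp only [hI]
        rw [e1, e2]
        exact norm_integral_pair_le hd hK hΞ hQm hl (fun h => hx (hinj h)) a1 a2 a3 a4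
    calc ∑ a' ∈ G, p a * p a' * I a a' = p a * ∑ a' ∈ G, p a' * I a a' := by
          rw [Finset.mul_sum]; exact Finset.sum_congr rfl fun _ _ => by ring
      _ ≤ p a * (M + n * R * D) := by
          refine mul_le_mul_of_nonneg_left ?_ (hp0 a)
          refine (Finset.sum_le_sum hIle).trans ?_
          rw [Finset.sum_add_distrib, Finset.sum_ite_eq' G a, if_pos ha, Finset.sum_comm]
          gcongr
          calc ∑ j ∈ Finset.range n, ∑ a' ∈ G, D * cQ dg (a.drop (j + 1)) *
                (if a'.drop (j + 1) = a.drop (j + 1) then p a' else 0)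
              ≤ ∑ j ∈ Finset.range n, R * D := by
                refine Finset.sum_le_sum fun j hj => ?_
                have hj' := Finset.mem_range.1 hj
                have hq := cQ_pos hd (a.drop (j + 1))
                rw [← Finset.mul_sum]
                have h1 : ∑ a' ∈ G, (if a'.drop (j + 1) = a.drop (j + 1) then p a' else 0) ≤
                    p (a.drop (j + 1)) := by
                  refine le_trans ?_ (sum_words_drop hN (n := n) (j := j + 1) hj' y
                    (c := a.drop (j + 1)) (by rw [List.length_drop, mem_words.1 (hG ha)])).le
                  refine Finset.sum_le_sum_of_subset_of_nonneg hG fun a' _ _ => ?_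
                  split_ifs
                  · exact hp0 _
                  · exact le_rfl
                have h2 := hR a ha j hj'
                calc D * cQ dg (a.drop (j + 1)) * _
                    ≤ D * cQ dg (a.drop (j + 1)) * p (a.drop (j + 1)) := by gcongr
                  _ = (p (a.drop (j + 1)) * cQ dg (a.drop (j + 1))) * D := by ring
                  _ ≤ R * D := by gcongr
            _ = n * R * D := by simp [mul_assoc]
  calc ∑ a ∈ G, ∑ a' ∈ G, p a * p a' * I a a' ≤ ∑ a ∈ G, p a * (M + n * R * D) :=
        Finset.sum_le_sum hrow
    _ = (∑ a ∈ G, p a) * (M + n * R * D) := by rw [Finset.sum_mul]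
    _ ≤ 1 * (M + n * R * D) := by gcongr
    _ = _ := one_mul _

end MeanSquareSum

/-! ### Comparison of the Gibbs measure with Lebesgue measure -/

section Comparison

variable {ι : Type*} {dg : ι → ℕ} (hd : ∀ a, 1 ≤ dg a)

/-- The open interval spanned by the inverse branch of a word. -/
def brInterval (dg : ι → ℕ) (b : List ι) : Set ℝ := uIoo (br dg b 0) (br dg b 1)

lemma measurableSet_brInterval (b : List ι) : MeasurableSet (brInterval dg b) := by
  unfold brInterval uIoo; exact measurableSet_Ioo

include hd

lemma exists_of_mem_brInterval {b : List ι} {x : ℝ} (hx : x ∈ brInterval dg b) :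
    ∃ t ∈ Ioo (0 : ℝ) 1, br dg b t = x := by
  have hc : ContinuousOn (br dg b) (uIcc (0 : ℝ) 1) := by
    rw [uIcc_of_le zero_le_one]
    exact fun t ht => (hasDerivAt_br hd b ht.1).continuousAt.continuousWithinAt
  obtain ⟨t, ht, rfl⟩ := intermediate_value_uIcc hc (uIoo_subset_uIcc_self hx)
  rw [uIcc_of_le zero_le_one] at ht
  refine ⟨t, ⟨lt_of_le_of_ne ht.1 ?_, lt_of_le_of_ne ht.2 ?_⟩, rfl⟩
  · rintro rfl
    simp [brInterval, uIoo] at hx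
    exact lt_asymm hx.1 hx.2
  · rintro rfl
    simp [brInterval, uIoo] at hx
    exact lt_asymm hx.1 hx.2

lemma br_mem_Ioo (b : List ι) {t : ℝ} (ht : t ∈ Ioo (0 : ℝ) 1) : br dg b t ∈ Ioo (0 : ℝ) 1 := by
  induction b with
  | nil => simpa using ht
  | cons a b ih =>
    rw [br_cons hd _ _ ht.1.le]
    have := one_le_dg hd a
    exact ⟨inv_pos.2 (by linarith [ih.1]), inv_lt_one_of_one_lt₀ (by linarith [ih.1])⟩

lemma br_injective (hinj : Function.Injective dg) {b b' : List ι} (hl : b.length = b'.length)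
    {t t' : ℝ} (ht : t ∈ Ioo (0 : ℝ) 1) (ht' : t' ∈ Ioo (0 : ℝ) 1)
    (h : br dg b t = br dg b' t') : b = b' := by
  induction b generalizing b' with
  | nil => exact (List.eq_nil_of_length_eq_zero hl.symm).symm
  | cons a b ih =>
    cases b' with
    | nil => simp at hl
    | cons a' b' =>
      rw [br_cons hd _ _ ht.1.le, br_cons hd _ _ ht'.1.le, inv_inj] at h
      have s := br_mem_Ioo hd b ht
      have s' := br_mem_Ioo hd b' ht'
      have e1 : dg a < dg a' + 1 := by
        have : (dg a : ℝ) < dg a' + 1 := by linarith [s.1, s'.2]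
        exact_mod_cast this
      have e2 : dg a' < dg a + 1 := by
        have : (dg a' : ℝ) < dg a + 1 := by linarith [s'.1, s.2]
        exact_mod_cast this
      have e : dg a = dg a' := by omega
      rw [e] at h
      rw [hinj e, ih (by simpa using hl) (by linarith)]

lemma volume_brInterval (b : List ι) :
    volume.real (brInterval dg b) = 1 / (cQ dg b * (cR dg b + cQ dg b)) := by
  rw [brInterval, Measure.real, Real.volume_uIoo, ENNReal.toReal_ofReal (abs_nonneg _),
    abs_br_sub hd b zero_le_one le_rfl]
  simp [mul_comm]

variable [Fintype ι] [TopologicalSpace ι] [DiscreteTopology ι] [MeasurableSpace ι] [BorelSpace ι]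
  {K : ℕ} (hK : ∀ a, dg a ≤ K)
include hK

lemma continuous_code : Continuous (code dg) :=
  (hol_code hd hK).continuous (ratio_pos K).le (ratio_lt_one K)

lemma integral_comp_code_le (hinj : Function.Injective dg) {m : Measure (ℕ → ι)}
    [IsProbabilityMeasure m] {H : ℝ → ℝ} (hHm : Measurable H)
    (hH0 : ∀ x, 0 ≤ H x) (hH1 : ∀ x, H x ≤ 1) {Λ : ℝ} (hΛ : 0 ≤ Λ)
    (hLip : ∀ x ∈ Icc (0 : ℝ) 1, ∀ y ∈ Icc (0 : ℝ) 1, |H x - H y| ≤ Λ * |x - y|)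
    {n : ℕ} {G : Finset (List ι)} (hG : G ⊆ words ι n) {Qm Qp M : ℝ} (hQm : 0 < Qm)
    (hM0 : 0 ≤ M) (hQ1 : ∀ a ∈ G, Qm ≤ cQ dg a) (hQ2 : ∀ a ∈ G, cQ dg a ≤ Qp)
    (hM : ∀ b ∈ G, m.real (cyl b) ≤ M) :
    ∫ y, H (code dg y) ∂m ≤ ∑ b ∈ words ι n \ G, m.real (cyl b) + Λ / Qm ^ 2 +
      2 * Qp ^ 2 * M * ∫ t in (0 : ℝ)..1, H t := by
  have hHint : ∀ s : Set ℝ, volume s ≠ ⊤ → IntegrableOn H s := by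
    intro s hs
    refine Measure.integrableOn_of_bounded (M := 1) hs hHm.aestronglyMeasurable ?_
    exact Eventually.of_forall fun x => by
      rw [Real.norm_eq_abs, abs_of_nonneg (hH0 x)]; exact hH1 x
  have hJfin : ∀ b : List ι, volume (brInterval dg b) ≠ ⊤ := by
    intro b; rw [brInterval, Real.volume_uIoo]; exact ENNReal.ofReal_ne_top
  set S : List ι → ℝ := fun b =>
    if b ∈ G then 2 * Qp ^ 2 * (∫ x in brInterval dg b, H x) + Λ / Qm ^ 2 else 1 with hS
  have hpt : ∀ y, H (code dg y) ≤ S (pre n y) := by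
    intro y
    simp only [hS]
    split_ifs with hb
    swap
    · exact hH1 _
    set b := pre n y
    set z := shift^[n] y
    have hz : code dg y = br dg b (code dg z) := by
      rw [← code_app hd hK, app_pre]
    have hz0 := code_pos hd hK z
    have hz1 := code_lt_one hd hK z
    have hq := cQ_pos hd b
    have hle : ∀ x ∈ brInterval dg b, H (code dg y) - Λ / Qm ^ 2 ≤ H x := by
      intro x hx
      obtain ⟨t, ht, rfl⟩ := exists_of_mem_brInterval hd hx
      have m1 := br_mem_Ioo hd b ht
      have m2 := br_mem_Ioo hd b (t := code dg z) ⟨hz0, hz1⟩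
      have h1 := hLip _ (Ioo_subset_Icc_self m2) _ (Ioo_subset_Icc_self m1)
      have h2 : |br dg b (code dg z) - br dg b t| ≤ 1 / Qm ^ 2 := by
        refine (abs_br_sub_le hd b hz0.le ht.1.le).trans ?_
        have : |code dg z - t| ≤ 1 := by
          rw [abs_le]; constructor <;> linarith [ht.1, ht.2]
        have := hQ1 b hb
        gcongr
      have h3 : Λ * |br dg b (code dg z) - br dg b t| ≤ Λ / Qm ^ 2 := by
        rw [div_eq_mul_one_div]; gcongr
      rw [hz]
      linarith [le_of_abs_le h1]
    have hintg : (H (code dg y) - Λ / Qm ^ 2) * volume.real (brInterval dg b) ≤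
        ∫ x in brInterval dg b, H x := by
      have := setIntegral_mono_on (f := fun _ => H (code dg y) - Λ / Qm ^ 2)
        (integrableOn_const (hJfin b)) (hHint _ (hJfin b)) (measurableSet_brInterval b) hle
      simpa [mul_comm] using this
    have hvol : 1 ≤ 2 * Qp ^ 2 * volume.real (brInterval dg b) := by
      rw [volume_brInterval hd, mul_one_div, le_div_iff₀ (by
        have := cR_nonneg hd b; positivity), one_mul]
      have h1 := cR_le hd b
      have h2 := hQ2 b hb
      calc cQ dg b * (cR dg b + cQ dg b) ≤ Qp * (Qp + Qp) := by
            have := cR_nonneg hd b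
            gcongr <;> linarith
        _ = _ := by ring
    rcases le_total (H (code dg y) - Λ / Qm ^ 2) 0 with h | h
    · have : 0 ≤ ∫ x in brInterval dg b, H x := integral_nonneg hH0
      have : 0 ≤ 2 * Qp ^ 2 * ∫ x in brInterval dg b, H x := by positivity
      linarith
    · have h1 := mul_le_mul_of_nonneg_left hvol h
      have h2 := mul_le_mul_of_nonneg_left hintg (by positivity : 0 ≤ 2 * Qp ^ 2)
      linarith
  have hsumint : ∫ y, S (pre n y) ∂m = ∑ b ∈ words ι n, m.real (cyl b) * S b := by
    simp_rw [← sum_words_indicator n _ S]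
    rw [integral_finsetSum]
    · refine Finset.sum_congr rfl fun b _ => ?_
      rw [integral_indicator (measurableSet_cyl b)]
      simp
    · exact fun b _ => (integrable_const _).indicator (measurableSet_cyl b)
  have hSint : Integrable (fun y => S (pre n y)) m := by
    simp_rw [← sum_words_indicator n _ S]
    exact integrable_finsetSum _ fun b _ => (integrable_const _).indicator (measurableSet_cyl b)
  have h1 : ∫ y, H (code dg y) ∂m ≤ ∫ y, S (pre n y) ∂m := by
    refine integral_mono_of_nonneg (Eventually.of_forall fun y => hH0 _) hSint
      (Eventually.of_forall hpt)
  refine h1.trans ?_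
  rw [hsumint, ← Finset.sum_sdiff hG, add_assoc]
  have hb1 : ∑ b ∈ words ι n \ G, m.real (cyl b) * S b = ∑ b ∈ words ι n \ G, m.real (cyl b) := by
    refine Finset.sum_congr rfl fun b hb => ?_
    simp only [hS]
    rw [if_neg (Finset.mem_sdiff.1 hb).2, mul_one]
  have hcyl : ∑ b ∈ G, m.real (cyl b) ≤ 1 := by
    rw [← sum_real_cyl m n]
    exact Finset.sum_le_sum_of_subset_of_nonneg hG fun _ _ _ => measureReal_nonneg
  have hJ : ∑ b ∈ G, ∫ x in brInterval dg b, H x ≤ ∫ t in (0 : ℝ)..1, H t := by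
    rw [← integral_biUnion_finset G (fun b _ => measurableSet_brInterval b)
      (fun b hb b' hb' hne => ?_) (fun b _ => hHint _ (hJfin b)),
      intervalIntegral.integral_of_le zero_le_one]
    · refine setIntegral_mono_set (hHint _ (by simp)) (Eventually.of_forall hH0) ?_
      refine LE.le.eventuallyLE (iUnion₂_subset fun b _ x hx => ?_)
      obtain ⟨t, ht, rfl⟩ := exists_of_mem_brInterval hd hx
      exact Ioo_subset_Ioc_self (br_mem_Ioo hd b ht)
    · rw [Function.onFun, Set.disjoint_left]
      intro x hx hx'
      obtain ⟨t, ht, rfl⟩ := exists_of_mem_brInterval hd hx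
      obtain ⟨t', ht', h⟩ := exists_of_mem_brInterval hd hx'
      refine hne (br_injective hd hinj ?_ ht ht' h.symm)
      rw [mem_words.1 (hG hb), mem_words.1 (hG hb')]
  have hJ0 : ∀ b, 0 ≤ ∫ x in brInterval dg b, H x := fun b => integral_nonneg hH0
  rw [hb1]
  gcongr
  calc ∑ b ∈ G, m.real (cyl b) * S b
      = ∑ b ∈ G, (m.real (cyl b) * (2 * Qp ^ 2 * ∫ x in brInterval dg b, H x) +
          m.real (cyl b) * (Λ / Qm ^ 2)) := by
        refine Finset.sum_congr rfl fun b hb => ?_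
        simp only [hS]
        rw [if_pos hb, mul_add]
    _ ≤ ∑ b ∈ G, (M * (2 * Qp ^ 2 * ∫ x in brInterval dg b, H x) +
          m.real (cyl b) * (Λ / Qm ^ 2)) := by
        refine Finset.sum_le_sum fun b hb => ?_
        have := hJ0 b
        have := hM b hb
        gcongr
    _ = M * (2 * Qp ^ 2 * ∑ b ∈ G, ∫ x in brInterval dg b, H x) +
          (∑ b ∈ G, m.real (cyl b)) * (Λ / Qm ^ 2) := by
        rw [Finset.sum_add_distrib, ← Finset.mul_sum, ← Finset.mul_sum, Finset.sum_mul]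
    _ ≤ M * (2 * Qp ^ 2 * ∫ t in (0 : ℝ)..1, H t) + 1 * (Λ / Qm ^ 2) := by gcongr
    _ = _ := by ring

end Comparison

/-! ### Decomposition of the Fourier transform -/

section Decomposition

lemma abs_exp_sub_exp_le (s t : ℝ) :
    |Real.exp s - Real.exp t| ≤ |s - t| * (Real.exp s + Real.exp t) := by
  have key : ∀ u v : ℝ, Real.exp u - Real.exp v ≤ |u - v| * (Real.exp u + Real.exp v) := by
    intro u v
    have h1 : Real.exp v = Real.exp u * Real.exp (v - u) := by rw [← Real.exp_add]; ring_nf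
    have h2 := Real.add_one_le_exp (v - u)
    have h3 := mul_le_mul_of_nonneg_left h2 (Real.exp_pos u).le
    have h4 : (u - v) * Real.exp u ≤ |u - v| * Real.exp u :=
      mul_le_mul_of_nonneg_right (le_abs_self _) (Real.exp_pos u).le
    have h5 : 0 ≤ |u - v| * Real.exp v := by positivity
    nlinarith
  rw [abs_sub_le_iff]
  refine ⟨key s t, ?_⟩
  have := key t s
  rwa [abs_sub_comm t s, add_comm (Real.exp t)] at this

lemma integral_le_sqrt_integral_sq {Ω : Type*} [MeasurableSpace Ω] {m : Measure Ω}
    [IsProbabilityMeasure m] {f : Ω → ℝ} (hf : Measurable f) {B : ℝ} (hB : ∀ x, |f x| ≤ B) :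
    ∫ x, f x ∂m ≤ √(∫ x, f x ^ 2 ∂m) := by
  have hi : Integrable f m := .of_bound hf.aestronglyMeasurable B (Eventually.of_forall hB)
  have hi2 : Integrable (fun x => f x ^ 2) m := by
    refine .of_bound (hf.pow_const 2).aestronglyMeasurable (B ^ 2) (Eventually.of_forall fun x => ?_)
    rw [Real.norm_eq_abs, abs_pow]
    have := hB x
    gcongr
  set I := ∫ x, f x ∂m with hI
  have h : 0 ≤ ∫ x, (f x - I) ^ 2 ∂m := integral_nonneg fun x => sq_nonneg _
  have e : ∫ x, (f x - I) ^ 2 ∂m = ∫ x, f x ^ 2 ∂m - I ^ 2 := by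
    have : ∀ x, (f x - I) ^ 2 = (f x ^ 2 - 2 * I * f x) + I ^ 2 := fun x => by ring
    simp_rw [this]
    have hi3 : Integrable (fun x => f x ^ 2 - 2 * I * f x) m := hi2.sub (hi.const_mul _)
    rw [integral_add hi3 (integrable_const _),
      integral_sub hi2 (hi.const_mul _), integral_const_mul, ← hI]
    simp
    ring
  exact Real.le_sqrt_of_sq_le (by linarith)

variable {ι : Type*} {dg : ι → ℕ} (hd : ∀ a, 1 ≤ dg a)
include hd

lemma norm_expSum_sub_le {Ξ : ℝ} (hΞ : 0 ≤ Ξ) {Qm : ℝ} (hQm : 0 < Qm) {G : Finset (List ι)}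
    {p : List ι → ℝ} (hp : ∀ a ∈ G, 0 ≤ p a) (hp1 : ∑ a ∈ G, p a ≤ 1)
    (hQ1 : ∀ a ∈ G, Qm ≤ cQ dg a) {x y : ℝ} (hx : 0 ≤ x) (hy : 0 ≤ y) :
    ‖expSum dg Ξ G p x - expSum dg Ξ G p y‖ ≤ Ξ / Qm ^ 2 * |x - y| := by
  unfold expSum
  rw [← Finset.sum_sub_distrib]
  calc _ ≤ ∑ a ∈ G, p a * (Ξ / Qm ^ 2 * |x - y|) := by
        refine (norm_sum_le _ _).trans (Finset.sum_le_sum fun a ha => ?_)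
        rw [← mul_sub, norm_mul, Complex.norm_real, Real.norm_eq_abs, abs_of_nonneg (hp a ha)]
        refine mul_le_mul_of_nonneg_left ?_ (hp a ha)
        have e : Complex.exp ((Ξ * br dg a x : ℝ) * Complex.I) -
            Complex.exp ((Ξ * br dg a y : ℝ) * Complex.I) =
            Complex.exp ((Ξ * br dg a y : ℝ) * Complex.I) *
              (Complex.exp (Complex.I * (Ξ * (br dg a x - br dg a y) : ℝ)) - 1) := by
          rw [mul_sub, mul_one, ← Complex.exp_add]
          congr 2
          push_cast; ring
        rw [e, norm_mul, Complex.norm_exp_ofReal_mul_I, one_mul]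
        refine (Real.norm_exp_I_mul_ofReal_sub_one_le).trans ?_
        rw [Real.norm_eq_abs, abs_mul, abs_of_nonneg hΞ]
        have h1 := abs_br_sub_le hd a hx hy
        have h2 := hQ1 a ha
        calc Ξ * |br dg a x - br dg a y| ≤ Ξ * (|x - y| / cQ dg a ^ 2) := by gcongr
          _ ≤ Ξ * (|x - y| / Qm ^ 2) := by gcongr
          _ = _ := by ring
    _ = (∑ a ∈ G, p a) * (Ξ / Qm ^ 2 * |x - y|) := by rw [Finset.sum_mul]
    _ ≤ 1 * (Ξ / Qm ^ 2 * |x - y|) := by gcongr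
    _ = _ := one_mul _

variable [Fintype ι]

lemma abs_sq_norm_expSum_sub_le {Ξ : ℝ} (hΞ : 0 ≤ Ξ) {Qm : ℝ} (hQm : 0 < Qm)
    {G : Finset (List ι)} {p : List ι → ℝ} (hp : ∀ a ∈ G, 0 ≤ p a) (hp1 : ∑ a ∈ G, p a ≤ 1)
    (hQ1 : ∀ a ∈ G, Qm ≤ cQ dg a) {x y : ℝ} (hx : 0 ≤ x) (hy : 0 ≤ y) :
    |‖expSum dg Ξ G p x‖ ^ 2 - ‖expSum dg Ξ G p y‖ ^ 2| ≤ 2 * Ξ / Qm ^ 2 * |x - y| := by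
  have h := norm_expSum_sub_le hd hΞ hQm hp hp1 hQ1 hx hy
  have h1 := (abs_norm_sub_norm_le _ _).trans h
  have hb : ∀ t, ‖expSum dg Ξ G p t‖ ≤ 1 := fun t => (norm_expSum_le Ξ G p t hp).trans hp1
  rw [sq_sub_sq, abs_mul, abs_of_nonneg (by positivity)]
  calc _ ≤ (1 + 1) * (Ξ / Qm ^ 2 * |x - y|) := by
        have := hb x
        have := hb y
        gcongr
    _ = _ := by ring

variable [TopologicalSpace ι] [DiscreteTopology ι] [MeasurableSpace ι] [BorelSpace ι]
  {K : ℕ} (hK : ∀ a, dg a ≤ K)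
include hK

lemma norm_integral_le_sum_expSum {φ : (ℕ → ι) → ℝ} {m : Measure (ℕ → ι)} [IsProbabilityMeasure m]
    {C Cφ θ : ℝ} (hC : 1 ≤ C) (hCφ : 0 ≤ Cφ) (h0 : 0 < θ) (h1 : θ < 1) (hφ : Hol Cφ θ φ)
    (hN : Normalized φ) (hG : GibbsW C φ m) (hinv : MeasurePreserving shift m m)
    {Ξ : ℝ} {n : ℕ} (L : ℕ) {G : Finset (List ι)} (hGn : G ⊆ words ι n) (o : ℕ → ι) :
    ‖∫ y, Complex.exp ((Ξ * code dg y : ℝ) * Complex.I) ∂m‖ ≤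
      2 * (Cφ / (1 - θ)) * θ ^ L + C * ∑ a ∈ words ι n \ G, m.real (cyl a) +
      ∑ d ∈ words ι L, ∫ y, ‖expSum dg Ξ G (fun a => Real.exp (bs φ a (app d o)))
        (code dg y)‖ ∂m := by
  have hφc : Continuous φ := hφ.continuous h0.le h1
  have hcode := continuous_code hd hK
  have hcont : Continuous fun y => Complex.exp ((Ξ * code dg y : ℝ) * Complex.I) :=
    Complex.continuous_exp.comp ((Complex.continuous_ofReal.comp
      (continuous_const.mul hcode)).mul continuous_const)
  have hdual := dualOp_eq_self hC hφc hG hN hinv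
  rw [integral_eq_sum_words hφc hdual n hcont]
  have hmeas : ∀ d, Measurable fun y => ‖expSum dg Ξ G (fun a => Real.exp (bs φ a (app d o)))
        (code dg y)‖ := fun d =>
    ((measurable_expSum Ξ G _).comp hcode.measurable).norm
  have hs1 : ∀ z, ∑ a ∈ G, Real.exp (bs φ a z) ≤ 1 := fun z => by
    rw [← hN.sum_words n z]
    exact Finset.sum_le_sum_of_subset_of_nonneg hGn fun _ _ _ => (Real.exp_pos _).le
  have hintg : ∀ d, Integrable (fun y => ‖expSum dg Ξ G (fun a => Real.exp (bs φ a (app d o)))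
        (code dg y)‖) m := fun d => by
    refine .of_bound (hmeas d).aestronglyMeasurable 1 (Eventually.of_forall fun y => ?_)
    rw [norm_norm]
    exact (norm_expSum_le Ξ G _ _ fun a _ => (Real.exp_pos _).le).trans (hs1 _)
  have hpt : ∀ z, ‖∑ l ∈ words ι n, Real.exp (bs φ l z) •
      Complex.exp ((Ξ * code dg (app l z) : ℝ) * Complex.I)‖ ≤
      (2 * (Cφ / (1 - θ)) * θ ^ L + C * ∑ a ∈ words ι n \ G, m.real (cyl a)) +
      ∑ d ∈ words ι L, ‖expSum dg Ξ G (fun a => Real.exp (bs φ a (app d o))) (code dg z)‖ := by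
    intro z
    set d := pre L z
    set p : List ι → ℝ := fun a => Real.exp (bs φ a (app d o)) with hp
    have hagree : ∀ i < L, z i = app d o i := by
      intro i hi
      refine eq_of_mem_cyl (l := d) (mem_cyl_pre _ _) (app_mem_cyl _ _) i (by simpa [d] using hi)
    rw [← Finset.sum_sdiff hGn]
    have hbad : ‖∑ l ∈ words ι n \ G, Real.exp (bs φ l z) •
        Complex.exp ((Ξ * code dg (app l z) : ℝ) * Complex.I)‖ ≤
        C * ∑ a ∈ words ι n \ G, m.real (cyl a) := by
      rw [Finset.mul_sum]
      refine (norm_sum_le _ _).trans (Finset.sum_le_sum fun a _ => ?_)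
      rw [norm_smul, Complex.norm_exp_ofReal_mul_I, mul_one, Real.norm_eq_abs, Real.abs_exp]
      have := (hG a z).1
      have hC0 : 0 < C := by linarith
      rwa [inv_mul_le_iff₀ hC0] at this
    have hgood : ‖∑ l ∈ G, Real.exp (bs φ l z) •
        Complex.exp ((Ξ * code dg (app l z) : ℝ) * Complex.I)‖ ≤
        2 * (Cφ / (1 - θ)) * θ ^ L + ‖expSum dg Ξ G p (code dg z)‖ := by
      have e : ∑ l ∈ G, Real.exp (bs φ l z) •
          Complex.exp ((Ξ * code dg (app l z) : ℝ) * Complex.I) =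
          ∑ l ∈ G, ((Real.exp (bs φ l z) - p l : ℝ) : ℂ) *
            Complex.exp ((Ξ * br dg l (code dg z) : ℝ) * Complex.I) +
            expSum dg Ξ G p (code dg z) := by
        rw [expSum, ← Finset.sum_add_distrib]
        refine Finset.sum_congr rfl fun l _ => ?_
        rw [code_app hd hK, Complex.real_smul]
        push_cast; ring
      rw [e]
      refine (norm_add_le _ _).trans (add_le_add_left ?_ _)
      calc _ ≤ ∑ l ∈ G, (Cφ / (1 - θ) * θ ^ L) * (Real.exp (bs φ l z) + p l) := by
            refine (norm_sum_le _ _).trans (Finset.sum_le_sum fun a _ => ?_)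
            rw [norm_mul, Complex.norm_exp_ofReal_mul_I, mul_one, Complex.norm_real,
              Real.norm_eq_abs]
            refine (abs_exp_sub_exp_le _ _).trans ?_
            refine mul_le_mul_of_nonneg_right (hφ.bs_le hCφ h0 h1 a hagree) (by positivity)
        _ = (Cφ / (1 - θ) * θ ^ L) * (∑ l ∈ G, Real.exp (bs φ l z) + ∑ l ∈ G, p l) := by
            rw [← Finset.mul_sum, Finset.sum_add_distrib]
        _ ≤ (Cφ / (1 - θ) * θ ^ L) * (1 + 1) := by
            have := hs1 z
            have := hs1 (app d o)
            have : 0 ≤ Cφ / (1 - θ) := div_nonneg hCφ (by linarith)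
            gcongr
        _ = _ := by ring
    have hle : ‖expSum dg Ξ G p (code dg z)‖ ≤
        ∑ d ∈ words ι L, ‖expSum dg Ξ G (fun a => Real.exp (bs φ a (app d o))) (code dg z)‖ :=
      Finset.single_le_sum
        (f := fun d => ‖expSum dg Ξ G (fun a => Real.exp (bs φ a (app d o))) (code dg z)‖)
        (fun d _ => norm_nonneg _) (pre_mem_words L z)
    refine (norm_add_le _ _).trans ?_
    linarith
  refine (norm_integral_le_integral_norm _).trans ?_
  refine (integral_mono_of_nonneg (Eventually.of_forall fun z => norm_nonneg _)
    ((integrable_const _).add (integrable_finsetSum _ fun d _ => hintg d))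
    (Eventually.of_forall hpt)).trans_eq ?_
  rw [integral_add' (integrable_const _) (integrable_finsetSum _ fun d _ => hintg d),
    integral_finsetSum _ fun d _ => hintg d]
  simp

lemma norm_integral_cexp_code_le (hinj : Function.Injective dg) {φ : (ℕ → ι) → ℝ}
    {m : Measure (ℕ → ι)} [IsProbabilityMeasure m]
    {C Cφ θ : ℝ} (hC : 1 ≤ C) (hCφ : 0 ≤ Cφ) (h0 : 0 < θ) (h1 : θ < 1) (hφ : Hol Cφ θ φ)
    (hN : Normalized φ) (hG : GibbsW C φ m) (hinv : MeasurePreserving shift m m)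
    {Ξ : ℝ} (hΞ : 0 < Ξ) {n : ℕ} (L : ℕ) {G : Finset (List ι)} (hGn : G ⊆ words ι n)
    (o : ℕ → ι) {Qm Qp M R β : ℝ} (hQm : 0 < Qm) (hM0 : 0 ≤ M) (hR0 : 0 ≤ R)
    (hQ1 : ∀ a ∈ G, Qm ≤ cQ dg a) (hQ2 : ∀ a ∈ G, cQ dg a ≤ Qp)
    (hM : ∀ a ∈ G, ∀ y, Real.exp (bs φ a y) ≤ M)
    (hR : ∀ a ∈ G, ∀ y, ∀ j < n,
      Real.exp (bs φ (a.drop (j + 1)) y) * cQ dg (a.drop (j + 1)) ≤ R)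
    (hβ : ∑ a ∈ words ι n \ G, m.real (cyl a) ≤ β) :
    ‖∫ y, Complex.exp ((Ξ * code dg y : ℝ) * Complex.I) ∂m‖ ≤
      2 * (Cφ / (1 - θ)) * θ ^ L + C * β + (Fintype.card ι : ℝ) ^ L *
        √(β + 2 * Ξ / Qm ^ 4 + 2 * Qp ^ 2 * (C * M) * (M + n * R * oscConst K Qm Qp Ξ)) := by
  refine (norm_integral_le_sum_expSum hd hK hC hCφ h0 h1 hφ hN hG hinv (Ξ := Ξ) L hGn o).trans ?_
  have hC0 : 0 < C := by linarith
  have hs1 : ∀ z, ∑ a ∈ G, Real.exp (bs φ a z) ≤ 1 := fun z => by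
    rw [← hN.sum_words n z]
    exact Finset.sum_le_sum_of_subset_of_nonneg hGn fun _ _ _ => (Real.exp_pos _).le
  have hsum : ∑ d ∈ words ι L, ∫ y, ‖expSum dg Ξ G (fun a => Real.exp (bs φ a (app d o)))
        (code dg y)‖ ∂m ≤ (Fintype.card ι : ℝ) ^ L *
        √(β + 2 * Ξ / Qm ^ 4 + 2 * Qp ^ 2 * (C * M) * (M + n * R * oscConst K Qm Qp Ξ)) := by
    rw [← Nat.cast_pow, ← card_words (ι := ι) L, ← nsmul_eq_mul]
    refine Finset.sum_le_card_nsmul _ _ _ fun d _ => ?_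
    set p : List ι → ℝ := fun a => Real.exp (bs φ a (app d o)) with hp
    have hp0 : ∀ a ∈ G, 0 ≤ p a := fun a _ => (Real.exp_pos _).le
    have hb : ∀ t, ‖expSum dg Ξ G p t‖ ≤ 1 := fun t =>
      (norm_expSum_le Ξ G p t hp0).trans (hs1 _)
    refine (integral_le_sqrt_integral_sq
      ((measurable_expSum Ξ G p).comp (continuous_code hd hK).measurable).norm
      (B := 1) fun y => by rw [abs_of_nonneg (norm_nonneg _)]; exact hb _).trans ?_
    refine Real.sqrt_le_sqrt ?_
    refine (integral_comp_code_le hd hK hinj (H := fun t => ‖expSum dg Ξ G p t‖ ^ 2)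
      ((measurable_expSum Ξ G p).norm.pow_const 2) (fun t => sq_nonneg _)
      (fun t => pow_le_one₀ (norm_nonneg _) (hb t)) (Λ := 2 * Ξ / Qm ^ 2) (by positivity)
      (fun x hx y hy => abs_sq_norm_expSum_sub_le hd hΞ.le hQm hp0 (hs1 _) hQ1 hx.1 hy.1)
      hGn hQm (M := C * M) (by positivity) hQ1 hQ2 fun b hb' => ?_).trans ?_
    · exact (hG b o).2.trans (mul_le_mul_of_nonneg_left (hM b hb' o) hC0.le)
    · have := integral_sq_norm_expSum_words_le hd hK hinj hN hΞ hQm (app d o) hGn hQ1 hQ2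
        (fun a ha => hM a ha _) (fun a ha j hj => hR a ha _ j hj) hM0 hR0
      have e : 2 * Ξ / Qm ^ 2 / Qm ^ 2 = 2 * Ξ / Qm ^ 4 := by
        rw [div_div, ← pow_add]
      rw [e]
      gcongr
  gcongr

end Decomposition

/-! ### Words with typical suffixes -/

section Typical

variable {ι : Type*} [Fintype ι] [TopologicalSpace ι] [DiscreteTopology ι]
  [MeasurableSpace ι] [BorelSpace ι]

lemma continuous_shift_iterate (n : ℕ) : Continuous (shift^[n] : (ℕ → ι) → (ℕ → ι)) :=
  continuous_shift.iterate n

lemma measurable_birkhoffSum_shift {f : (ℕ → ι) → ℝ} (hf : Continuous f) (n : ℕ) :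
    Measurable (birkhoffSum shift f n) := by
  unfold birkhoffSum
  exact Finset.measurable_fun_sum _ fun k _ =>
    (hf.comp (continuous_shift_iterate k)).measurable

lemma exists_large_deviation_family {κ : Type*} [Fintype κ] {C Cφ Cf θ : ℝ} {φ : (ℕ → ι) → ℝ}
    {f : κ → (ℕ → ι) → ℝ} {m : Measure (ℕ → ι)}
    [IsProbabilityMeasure m] (hC : 1 ≤ C) (h0 : 0 < θ) (h1 : θ < 1) (hCφ : 0 ≤ Cφ)
    (hφ : Hol Cφ θ φ) (hN : Normalized φ) (hG : GibbsW C φ m)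
    (hinv : MeasurePreserving shift m m) (hCf : 0 ≤ Cf) (hf : ∀ k, Hol Cf θ (f k))
    (hneg : ∀ k, ∫ y, f k y ∂m < 0) :
    ∃ K ≥ (0 : ℝ), ∃ δ > (0 : ℝ), ∀ n : ℕ,
      m.real (⋃ k, {y | 0 ≤ birkhoffSum shift (f k) n y}) ≤ K * Real.exp (-δ * n) := by
  choose K hK δ hδ h using fun k =>
    exists_large_deviation hC h0 h1 hCφ hφ hN hG hinv hCf (hf k) (hneg k)
  have hev : ∀ᶠ x in 𝓝[>] (0 : ℝ), ∀ k, x < δ k :=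
    eventually_all.2 fun k => eventually_nhdsWithin_of_eventually_nhds (eventually_lt_nhds (hδ k))
  obtain ⟨δ₀, h2, h3⟩ := (hev.and self_mem_nhdsWithin).exists
  refine ⟨∑ k, K k, Finset.sum_nonneg fun k _ => hK k, δ₀, h3, fun n => ?_⟩
  refine (measureReal_iUnion_fintype_le _).trans ?_
  rw [Finset.sum_mul]
  refine Finset.sum_le_sum fun k _ => (h k n).trans ?_
  have := hK k
  have := (h2 k).le
  gcongr

lemma exists_typical_words {κ : Type*} [Fintype κ] {C Cφ Cf θ : ℝ} {φ : (ℕ → ι) → ℝ}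
    {f : κ → (ℕ → ι) → ℝ} {m : Measure (ℕ → ι)}
    [IsProbabilityMeasure m] (hC : 1 ≤ C) (h0 : 0 < θ) (h1 : θ < 1) (hCφ : 0 ≤ Cφ)
    (hφ : Hol Cφ θ φ) (hN : Normalized φ) (hG : GibbsW C φ m)
    (hinv : MeasurePreserving shift m m) (hCf : 0 ≤ Cf) (hf : ∀ k, Hol Cf θ (f k))
    (hneg : ∀ k, ∫ y, f k y ∂m < 0) {ε : ℝ} (hε : 0 < ε) :
    ∃ K ≥ (0 : ℝ), ∃ δ > (0 : ℝ), ∀ n : ℕ, ∃ G ⊆ words ι n,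
      ∑ a ∈ words ι n \ G, m.real (cyl a) ≤ (n + 1) * (K * Real.exp (-δ * n)) ∧
      ∀ a ∈ G, ∀ j ≤ n, ε * n ≤ (n - j : ℕ) → ∃ z, ∀ k, bs (f k) (a.drop j) z < 0 := by
  obtain ⟨K, hK, δ, hδ, h⟩ :=
    exists_large_deviation_family hC h0 h1 hCφ hφ hN hG hinv hCf hf hneg
  refine ⟨K, hK, δ * ε, by positivity, fun n => ?_⟩
  set J : Finset ℕ := (Finset.range (n + 1)).filter fun j => ε * n ≤ (n - j : ℕ) with hJ
  set Bad : ℕ → Set (ℕ → ι) := fun i => ⋃ k, {y | 0 ≤ birkhoffSum shift (f k) i y} with hBad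
  have hBm : ∀ i, MeasurableSet (Bad i) := fun i => MeasurableSet.iUnion fun k =>
    measurableSet_le measurable_const
      (measurable_birkhoffSum_shift ((hf k).continuous h0.le h1) i)
  set E : Set (ℕ → ι) := ⋃ j ∈ J, shift^[j] ⁻¹' Bad (n - j) with hE
  have hEm : MeasurableSet E := Finset.measurableSet_biUnion _ fun j _ =>
    (continuous_shift_iterate j).measurable (hBm _)
  refine ⟨(words ι n).filter fun a => ¬ cyl a ⊆ E, Finset.filter_subset _ _, ?_, ?_⟩
  · calc _ = ∑ a ∈ words ι n \ (words ι n).filter (fun a => ¬ cyl a ⊆ E), m.real (cyl a ∩ E) := by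
          refine Finset.sum_congr rfl fun a ha => ?_
          rw [Finset.mem_sdiff, Finset.mem_filter] at ha
          have : cyl a ⊆ E := by
            by_contra hc
            exact ha.2 ⟨ha.1, hc⟩
          rw [inter_eq_left.2 this]
      _ ≤ ∑ a ∈ words ι n, m.real (cyl a ∩ E) :=
          Finset.sum_le_sum_of_subset_of_nonneg Finset.sdiff_subset
            fun _ _ _ => measureReal_nonneg
      _ = m.real E := sum_real_cyl_inter m n hEm
      _ ≤ ∑ j ∈ J, m.real (shift^[j] ⁻¹' Bad (n - j)) := measureReal_biUnion_finset_le _ _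
      _ ≤ ∑ j ∈ J, K * Real.exp (-(δ * ε) * n) := by
          refine Finset.sum_le_sum fun j hj => ?_
          rw [(hinv.iterate j).measureReal_preimage (hBm _).nullMeasurableSet]
          refine (h _).trans ?_
          have h2 := (Finset.mem_filter.1 hj).2
          have h3 := mul_le_mul_of_nonneg_left h2 hδ.le
          refine mul_le_mul_of_nonneg_left (Real.exp_le_exp.2 ?_) hK
          linarith
      _ = J.card * (K * Real.exp (-(δ * ε) * n)) := by rw [Finset.sum_const, nsmul_eq_mul]
      _ ≤ _ := by
          have : J.card ≤ n + 1 := (Finset.card_filter_le _ _).trans_eq (Finset.card_range _)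
          have : (J.card : ℝ) ≤ n + 1 := by exact_mod_cast this
          gcongr
  · intro a ha j hj hjn
    rw [Finset.mem_filter] at ha
    obtain ⟨y, hy, hyE⟩ := not_subset.1 ha.2
    have hlen := mem_words.1 ha.1
    refine ⟨shift^[n] y, fun k => ?_⟩
    by_contra hc
    push Not at hc
    refine hyE (mem_iUnion₂.2 ⟨j, Finset.mem_filter.2 ⟨Finset.mem_range.2 (by omega), hjn⟩,
      mem_iUnion.2 ⟨k, ?_⟩⟩)
    rw [bs_eq_birkhoffSum] at hc
    have e : app (a.drop j) (shift^[n] y) = shift^[j] y := by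
      have h2 : y = app a (shift^[n] y) := by
        have := app_pre n y
        rw [mem_cyl_iff, hlen] at hy
        rw [hy] at this
        exact this.symm
      have h3 : app a (shift^[n] y) = app (a.take j) (app (a.drop j) (shift^[n] y)) := by
        rw [← app_append, List.take_append_drop]
      conv_rhs => rw [h2, h3]
      have h4 := shift_iterate_app (a.take j) (app (a.drop j) (shift^[n] y))
      rw [List.length_take, hlen, min_eq_left hj] at h4
      exact h4.symm
    rw [e, List.length_drop, hlen] at hc
    exact hc

end Typical

/-! ### Exponential bounds along typical words -/

section Exponential

variable {ι : Type*}

lemma bs_add_const (f : (ℕ → ι) → ℝ) (c : ℝ) (w : List ι) (y : ℕ → ι) :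
    bs (fun y => f y + c) w y = bs f w y + c * w.length := by
  induction w with
  | nil => simp
  | cons a w ih => simp [ih]; ring

lemma bs_const_mul (f : (ℕ → ι) → ℝ) (c : ℝ) (w : List ι) (y : ℕ → ι) :
    bs (fun y => c * f y) w y = c * bs f w y := by
  induction w with
  | nil => simp
  | cons a w ih => simp [ih]; ring

lemma oscConst_exp_le (K : ℕ) (u v w : ℝ) :
    oscConst K (2⁻¹ * Real.exp u) (Real.exp v) (Real.exp w) ≤
      512 * √(((K : ℝ) + 1) ^ 3) * Real.exp (2 * v - u - w / 2) := by
  have h : (8 * Real.exp v ^ 4 / (2⁻¹ * Real.exp u)) *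
      (8 * ((K : ℝ) + 1) ^ 3 / ((2⁻¹ * Real.exp u) * Real.exp w)) =
      (16 * √(((K : ℝ) + 1) ^ 3) * Real.exp (2 * v - u - w / 2)) ^ 2 := by
    rw [mul_pow, mul_pow, Real.sq_sqrt (by positivity), ← Real.exp_nat_mul, ← Real.exp_nat_mul]
    have : Real.exp ((2 : ℕ) * (2 * v - u - w / 2)) =
        Real.exp ((4 : ℕ) * v) / (Real.exp u * Real.exp u * Real.exp w) := by
      rw [← Real.exp_add, ← Real.exp_add, ← Real.exp_sub]
      congr 1; push_cast; ring
    rw [this]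
    field_simp
    norm_num
  rw [oscConst, h, Real.sqrt_sq (by positivity)]
  exact le_of_eq (by ring)

variable [Fintype ι] [TopologicalSpace ι] [DiscreteTopology ι] [MeasurableSpace ι] [BorelSpace ι]
  {dg : ι → ℕ} (hd : ∀ a, 1 ≤ dg a) {K : ℕ} (hK : ∀ a, dg a ≤ K)
include hd hK

lemma typical_word_bounds {φ : (ℕ → ι) → ℝ} {Cφ θ lam h ε : ℝ}
    (hCφ : 0 ≤ Cφ) (h0 : 0 < θ) (h1 : θ < 1) (hφ : Hol Cφ θ φ) {w : List ι} {z : ℕ → ι}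
    (e1 : bs (fun y => -2 * Real.log (code dg y)) w z ≤ (lam + ε) * w.length)
    (e2 : (lam - ε) * w.length ≤ bs (fun y => -2 * Real.log (code dg y)) w z)
    (e3 : bs φ w z ≤ -(h - ε) * w.length) :
    2⁻¹ * Real.exp ((lam - ε) / 2 * w.length) ≤ cQ dg w ∧
    cQ dg w ≤ Real.exp ((lam + ε) / 2 * w.length) ∧
    ∀ y, Real.exp (bs φ w y) ≤ Real.exp (Cφ / (1 - θ)) * Real.exp (-(h - ε) * w.length) := by
  obtain ⟨b1, b2⟩ := bs_log_code_bounds hd hK w z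
  have hq := cQ_pos hd w
  refine ⟨?_, ?_, fun y => ?_⟩
  · have : (lam - ε) / 2 * w.length ≤ Real.log (2 * cQ dg w) := by linarith
    rw [Real.le_log_iff_exp_le (by positivity)] at this
    linarith
  · rw [← Real.log_le_iff_le_exp hq]
    linarith
  · rw [← Real.exp_add, Real.exp_le_exp]
    have := hφ.bs_le hCφ h0 h1 w (k := 0) (x := y) (y := z) (by simp)
    rw [pow_zero, mul_one] at this
    linarith [le_of_abs_le this]

lemma exists_typical_code_words {φ : (ℕ → ι) → ℝ} {m : Measure (ℕ → ι)} [IsProbabilityMeasure m]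
    {C Cφ θ : ℝ} (hC : 1 ≤ C) (hCφ : 0 ≤ Cφ) (h0 : 0 < θ) (h1 : θ < 1) (hφ : Hol Cφ θ φ)
    (hN : Normalized φ) (hG : GibbsW C φ m) (hinv : MeasurePreserving shift m m)
    {lam h ε : ℝ} (hlam : ∫ y, -2 * Real.log (code dg y) ∂m = lam) (hh : ∫ y, φ y ∂m = -h)
    (hε : 0 < ε) :
    ∃ K₁ ≥ (0 : ℝ), ∃ δ > (0 : ℝ), ∀ n : ℕ, ∃ G ⊆ words ι n,
      ∑ a ∈ words ι n \ G, m.real (cyl a) ≤ (n + 1) * (K₁ * Real.exp (-δ * n)) ∧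
      ∀ a ∈ G, ∀ j ≤ n, ε * n ≤ (n - j : ℕ) →
        2⁻¹ * Real.exp ((lam - ε) / 2 * (n - j : ℕ)) ≤ cQ dg (a.drop j) ∧
        cQ dg (a.drop j) ≤ Real.exp ((lam + ε) / 2 * (n - j : ℕ)) ∧
        ∀ y, Real.exp (bs φ (a.drop j) y) ≤
          Real.exp (Cφ / (1 - θ)) * Real.exp (-(h - ε) * (n - j : ℕ)) := by
  set ψ : (ℕ → ι) → ℝ := fun y => -2 * Real.log (code dg y) with hψ
  set θ' := max θ (ratio K)
  have t0 : 0 < θ' := lt_max_of_lt_left h0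
  have t1 : θ' < 1 := max_lt h1 (ratio_lt_one K)
  have hφ' : Hol Cφ θ' φ := hφ.mono_exp hCφ h0.le (le_max_left _ _)
  have hK0 : (0 : ℝ) ≤ 2 * (K + 1) := by positivity
  have hψ' : Hol (2 * (K + 1)) θ' ψ :=
    (hol_log_code hd hK).mono_exp hK0 (ratio_pos K).le (le_max_right _ _)
  have hmono : ∀ {c c' : ℝ} {f : (ℕ → ι) → ℝ}, Hol c θ' f → c ≤ c' → Hol c' θ' f := by
    intro c c' f hf hcc n x y hxy
    exact (hf n x y hxy).trans (by gcongr)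
  have hI : ∀ {f : (ℕ → ι) → ℝ}, Continuous f → Integrable f m := fun hf =>
    hf.integrable_of_hasCompactSupport (HasCompactSupport.of_compactSpace _)
  have iψ : Integrable ψ m := hI (hψ'.continuous t0.le t1)
  have iφ : Integrable φ m := hI (hφ'.continuous t0.le t1)
  let f : Fin 3 → (ℕ → ι) → ℝ := ![fun y => ψ y + (-lam - ε), fun y => (-1) * ψ y + (lam - ε),
    fun y => φ y + (h - ε)]
  have hf : ∀ k, Hol (2 * (K + 1) + Cφ) θ' (f k) := by
    intro k
    fin_cases k
    · exact hmono (hψ'.add_const _) (by linarith)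
    · exact hmono ((hψ'.const_mul (-1)).add_const _) (by simp; linarith)
    · exact hmono (hφ'.add_const _) (by linarith)
  have hneg : ∀ k, ∫ y, f k y ∂m < 0 := by
    intro k
    fin_cases k
    · change ∫ y, (ψ y + (-lam - ε)) ∂m < 0
      rw [integral_add iψ (integrable_const _), hlam]
      simp; linarith
    · change ∫ y, ((-1) * ψ y + (lam - ε)) ∂m < 0
      rw [integral_add (iψ.const_mul _) (integrable_const _), integral_const_mul, hlam]
      simp; linarith
    · change ∫ y, (φ y + (h - ε)) ∂m < 0
      rw [integral_add iφ (integrable_const _), hh]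
      simp; linarith
  obtain ⟨K₁, hK₁, δ, hδ, H⟩ := exists_typical_words hC t0 t1 hCφ hφ' hN hG hinv
    (by positivity) hf hneg hε
  refine ⟨K₁, hK₁, δ, hδ, fun n => ?_⟩
  obtain ⟨G, hGn, hβ, hGt⟩ := H n
  refine ⟨G, hGn, hβ, fun a ha j hj hjn => ?_⟩
  obtain ⟨z, hz⟩ := hGt a ha j hj hjn
  have hlen : (a.drop j).length = n - j := by
    rw [List.length_drop, mem_words.1 (hGn ha)]
  have z0 : bs (fun y => ψ y + (-lam - ε)) (a.drop j) z < 0 := hz 0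
  have z1 : bs (fun y => (-1) * ψ y + (lam - ε)) (a.drop j) z < 0 := hz 1
  have z2 : bs (fun y => φ y + (h - ε)) (a.drop j) z < 0 := hz 2
  rw [bs_add_const] at z0 z1 z2
  rw [bs_const_mul] at z1
  rw [← hlen]
  exact typical_word_bounds hd hK hCφ h0 h1 hφ (z := z) (by linarith) (by linarith) (by linarith)

end Exponential

/-! ### Power decay for the coded measure -/

section Decay

variable {ι : Type*} [Fintype ι] [TopologicalSpace ι] [DiscreteTopology ι]
  [MeasurableSpace ι] [BorelSpace ι]

lemma Normalized.exp_bs_le_one {φ : (ℕ → ι) → ℝ} (hN : Normalized φ) (w : List ι) (y : ℕ → ι) :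
    Real.exp (bs φ w y) ≤ 1 := by
  rw [← hN.sum_words w.length y]
  exact Finset.single_le_sum (f := fun l => Real.exp (bs φ l y))
    (fun _ _ => (Real.exp_pos _).le) (mem_words.2 rfl)

variable {dg : ι → ℕ} (hd : ∀ a, 1 ≤ dg a) {K : ℕ} (hK : ∀ a, dg a ≤ K)
include hd hK

lemma exists_norm_integral_cexp_code_le [Nonempty ι] (hinj : Function.Injective dg)
    {φ : (ℕ → ι) → ℝ} {m : Measure (ℕ → ι)} [IsProbabilityMeasure m]
    {C Cφ θ : ℝ} (hC : 1 ≤ C) (hCφ : 0 ≤ Cφ) (h0 : 0 < θ) (h1 : θ < 1) (hφ : Hol Cφ θ φ)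
    (hN : Normalized φ) (hG : GibbsW C φ m) (hinv : MeasurePreserving shift m m)
    {lam h : ℝ} (hlam : ∫ y, -2 * Real.log (code dg y) ∂m = lam) (hh : ∫ y, φ y ∂m = -h)
    (hlam0 : 0 < lam) (hdim : lam / 2 < h) :
    ∃ ρ > (0 : ℝ), ∃ D ≥ (0 : ℝ), ∃ κ > (0 : ℝ), ∀ n L : ℕ, ∀ Ξ : ℝ,
      Real.exp (ρ * n) ≤ Ξ → Ξ ≤ Real.exp (ρ * (n + 1)) →
      ‖∫ y, Complex.exp ((Ξ * code dg y : ℝ) * Complex.I) ∂m‖ ≤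
        D * θ ^ L + D * (n + 1) * Real.exp (-κ * n) +
          (Fintype.card ι : ℝ) ^ L * √(D * (n + 1) * Real.exp (-κ * n)) := by
  set Δ := h - lam / 2 with hΔ
  have hΔ0 : 0 < Δ := by rw [hΔ]; linarith
  set B := Real.log ((K : ℝ) + 1) with hB
  have hB0 : 0 ≤ B := Real.log_nonneg (by linarith [(Nat.cast_nonneg K : (0 : ℝ) ≤ K)])
  set ε := min (min (Δ / (2 * (B + 5))) (lam / 3)) 1 with hε
  have hε0 : 0 < ε := lt_min (lt_min (by positivity) (by positivity)) one_pos
  have hεB : ε * (B + 5) ≤ Δ / 2 := by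
    have : ε ≤ Δ / (2 * (B + 5)) := (min_le_left _ _).trans (min_le_left _ _)
    calc ε * (B + 5) ≤ Δ / (2 * (B + 5)) * (B + 5) := by gcongr
      _ = Δ / 2 := by field_simp
  have hεl : ε ≤ lam / 3 := (min_le_left _ _).trans (min_le_right _ _)
  have hεB' : 0 ≤ ε * B := by positivity
  have hhε : 0 < h - ε := by linarith
  obtain ⟨K₁, hK₁, δ, hδ, H⟩ :=
    exists_typical_code_words hd hK hC hCφ h0 h1 hφ hN hG hinv hlam hh hε0
  set C₁ := Cφ / (1 - θ) with hC₁
  have hC₁0 : 0 ≤ C₁ := div_nonneg hCφ (by linarith)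
  set s := √(((K : ℝ) + 1) ^ 3) with hs
  have hC0 : 0 < C := by linarith
  set ρ := 2 * lam - 3 * ε with hρ
  set κ := min δ ε with hκ
  have hκ0 : 0 < κ := lt_min hδ hε0
  have hκδ : κ ≤ δ := min_le_left _ _
  have hκε : κ ≤ ε := min_le_right _ _
  set D₁ := K₁ + 32 * Real.exp ρ + 2 * C * Real.exp C₁ ^ 2 +
    1024 * C * Real.exp C₁ ^ 2 * s with hD₁
  refine ⟨ρ, by linarith, 2 * C₁ + C * K₁ + D₁, by positivity, κ, hκ0, fun n L Ξ hΞ1 hΞ2 => ?_⟩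
  have hΞ : 0 < Ξ := (Real.exp_pos _).trans_le hΞ1
  obtain ⟨G, hGn, hβ, hGt⟩ := H n
  have hε1 : ε * n ≤ (n - 0 : ℕ) := by
    have : ε ≤ 1 := min_le_right _ _
    simpa using mul_le_of_le_one_left (Nat.cast_nonneg n) this
  set Qm := 2⁻¹ * Real.exp ((lam - ε) / 2 * n) with hQm
  set Qp := Real.exp ((lam + ε) / 2 * n) with hQp
  set M := Real.exp C₁ * Real.exp (-(h - ε) * n) with hM
  set R := Real.exp C₁ * Real.exp (B * (ε * n)) with hR
  set β := (n + 1) * (K₁ * Real.exp (-δ * n)) with hβ'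
  have key := norm_integral_cexp_code_le hd hK hinj hC hCφ h0 h1 hφ hN hG hinv hΞ L hGn
    (fun _ => Classical.arbitrary ι) (Qm := Qm) (Qp := Qp) (M := M) (R := R) (β := β)
    (by positivity) (by positivity) (by positivity)
    (fun a ha => by simpa only [List.drop_zero, Nat.sub_zero] using (hGt a ha 0 (Nat.zero_le _) hε1).1)
    (fun a ha => by simpa only [List.drop_zero, Nat.sub_zero] using (hGt a ha 0 (Nat.zero_le _) hε1).2.1)
    (fun a ha => by simpa only [List.drop_zero, Nat.sub_zero] using (hGt a ha 0 (Nat.zero_le _) hε1).2.2)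
    (fun a ha y j hj => by
      have e1 : 1 ≤ Real.exp C₁ := Real.one_le_exp hC₁0
      have q0 := cQ_pos hd (a.drop (j + 1))
      rcases le_or_gt (ε * n) ((n - (j + 1) : ℕ) : ℝ) with hc | hc
      · obtain ⟨-, t1, t2⟩ := hGt a ha (j + 1) hj hc
        have t2 := t2 y
        set i : ℝ := ((n - (j + 1) : ℕ) : ℝ)
        have hi : 0 ≤ i := Nat.cast_nonneg _
        calc _ ≤ (Real.exp C₁ * Real.exp (-(h - ε) * i)) * Real.exp ((lam + ε) / 2 * i) := by
              gcongr
          _ = Real.exp C₁ * Real.exp (-(Δ - 3 / 2 * ε) * i) := by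
              rw [mul_assoc, ← Real.exp_add]
              congr 2
              rw [hΔ]; ring
          _ ≤ Real.exp C₁ * Real.exp (B * (ε * n)) := by
              have : 0 ≤ (Δ - 3 / 2 * ε) * i := mul_nonneg (by nlinarith) hi
              have : 0 ≤ B * (ε * n) := by positivity
              exact mul_le_mul_of_nonneg_left (Real.exp_le_exp.2 (by linarith)) (Real.exp_pos _).le
      · have t1 := cQ_le_pow hd hK (a.drop (j + 1))
        rw [List.length_drop, mem_words.1 (hGn ha)] at t1
        have t2 : ((K : ℝ) + 1) ^ (n - (j + 1)) = Real.exp (B * (n - (j + 1) : ℕ)) := by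
          rw [mul_comm, Real.exp_nat_mul, hB, Real.exp_log (by positivity)]
        rw [t2] at t1
        calc _ ≤ 1 * Real.exp (B * (n - (j + 1) : ℕ)) := by
              have := hN.exp_bs_le_one (a.drop (j + 1)) y
              gcongr
          _ ≤ Real.exp C₁ * Real.exp (B * (ε * n)) := by gcongr) hβ
  set e := Real.exp (-κ * n) with he
  have he0 : 0 < e := Real.exp_pos _
  have hn0 : (0 : ℝ) ≤ n := Nat.cast_nonneg n
  have hexp : ∀ x : ℝ, x ≤ -κ → Real.exp (x * n) ≤ e := fun x hx =>
    Real.exp_le_exp.2 (mul_le_mul_of_nonneg_right hx hn0)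
  have hβ1 : β ≤ K₁ * (n + 1) * e := by
    have := hexp (-δ) (by linarith)
    calc β = K₁ * (n + 1) * Real.exp (-δ * n) := by rw [hβ']; ring
      _ ≤ _ := by gcongr
  have hX2 : 2 * Ξ / Qm ^ 4 ≤ 32 * Real.exp ρ * e := by
    have : 2 * Ξ / Qm ^ 4 = 32 * (Ξ * Real.exp (-(2 * (lam - ε) * n))) := by
      have : Qm ^ 4 = Real.exp (2 * (lam - ε) * n) / 16 := by
        rw [hQm, mul_pow, ← Real.exp_nat_mul,
          show ((4 : ℕ) : ℝ) * ((lam - ε) / 2 * n) = 2 * (lam - ε) * n by push_cast; ring]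
        ring
      rw [this, Real.exp_neg]
      field_simp
      norm_num
    rw [this, mul_assoc 32 (Real.exp ρ)]
    refine mul_le_mul_of_nonneg_left ?_ (by norm_num)
    calc _ ≤ Real.exp (ρ * (n + 1)) * Real.exp (-(2 * (lam - ε) * n)) := by gcongr
      _ = Real.exp ρ * Real.exp (-ε * n) := by
        rw [← Real.exp_add, ← Real.exp_add]
        congr 1
        rw [hρ]; ring
      _ ≤ _ := by
        have := hexp (-ε) (by linarith)
        gcongr
  have hosc : oscConst K Qm Qp Ξ ≤ 512 * s * Real.exp ((-lam / 2 + 3 * ε) * n) := by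
    have o1 : oscConst K Qm Qp Ξ ≤ oscConst K Qm Qp (Real.exp (ρ * n)) := by
      unfold oscConst
      gcongr
    refine o1.trans ((oscConst_exp_le _ _ _ _).trans_eq ?_)
    congr 2
    rw [hρ]; ring
  have hX3 : 2 * Qp ^ 2 * (C * M) * M ≤ 2 * C * Real.exp C₁ ^ 2 * e := by
    have : 2 * Qp ^ 2 * (C * M) * M = 2 * C * Real.exp C₁ ^ 2 * Real.exp ((-2 * Δ + 3 * ε) * n) := by
      have : Real.exp ((-2 * Δ + 3 * ε) * n) =
          Qp ^ 2 * (Real.exp (-(h - ε) * n)) ^ 2 := by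
        rw [hQp, ← Real.exp_nat_mul, ← Real.exp_nat_mul, ← Real.exp_add]
        congr 1
        rw [hΔ]; push_cast; ring
      rw [this, hM]; ring
    rw [this]
    have := hexp (-2 * Δ + 3 * ε) (by linarith)
    gcongr
  have hX4 : 2 * Qp ^ 2 * (C * M) * (n * R * oscConst K Qm Qp Ξ) ≤
      1024 * C * Real.exp C₁ ^ 2 * s * n * e := by
    calc _ ≤ 2 * Qp ^ 2 * (C * M) *
          (n * R * (512 * s * Real.exp ((-lam / 2 + 3 * ε) * n))) := by gcongr
      _ = 1024 * C * Real.exp C₁ ^ 2 * s * n * Real.exp ((-Δ + (B + 5) * ε) * n) := by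
        have : Real.exp ((-Δ + (B + 5) * ε) * n) =
            Qp ^ 2 * Real.exp (-(h - ε) * n) * Real.exp (B * (ε * n)) *
              Real.exp ((-lam / 2 + 3 * ε) * n) := by
          rw [hQp, ← Real.exp_nat_mul, ← Real.exp_add, ← Real.exp_add, ← Real.exp_add]
          congr 1
          rw [hΔ]; push_cast; ring
        rw [this, hM, hR]; ring
      _ ≤ _ := by
        have := hexp (-Δ + (B + 5) * ε) (by linarith)
        gcongr
  have hX : β + 2 * Ξ / Qm ^ 4 + 2 * Qp ^ 2 * (C * M) * (M + n * R * oscConst K Qm Qp Ξ) ≤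
      D₁ * (n + 1) * e := by
    have a1 : 0 ≤ 32 * Real.exp ρ * (n * e) := by positivity
    have a2 : 0 ≤ 2 * C * Real.exp C₁ ^ 2 * (n * e) := by positivity
    have a3 : 0 ≤ 1024 * C * Real.exp C₁ ^ 2 * s * e := by positivity
    rw [hD₁, mul_add (2 * Qp ^ 2 * (C * M))]
    linarith
  refine key.trans ?_
  have f0 : D₁ * (n + 1) * e ≤ (2 * C₁ + C * K₁ + D₁) * (n + 1) * e := by
    gcongr
    have : 0 ≤ C * K₁ := by positivity
    linarith
  have hD₁0 : 0 ≤ D₁ := by positivity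
  have hCK : 0 ≤ C * K₁ := by positivity
  have f1 : 2 * C₁ * θ ^ L ≤ (2 * C₁ + C * K₁ + D₁) * θ ^ L := by
    gcongr
    linarith
  have f2 : C * β ≤ (2 * C₁ + C * K₁ + D₁) * (n + 1) * e := by
    calc C * β ≤ C * (K₁ * (n + 1) * e) := by gcongr
      _ = (C * K₁) * (n + 1) * e := by ring
      _ ≤ _ := by
        gcongr
        linarith
  have f3 := Real.sqrt_le_sqrt (hX.trans f0)
  gcongr

end Decay

section PowerDecay

/-- Exponential bounds along a geometric progression of frequencies give power decay. -/
lemma exists_rpow_decay {F : ℝ → ℝ} {ρ D κ θ : ℝ} {N : ℕ} (hρ : 0 < ρ) (hD : 0 ≤ D) (hκ : 0 < κ)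
    (h0 : 0 < θ) (h1 : θ < 1) (hN : 1 ≤ N)
    (hF : ∀ n L : ℕ, ∀ Ξ : ℝ, Real.exp (ρ * n) ≤ Ξ → Ξ ≤ Real.exp (ρ * (n + 1)) →
      F Ξ ≤ D * θ ^ L + D * (n + 1) * Real.exp (-κ * n) +
        (N : ℝ) ^ L * √(D * (n + 1) * Real.exp (-κ * n))) :
    ∃ η > (0 : ℝ), ∃ B ≥ (0 : ℝ), ∀ Ξ : ℝ, 1 ≤ Ξ → F Ξ ≤ B * Ξ ^ (-η) := by
  set l := Real.log N with hl
  have hN' : (1 : ℝ) ≤ N := by exact_mod_cast hN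
  have hl0 : 0 ≤ l := Real.log_nonneg hN'
  set r := κ / (4 * (l + 1)) with hr
  have hr0 : 0 < r := by positivity
  have hlr : l * r ≤ κ / 4 := by
    rw [hr, mul_div_assoc', div_le_div_iff₀ (by positivity) (by norm_num)]
    nlinarith
  have hlog : Real.log θ < 0 := Real.log_neg h0 h1
  set τ := min (κ / 4) (r * -Real.log θ) with hτ
  have hτ0 : 0 < τ := lt_min (by positivity) (mul_pos hr0 (by linarith))
  have hτκ : τ ≤ κ / 4 := min_le_left _ _
  have hτθ : τ ≤ r * -Real.log θ := min_le_right _ _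
  set D₂ := D * θ⁻¹ + D + √D with hD₂
  have hD₂0 : 0 ≤ D₂ := by positivity
  refine ⟨τ / 2 / ρ, by positivity, D₂ * (1 + 2 / τ) * Real.exp (τ / 2), by positivity,
    fun Ξ hΞ => ?_⟩
  have hΞ0 : 0 < Ξ := by linarith
  set n := ⌊Real.log Ξ / ρ⌋₊ with hn
  have hn1 : ρ * n ≤ Real.log Ξ := by
    have := Nat.floor_le (div_nonneg (Real.log_nonneg hΞ) hρ.le)
    rw [le_div_iff₀ hρ] at this
    linarith
  have hn2 : Real.log Ξ ≤ ρ * (n + 1) := by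
    have := (Nat.lt_floor_add_one (Real.log Ξ / ρ)).le
    rw [div_le_iff₀ hρ] at this
    linarith
  have hn0 : (0 : ℝ) ≤ n := Nat.cast_nonneg n
  set L := ⌊r * n⌋₊ with hL
  have hL1 : (L : ℝ) ≤ r * n := Nat.floor_le (by positivity)
  have hL2 : r * n - 1 ≤ L := by linarith [Nat.lt_floor_add_one (r * n)]
  refine (hF n L Ξ ((Real.le_log_iff_exp_le hΞ0).1 hn1) ((Real.log_le_iff_le_exp hΞ0).1 hn2)).trans ?_
  set e := Real.exp (-τ * n) with he
  have he0 : 0 < e := Real.exp_pos _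
  have hexp : ∀ x : ℝ, x ≤ -τ → Real.exp (x * n) ≤ e := fun x hx =>
    Real.exp_le_exp.2 (mul_le_mul_of_nonneg_right hx hn0)
  have b1 : D * θ ^ L ≤ D * θ⁻¹ * (n + 1) * e := by
    have : θ ^ L ≤ θ⁻¹ * e := by
      have h2 : θ ^ L = Real.exp (L * Real.log θ) := by
        rw [Real.exp_nat_mul, Real.exp_log h0]
      have h3 : θ⁻¹ = Real.exp (-Real.log θ) := by rw [Real.exp_neg, Real.exp_log h0]
      rw [h2, h3, he, ← Real.exp_add, Real.exp_le_exp]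
      have h4 := mul_le_mul_of_nonneg_right hτθ hn0
      nlinarith
    calc D * θ ^ L ≤ D * (θ⁻¹ * e) := by gcongr
      _ = D * θ⁻¹ * 1 * e := by ring
      _ ≤ _ := by gcongr; linarith
  have b2 : D * (n + 1) * Real.exp (-κ * n) ≤ D * (n + 1) * e := by
    have := hexp (-κ) (by linarith)
    gcongr
  have b3 : (N : ℝ) ^ L * √(D * (n + 1) * Real.exp (-κ * n)) ≤ √D * (n + 1) * e := by
    have h2 : (N : ℝ) ^ L ≤ Real.exp (κ / 4 * n) := by
      have : (N : ℝ) ^ L = Real.exp (L * l) := by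
        rw [Real.exp_nat_mul, hl, Real.exp_log (by linarith)]
      rw [this, Real.exp_le_exp]
      calc L * l ≤ (r * n) * l := by gcongr
        _ = (l * r) * n := by ring
        _ ≤ _ := by gcongr
    have h3 : √(D * (n + 1) * Real.exp (-κ * n)) ≤ √D * (n + 1) * Real.exp (-κ / 2 * n) := by
      rw [Real.sqrt_le_left (by positivity)]
      have : Real.exp (-κ * n) = Real.exp (-κ / 2 * n) ^ 2 := by
        rw [← Real.exp_nat_mul]; congr 1; push_cast; ring
      rw [this, mul_pow, mul_pow, Real.sq_sqrt hD]
      gcongr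
      nlinarith
    calc _ ≤ Real.exp (κ / 4 * n) * (√D * (n + 1) * Real.exp (-κ / 2 * n)) := by gcongr
      _ = √D * (n + 1) * Real.exp (-(κ / 4) * n) := by
        have : Real.exp (-(κ / 4) * n) = Real.exp (κ / 4 * n) * Real.exp (-κ / 2 * n) := by
          rw [← Real.exp_add]; congr 1; ring
        rw [this]; ring
      _ ≤ _ := by
        have := hexp (-(κ / 4)) (by linarith)
        gcongr
  have b4 : (n + 1 : ℝ) * e ≤ (1 + 2 / τ) * Real.exp (-(τ / 2) * n) := by
    have h2 : τ / 2 * n ≤ Real.exp (τ / 2 * n) := by linarith [Real.add_one_le_exp (τ / 2 * n)]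
    have h3 : 1 ≤ Real.exp (τ / 2 * n) := Real.one_le_exp (by positivity)
    have h4 : (n : ℝ) + 1 ≤ (1 + 2 / τ) * Real.exp (τ / 2 * n) := by
      have : (n : ℝ) = 2 / τ * (τ / 2 * n) := by field_simp
      have h5 : 2 / τ * (τ / 2 * n) ≤ 2 / τ * Real.exp (τ / 2 * n) := by gcongr
      linarith
    calc _ ≤ ((1 + 2 / τ) * Real.exp (τ / 2 * n)) * e := by gcongr
      _ = _ := by
        rw [mul_assoc, he, ← Real.exp_add]
        congr 2; ring
  have b5 : Real.exp (-(τ / 2) * n) ≤ Real.exp (τ / 2) * Ξ ^ (-(τ / 2 / ρ)) := by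
    rw [Real.rpow_def_of_pos hΞ0, ← Real.exp_add, Real.exp_le_exp]
    have : Real.log Ξ * (τ / 2 / ρ) ≤ (ρ * (n + 1)) * (τ / 2 / ρ) := by gcongr
    have h6 : (ρ * (n + 1)) * (τ / 2 / ρ) = τ / 2 * (n + 1) := by field_simp
    linarith
  calc _ ≤ D₂ * ((n + 1) * e) := by rw [hD₂]; linarith
    _ ≤ D₂ * ((1 + 2 / τ) * (Real.exp (τ / 2) * Ξ ^ (-(τ / 2 / ρ)))) := by
      exact mul_le_mul_of_nonneg_left
        (b4.trans (mul_le_mul_of_nonneg_left b5 (by positivity))) hD₂0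
    _ = _ := by ring

variable {ι : Type*} [Fintype ι] [TopologicalSpace ι] [DiscreteTopology ι]
  [MeasurableSpace ι] [BorelSpace ι]
  {dg : ι → ℕ} (hd : ∀ a, 1 ≤ dg a) {K : ℕ} (hK : ∀ a, dg a ≤ K)
include hd hK

/-- Power decay of the oscillatory integrals of the coding map. -/
lemma exists_norm_integral_cexp_code_le_rpow [Nonempty ι] (hinj : Function.Injective dg)
    {φ : (ℕ → ι) → ℝ} {m : Measure (ℕ → ι)} [IsProbabilityMeasure m]
    {C Cφ θ : ℝ} (hC : 1 ≤ C) (hCφ : 0 ≤ Cφ) (h0 : 0 < θ) (h1 : θ < 1) (hφ : Hol Cφ θ φ)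
    (hN : Normalized φ) (hG : GibbsW C φ m) (hinv : MeasurePreserving shift m m)
    {lam h : ℝ} (hlam : ∫ y, -2 * Real.log (code dg y) ∂m = lam) (hh : ∫ y, φ y ∂m = -h)
    (hlam0 : 0 < lam) (hdim : lam / 2 < h) :
    ∃ η > (0 : ℝ), ∃ B ≥ (0 : ℝ), ∀ Ξ : ℝ, 1 ≤ Ξ →
      ‖∫ y, Complex.exp ((Ξ * code dg y : ℝ) * Complex.I) ∂m‖ ≤ B * Ξ ^ (-η) := by
  obtain ⟨ρ, hρ, D, hD, κ, hκ, H⟩ := exists_norm_integral_cexp_code_le hd hK hinj hC hCφ h0 h1 hφ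
    hN hG hinv hlam hh hlam0 hdim
  exact exists_rpow_decay hρ hD hκ h0 h1 (Nat.one_le_iff_ne_zero.2 Fintype.card_ne_zero) H

end PowerDecay

/-! ### Continued fraction digits as a symbolic coding -/

section Digits

lemma measurable_gaussMap : Measurable gaussMap := measurable_inv.fract

lemma measurable_cfDigit (i : ℕ) : Measurable (cfDigit i) :=
  Nat.measurable_floor.comp (measurable_inv.comp (measurable_gaussMap.iterate i))

lemma measurableSet_gaussSet : MeasurableSet gaussSet := by
  have : gaussSet = Icc 0 1 ∩ (range ((↑) : ℚ → ℝ))ᶜ := rfl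
  rw [this]
  exact measurableSet_Icc.inter (countable_range _).measurableSet.compl

lemma measurableSet_badSet (A : Finset ℕ) : MeasurableSet (badSet A) := by
  have : badSet A = gaussSet ∩ ⋂ i, cfDigit i ⁻¹' (A : Set ℕ) := by
    ext x; simp [badSet]
  rw [this]
  exact measurableSet_gaussSet.inter
    (MeasurableSet.iInter fun i => measurable_cfDigit i (MeasurableSet.of_discrete))

lemma pos_of_mem_gaussSet {x : ℝ} (hx : x ∈ gaussSet) : 0 < x :=
  lt_of_le_of_ne hx.1.1 hx.2.ne_zero.symm

lemma gaussMap_mem_gaussSet {x : ℝ} (hx : x ∈ gaussSet) : gaussMap x ∈ gaussSet := by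
  refine ⟨⟨Int.fract_nonneg _, (Int.fract_lt_one _).le⟩, ?_⟩
  have : gaussMap x = x⁻¹ - (⌊x⁻¹⌋ : ℤ) := rfl
  rw [this]
  exact hx.2.inv.sub_intCast _

lemma gaussMap_mem_badSet {A : Finset ℕ} {x : ℝ} (hx : x ∈ badSet A) : gaussMap x ∈ badSet A :=
  ⟨gaussMap_mem_gaussSet hx.1, fun i => hx.2 (i + 1)⟩

lemma eq_inv_cfDigit {x : ℝ} (hx : x ∈ gaussSet) : x = ((cfDigit 0 x : ℝ) + gaussMap x)⁻¹ := by
  have h0 := pos_of_mem_gaussSet hx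
  have h : (cfDigit 0 x : ℝ) = (⌊x⁻¹⌋ : ℤ) := by
    rw [← natCast_floor_eq_intCast_floor (inv_pos.2 h0).le]
    rfl
  rw [h, gaussMap, Int.floor_add_fract, inv_inv]

variable {A : Finset ℕ}

/-- The digit of a letter. -/
def digit (a : A) : ℕ := a.1

lemma digit_injective : Function.Injective (digit (A := A)) := Subtype.val_injective

lemma one_le_digit (hA0 : 0 ∉ A) (a : A) : 1 ≤ digit a :=
  Nat.one_le_iff_ne_zero.2 fun h => hA0 (by have := a.2; rwa [show a.1 = 0 from h] at this)

lemma digit_le (a : A) : digit a ≤ A.sup id := Finset.le_sup (f := id) a.2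

/-- The letter with a given digit, and `o` if there is none. -/
def letter (o : A) (k : ℕ) : A := if h : k ∈ A then ⟨k, h⟩ else o

/-- The sequence of letters of a number. -/
noncomputable def digits (o : A) (x : ℝ) : ℕ → A := fun i => letter o (cfDigit i x)

lemma measurable_digits (o : A) : Measurable (digits o) :=
  measurable_pi_lambda _ fun i => (measurable_from_nat (f := letter o)).comp (measurable_cfDigit i)

lemma shift_digits (o : A) (x : ℝ) : shift (digits o x) = digits o (gaussMap x) := rfl

lemma digit_digits (o : A) {x : ℝ} (hx : x ∈ badSet A) (i : ℕ) :
    digit (digits o x i) = cfDigit i x := by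
  simp [digits, letter, hx.2 i, digit]

variable (hA0 : 0 ∉ A)
include hA0

lemma code_mem_gaussSet (y : ℕ → A) : code digit y ∈ gaussSet :=
  ⟨⟨(code_pos (one_le_digit hA0) digit_le y).le, (code_lt_one (one_le_digit hA0) digit_le y).le⟩,
    irrational_code (one_le_digit hA0) digit_le y⟩

lemma inv_code (y : ℕ → A) : (code digit y)⁻¹ = (digit (y 0) : ℝ) + code digit (shift y) := by
  conv_lhs => rw [← scons_shift y, code_scons (one_le_digit hA0) digit_le, inv_inv]

lemma gaussMap_code (y : ℕ → A) : gaussMap (code digit y) = code digit (shift y) := by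
  rw [gaussMap, inv_code hA0, Int.fract_natCast_add, Int.fract_eq_self]
  exact ⟨(code_pos (one_le_digit hA0) digit_le _).le, code_lt_one (one_le_digit hA0) digit_le _⟩

lemma gaussMap_iterate_code (n : ℕ) (y : ℕ → A) :
    gaussMap^[n] (code digit y) = code digit (shift^[n] y) := by
  induction n generalizing y with
  | zero => rfl
  | succ n ih => rw [Function.iterate_succ_apply, Function.iterate_succ_apply, gaussMap_code hA0, ih]

lemma cfDigit_code (i : ℕ) (y : ℕ → A) : cfDigit i (code digit y) = digit (y i) := by
  rw [cfDigit, gaussMap_iterate_code hA0, cfDigit1, inv_code hA0, shift_iterate, zero_add,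
    add_comm, Nat.floor_add_natCast (code_pos (one_le_digit hA0) digit_le _).le,
    Nat.floor_eq_zero.2 (code_lt_one (one_le_digit hA0) digit_le _), zero_add]

lemma code_mem_badSet (y : ℕ → A) : code digit y ∈ badSet A :=
  ⟨code_mem_gaussSet hA0 y, fun i => by rw [cfDigit_code hA0]; exact (y i).2⟩

lemma br_digits (o : A) (n : ℕ) {x : ℝ} (hx : x ∈ badSet A) :
    br digit (pre n (digits o x)) (gaussMap^[n] x) = x := by
  induction n generalizing x with
  | zero => simp [pre]
  | succ n ih =>
    have hn : ∀ (n : ℕ) {x : ℝ}, x ∈ badSet A → gaussMap^[n] x ∈ badSet A := by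
      intro n
      induction n with
      | zero => exact fun h => h
      | succ n ihn => exact fun h => ihn (gaussMap_mem_badSet h)
    rw [pre, br_cons (one_le_digit hA0) _ _ (hn _ hx).1.1.1, digit_digits o hx,
      Function.iterate_succ_apply, shift_digits, ih (gaussMap_mem_badSet hx),
      ← eq_inv_cfDigit hx.1]

lemma code_digits (o : A) {x : ℝ} (hx : x ∈ badSet A) : code digit (digits o x) = x := by
  set K := A.sup id
  have hIcc : ∀ x ∈ badSet A, x ∈ Icc ((K : ℝ) + 1)⁻¹ 1 := by
    intro x hx
    refine ⟨?_, hx.1.1.2⟩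
    have h1 : (cfDigit 0 x : ℝ) ≤ K := by
      exact_mod_cast Finset.le_sup (f := id) (hx.2 0)
    have h2 := gaussMap_mem_badSet hx
    rw [eq_inv_cfDigit hx.1]
    have := pos_of_mem_gaussSet h2.1
    exact inv_anti₀ (by positivity) (by linarith [h2.1.1.2])
  have hn : ∀ (n : ℕ) {x : ℝ}, x ∈ badSet A → gaussMap^[n] x ∈ badSet A := by
    intro n
    induction n with
    | zero => exact fun h => h
    | succ n ihn => exact fun h => ihn (gaussMap_mem_badSet h)
  have hbound : ∀ n : ℕ, |code digit (digits o x) - x| ≤ ratio K ^ n * 1 := by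
    intro n
    have e1 : code digit (digits o x) =
        br digit (pre n (digits o x)) (code digit (shift^[n] (digits o x))) := by
      rw [← code_app (one_le_digit hA0) digit_le, app_pre]
    have m1 := hIcc _ (code_mem_badSet hA0 (shift^[n] (digits o x)))
    have m2 := hIcc _ (hn n hx)
    have := abs_br_sub_le_ratio (one_le_digit hA0) digit_le (pre n (digits o x)) m1 m2
    rw [← e1, br_digits hA0 o n hx, pre_length] at this
    refine this.trans (mul_le_mul_of_nonneg_left ?_ (pow_nonneg (ratio_pos K).le _))
    have h0 : (0 : ℝ) ≤ ((K : ℝ) + 1)⁻¹ := by positivity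
    rw [abs_le]
    constructor <;> linarith [m1.1, m1.2, m2.1, m2.2]
  have hlim := (tendsto_pow_atTop_nhds_zero_of_lt_one (ratio_pos K).le (ratio_lt_one K)).mul_const 1
  rw [zero_mul] at hlim
  have := ge_of_tendsto' hlim hbound
  exact sub_eq_zero.1 (abs_eq_zero.1 (le_antisymm this (abs_nonneg _)))

lemma birkhoff_code (φ : ℝ → ℝ) (n : ℕ) (y : ℕ → A) :
    birkhoff φ n (code digit y) = birkhoffSum shift (fun y => φ (code digit y)) n y := by
  unfold birkhoff birkhoffSum
  exact Finset.sum_congr rfl fun k _ => by rw [gaussMap_iterate_code hA0]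

lemma invBranch_code (l : List A) (y : ℕ → A) :
    invBranch (l.map digit) (code digit y) = code digit (app l y) := by
  induction l with
  | nil => rfl
  | cons a l ih =>
    rw [app_cons, code_scons (one_le_digit hA0) digit_le, ← ih, add_comm]
    rfl

omit hA0 in
lemma mem_cyl_iff_get {ι : Type*} {l : List ι} {y : ℕ → ι} :
    y ∈ cyl l ↔ ∀ i : Fin l.length, y i = l.get i := by
  induction l generalizing y with
  | nil => simp
  | cons a l ih =>
    rw [mem_cyl_cons, ih]
    constructor
    · rintro ⟨h1, h2⟩ ⟨i, hi⟩
      cases i with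
      | zero => exact h1
      | succ i => exact h2 ⟨i, by simpa using hi⟩
    · intro h
      exact ⟨h ⟨0, by simp⟩, fun i => h ⟨i + 1, by simp⟩⟩

omit hA0 in
lemma mem_cylinder_map_iff (o : A) (l : List A) {x : ℝ} (hx : x ∈ badSet A) :
    x ∈ cylinder (l.map digit) ↔ digits o x ∈ cyl l := by
  rw [mem_cyl_iff_get]
  constructor
  · rintro ⟨-, h⟩ i
    apply digit_injective
    rw [digit_digits o hx, h ⟨i, by simp⟩]
    simp
  · refine fun h => ⟨hx.1, fun i => ?_⟩
    have h2 := h ⟨i, by simpa using i.2⟩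
    rw [← digit_digits o hx]
    simp at h2 ⊢
    rw [h2]

lemma code_mem_cylinder_iff (l : List A) (y : ℕ → A) :
    code digit y ∈ cylinder (l.map digit) ↔ y ∈ cyl l := by
  rw [mem_cylinder_map_iff (y 0) l (code_mem_badSet hA0 y)]
  have : digits (y 0) (code digit y) = y := by
    funext i
    apply digit_injective
    rw [digit_digits _ (code_mem_badSet hA0 y), cfDigit_code hA0]
  rw [this]

end Digits

section Entropy

variable {ι : Type*} [Fintype ι] [TopologicalSpace ι] [DiscreteTopology ι]
  [MeasurableSpace ι] [BorelSpace ι]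

lemma abs_log_real_cyl_sub_le {C : ℝ} {g : (ℕ → ι) → ℝ} {m : Measure (ℕ → ι)} (hC : 1 ≤ C)
    (hG : GibbsW C g m) (n : ℕ) (y : ℕ → ι) :
    |Real.log (m.real (cyl (pre n y))) - birkhoffSum shift g n y| ≤ Real.log C := by
  obtain ⟨h1, h2⟩ := hG (pre n y) (shift^[n] y)
  rw [← birkhoffSum_eq_bs] at h1 h2
  have hC0 : 0 < C := by linarith
  have h3 : 0 < C⁻¹ * Real.exp (birkhoffSum shift g n y) := by positivity
  have l1 := Real.log_le_log h3 h1
  have l2 := Real.log_le_log (h3.trans_le h1) h2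
  rw [Real.log_mul (by positivity) (by positivity), Real.log_exp, Real.log_inv] at l1
  rw [Real.log_mul (by positivity) (by positivity), Real.log_exp] at l2
  rw [abs_le]
  constructor <;> linarith

lemma integral_birkhoffSum {g : (ℕ → ι) → ℝ} {m : Measure (ℕ → ι)} (hinv : MeasurePreserving shift m m)
    (hg : Integrable g m) (n : ℕ) :
    Integrable (birkhoffSum shift g n) m ∧ ∫ y, birkhoffSum shift g n y ∂m = n * ∫ y, g y ∂m := by
  have hk : ∀ k, Integrable (fun y => g (shift^[k] y)) m := fun k =>
    (hinv.iterate k).integrable_comp_of_integrable hg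
  constructor
  · exact integrable_finsetSum _ fun k _ => hk k
  · unfold birkhoffSum
    rw [integral_finsetSum _ fun k _ => hk k, Finset.sum_congr rfl (g := fun _ => ∫ y, g y ∂m)]
    · simp
    · intro k _
      conv_rhs => rw [← (hinv.iterate k).map_eq]
      rw [integral_map (hinv.iterate k).measurable.aemeasurable]
      rw [(hinv.iterate k).map_eq]
      exact hg.aestronglyMeasurable

lemma tendsto_entropy {C : ℝ} {g : (ℕ → ι) → ℝ} {m : Measure (ℕ → ι)} [IsProbabilityMeasure m]
    (hC : 1 ≤ C) (hG : GibbsW C g m) (hinv : MeasurePreserving shift m m) (hg : Integrable g m) :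
    Tendsto (fun n : ℕ => (∑ l ∈ words ι n, Real.negMulLog (m.real (cyl l))) / (n : ℝ)) atTop
      (𝓝 (-∫ y, g y ∂m)) := by
  have hintg : ∀ n : ℕ, ∀ l ∈ words ι n,
      Integrable ((cyl l).indicator fun _ => -Real.log (m.real (cyl l))) m :=
    fun n l _ => (integrable_const _).indicator (measurableSet_cyl l)
  have hsum : ∀ n : ℕ, ∑ l ∈ words ι n, Real.negMulLog (m.real (cyl l)) =
      ∫ y, -Real.log (m.real (cyl (pre n y))) ∂m := by
    intro n
    simp_rw [← sum_words_indicator n _ fun l => -Real.log (m.real (cyl l))]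
    rw [integral_finsetSum _ (hintg n)]
    refine Finset.sum_congr rfl fun l _ => ?_
    rw [integral_indicator (measurableSet_cyl l), setIntegral_const, Real.negMulLog, smul_eq_mul]
    ring
  have hbound : ∀ n : ℕ, |∑ l ∈ words ι n, Real.negMulLog (m.real (cyl l)) -
      n * -∫ y, g y ∂m| ≤ Real.log C := by
    intro n
    obtain ⟨hb1, hb2⟩ := integral_birkhoffSum hinv hg n
    have hF : Integrable (fun y => -Real.log (m.real (cyl (pre n y)))) m := by
      simp_rw [← sum_words_indicator n _ fun l => -Real.log (m.real (cyl l))]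
      exact integrable_finsetSum _ (hintg n)
    rw [hsum, mul_neg, ← hb2, sub_neg_eq_add, ← integral_add hF hb1]
    have := norm_integral_le_of_norm_le_const (μ := m) (C := Real.log C)
      (f := fun y => -Real.log (m.real (cyl (pre n y))) + birkhoffSum shift g n y)
      (Eventually.of_forall fun y => ?_)
    · simpa using this
    · rw [Real.norm_eq_abs, ← abs_neg, neg_add, neg_neg, ← sub_eq_add_neg]
      exact abs_log_real_cyl_sub_le hC hG n y
  rw [tendsto_iff_dist_tendsto_zero]
  refine squeeze_zero' (Eventually.of_forall fun n => dist_nonneg) ?_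
    (tendsto_const_div_atTop_nhds_zero_nat (Real.log C))
  filter_upwards [eventually_gt_atTop 0] with n hn
  have hn' : (0 : ℝ) < n := by exact_mod_cast hn
  rw [Real.dist_eq, le_div_iff₀ hn', ← abs_of_pos hn', ← abs_mul, abs_of_pos hn', sub_mul,
    div_mul_cancel₀ _ hn'.ne', mul_comm (-∫ y, g y ∂m)]
  exact hbound n

end Entropy

section Transport

variable {A : Finset ℕ} {μ : Measure ℝ} [IsProbabilityMeasure μ]

lemma ae_mem_badSet (hμX : μ (badSet A) = 1) : ∀ᵐ x ∂μ, x ∈ badSet A :=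
  (mem_ae_iff_prob_eq_one (measurableSet_badSet A)).2 hμX

lemma measurePreserving_shift_map_digits (hinv : GaussInvariant μ) (o : A) :
    MeasurePreserving shift (μ.map (digits o)) (μ.map (digits o)) := by
  have hs : Measurable (shift (ι := A)) :=
    measurable_pi_lambda _ fun i => measurable_pi_apply (i + 1)
  have hμ : μ.map gaussMap = μ := by
    ext s hs
    rw [Measure.map_apply measurable_gaussMap hs, hinv s hs]
  refine ⟨hs, ?_⟩
  rw [Measure.map_map hs (measurable_digits o)]
  have : shift ∘ digits o = digits o ∘ gaussMap := funext fun x => shift_digits o x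
  rw [this, ← Measure.map_map (measurable_digits o) measurable_gaussMap, hμ]

lemma map_digits_real_cyl (hμX : μ (badSet A) = 1) (o : A) (l : List A) :
    (μ.map (digits o)).real (cyl l) = (μ (cylinder (l.map digit))).toReal := by
  rw [Measure.real, Measure.map_apply (measurable_digits o) (measurableSet_cyl l)]
  congr 1
  refine measure_congr ?_
  filter_upwards [ae_mem_badSet hμX] with x hx
  exact propext (mem_cylinder_map_iff o l hx).symm

lemma hol_comp_code (hA0 : 0 ∉ A) {φ : ℝ → ℝ} (hφ : LocHolderOn A φ) :
    ∃ C ≥ (0 : ℝ), ∃ θ : ℝ, 0 < θ ∧ θ < 1 ∧ Hol C θ fun y : ℕ → A => φ (code digit y) := by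
  obtain ⟨C, hC, θ, hθ, H⟩ := hφ
  obtain ⟨C', hC', h⟩ := Hol.of_succ (ι := A) (C := C) (θ := θ)
    (f := fun y => φ (code digit y)) hθ.1.le (fun n x y hn hxy => by
      have hl : ((pre n x).map digit).length = n := by simp
      have := H ((pre n x).map digit) (List.ne_nil_of_length_pos (by rw [hl]; exact hn))
        (fun a ha => by
          obtain ⟨b, -, rfl⟩ := List.mem_map.1 ha
          exact b.2)
        (code digit x) ⟨(code_mem_cylinder_iff hA0 _ _).2 (mem_cyl_pre n x), code_mem_badSet hA0 x⟩
        (code digit y) ⟨(code_mem_cylinder_iff hA0 _ _).2 (mem_cyl_of_agree (mem_cyl_pre n x)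
          fun i hi => (hxy i (by simpa using hi)).symm), code_mem_badSet hA0 y⟩
      rwa [hl] at this)
  exact ⟨C', hC.le.trans hC', θ, hθ.1, hθ.2, h⟩

lemma gibbsW_map_digits (hA0 : 0 ∉ A) {φ : ℝ → ℝ} (hμX : μ (badSet A) = 1) (hG : IsGibbsOn A φ μ)
    (o : A) : ∃ C ≥ (1 : ℝ), GibbsW C (fun y => φ (code digit y)) (μ.map (digits o)) := by
  obtain ⟨C, hC, H⟩ := hG
  refine ⟨C, hC, fun l y => ?_⟩
  have : IsProbabilityMeasure (μ.map (digits o)) :=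
    Measure.isProbabilityMeasure_map (measurable_digits o).aemeasurable
  by_cases hl : l = []
  · subst hl
    simpa using ⟨inv_le_one_of_one_le₀ hC, hC⟩
  · have := H (l.map digit) (by simpa using hl)
      (fun a ha => by
        obtain ⟨b, -, rfl⟩ := List.mem_map.1 ha
        exact b.2) (code digit y) (code_mem_badSet hA0 y)
    rw [invBranch_code hA0, birkhoff_code hA0, List.length_map, ← bs_eq_birkhoffSum,
      ← map_digits_real_cyl hμX o] at this
    exact this

lemma integral_map_digits (hA0 : 0 ∉ A) (hμX : μ (badSet A) = 1) (o : A) {E : Type*}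
    [NormedAddCommGroup E] [NormedSpace ℝ E] {F : ℝ → E}
    (hF : AEStronglyMeasurable (fun y : ℕ → A => F (code digit y)) (μ.map (digits o))) :
    ∫ y, F (code digit y) ∂(μ.map (digits o)) = ∫ x, F x ∂μ := by
  rw [integral_map (measurable_digits o).aemeasurable hF]
  refine integral_congr_ae ?_
  filter_upwards [ae_mem_badSet hμX] with x hx
  rw [code_digits hA0 o hx]

lemma continuous_code_digit (hA0 : 0 ∉ A) : Continuous (code (digit (A := A))) :=
  continuous_code (one_le_digit hA0) digit_le

lemma integral_neg_two_mul_log_code (hA0 : 0 ∉ A) (hμX : μ (badSet A) = 1) (o : A) :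
    ∫ y, -2 * Real.log (code digit y) ∂(μ.map (digits o)) = lyapunov μ := by
  rw [integral_map_digits hA0 hμX o (F := fun x => -2 * Real.log x)]
  · unfold lyapunov logAbsDerivGauss
    simp [Real.log_pow]
  · exact (measurable_const.mul
      (Real.measurable_log.comp (continuous_code_digit hA0).measurable)).aestronglyMeasurable

lemma tsum_word_eq_sum_words (hA0 : 0 ∉ A) (hμX : μ (badSet A) = 1) (o : A) (n : ℕ) :
    ∑' l : Word n, Real.negMulLog (μ (cylinder l.1)).toReal =
      ∑ l ∈ words A n, Real.negMulLog ((μ.map (digits o)).real (cyl l)) := by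
  let f : words A n → Word n := fun l => ⟨l.1.map digit, by
    rw [List.length_map]; exact mem_words.1 l.2, fun a ha => by
      obtain ⟨b, -, rfl⟩ := List.mem_map.1 ha
      exact one_le_digit hA0 b⟩
  have hf : Function.Injective f := fun a b h => Subtype.ext
    (digit_injective.list_map (congrArg Subtype.val h))
  rw [← hf.tsum_eq (f := fun l : Word n => Real.negMulLog (μ (cylinder l.1)).toReal), tsum_fintype,
    ← Finset.sum_coe_sort (words A n)]
  · exact Finset.sum_congr rfl fun l _ => by rw [map_digits_real_cyl hμX o]
  · intro l hl
    have hne : μ (cylinder l.1) ≠ 0 := fun h0 => hl (by simp [h0])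
    have hex : ∃ x ∈ cylinder l.1, x ∈ badSet A := by
      by_contra! hno
      refine hne (measure_mono_null hno ?_)
      exact ae_mem_badSet hμX
    obtain ⟨x, hx, hxA⟩ := hex
    refine ⟨⟨pre n (digits o x), pre_mem_words n _⟩, Subtype.ext ?_⟩
    have hlen := l.2.1
    refine List.ext_getElem (by simp [hlen, f]) fun i h1 h2 => ?_
    have e1 := hx.2 ⟨i, h2⟩
    have e2 := mem_cyl_iff_get.1 (mem_cyl_pre n (digits o x)) ⟨i, by simpa [f] using h1⟩
    have e3 := digit_digits o hxA i
    simp only [List.get_eq_getElem] at e1 e2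
    rw [e2] at e3
    simp only [f, List.getElem_map]
    rw [e3, e1]

lemma norm_muFourier_eq (hA0 : 0 ∉ A) (hμX : μ (badSet A) = 1) (o : A) (ξ : ℝ) :
    ‖muFourier μ ξ‖ = ‖∫ y, Complex.exp ((2 * π * |ξ| * code digit y : ℝ) * Complex.I)
      ∂(μ.map (digits o))‖ := by
  have key : ∀ s : ℝ, ∫ y, Complex.exp ((s * code digit y : ℝ) * Complex.I) ∂(μ.map (digits o)) =
      ∫ x, Complex.exp ((s * x : ℝ) * Complex.I) ∂μ := fun s =>
    integral_map_digits hA0 hμX o (F := fun x => Complex.exp ((s * x : ℝ) * Complex.I))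
      (Continuous.aestronglyMeasurable (by have := continuous_code_digit hA0; fun_prop))
  rw [key]
  have h1 : muFourier μ ξ = ∫ x, Complex.exp ((2 * π * (-ξ) * x : ℝ) * Complex.I) ∂μ := by
    unfold muFourier
    refine integral_congr_ae (Eventually.of_forall fun x => ?_)
    simp
  rw [h1]
  rcases le_total ξ 0 with h | h
  · rw [abs_of_nonpos h]
  · rw [abs_of_nonneg h, ← RCLike.norm_conj, ← integral_conj]
    congr 1
    refine integral_congr_ae (Eventually.of_forall fun x => ?_)
    simp [← Complex.exp_conj, Complex.conj_ofNat]

end Transport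

end GaussGibbs

open GaussGibbs

/-- Any Gibbs measure for the Gauss map restricted to `B(𝒜)`, for a
finite alphabet `𝒜 ⊂ ℕ` with at least two elements, with Hausdorff dimension
`h_μ/λ_μ > 1/2`, has polynomially decaying Fourier transform. -/
theorem gibbs_badly_approximable_fourier_decay
    (A : Finset ℕ) (hA0 : 0 ∉ A) (hA2 : 2 ≤ A.card)
    (φ : ℝ → ℝ) (μ : MeasureTheory.Measure ℝ) [MeasureTheory.IsProbabilityMeasure μ]
    (hμX : μ (badSet A) = 1) (hinv : GaussInvariant μ)
    (hφH : LocHolderOn A φ) (hGibbs : IsGibbsOn A φ μ)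
    (h : ℝ) (hent : HasEntropy μ h) (hdim : 1/2 < h / lyapunov μ) :
    ∃ η > (0:ℝ), ∃ K : ℝ, ∀ ξ : ℝ, 1 ≤ |ξ| →
      ‖muFourier μ ξ‖ ≤ K * |ξ| ^ (-η) := by
  obtain ⟨o', ho⟩ : A.Nonempty := Finset.card_pos.1 (by omega)
  let o : A := ⟨o', ho⟩
  have : Nonempty A := ⟨o⟩
  have : IsProbabilityMeasure (μ.map (digits o)) :=
    Measure.isProbabilityMeasure_map (measurable_digits o).aemeasurable
  obtain ⟨C₀, hC₀, θ, h0, h1, hHol⟩ := hol_comp_code hA0 hφH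
  obtain ⟨C, hC, hG⟩ := gibbsW_map_digits hA0 hμX hGibbs o
  obtain ⟨g, C', hC', C₁, hC₁, hN, hgHol, hgG⟩ := exists_normalized hC hG hC₀ h0 h1 hHol
  have hshift := measurePreserving_shift_map_digits hinv o
  have hgint : Integrable g (μ.map (digits o)) :=
    (hgHol.continuous h0.le h1).integrable_of_hasCompactSupport
      (HasCompactSupport.of_compactSpace g)
  have hh : ∫ y, g y ∂(μ.map (digits o)) = -h := by
    have t1 := tendsto_entropy hC' hgG hshift hgint
    have t2 : Tendsto (fun n : ℕ => (∑ l ∈ words A n,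
        Real.negMulLog ((μ.map (digits o)).real (cyl l))) / (n : ℝ)) atTop (𝓝 h) := by
      refine hent.congr fun n => ?_
      rw [tsum_word_eq_sum_words hA0 hμX o]
    linarith [tendsto_nhds_unique t1 t2]
  have hlam := integral_neg_two_mul_log_code hA0 hμX o
  have hlam0 : 0 < lyapunov μ := by
    refine lt_of_le_of_ne ?_ fun h0 => ?_
    · rw [← hlam]
      refine integral_nonneg fun y => ?_
      have := Real.log_nonpos (code_mem_gaussSet hA0 y).1.1 (code_mem_gaussSet hA0 y).1.2
      change 0 ≤ -2 * Real.log (code digit y)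
      linarith
    · rw [← h0, div_zero] at hdim
      norm_num at hdim
  have hdim' : lyapunov μ / 2 < h := by
    rw [lt_div_iff₀ hlam0] at hdim
    linarith
  obtain ⟨η, hη, B, hB, H⟩ := exists_norm_integral_cexp_code_le_rpow (one_le_digit hA0) digit_le
    digit_injective hC' hC₁ h0 h1 hgHol hN hgG hshift hlam hh hlam0 hdim'
  refine ⟨η, hη, B, fun ξ hξ => ?_⟩
  have hπ : |ξ| ≤ 2 * π * |ξ| := by nlinarith [Real.pi_gt_three]
  rw [norm_muFourier_eq hA0 hμX o]
  refine (H (2 * π * |ξ|) (hξ.trans hπ)).trans (mul_le_mul_of_nonneg_left ?_ hB)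
  exact Real.rpow_le_rpow_of_nonpos (by linarith) hπ (by linarith)
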